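/- Let p₁ ≡ 3 (mod 8) be a prime with p₁ ≠ 3, let m ≥ 1, and set N = 2p₁^m. Let h be the class number of Q(√(−p₁)), and assume 1 + p₁ = 4p^h, where p is a prime with ord_N(p) = φ(N)/2. Let f = ord_N(p) and q = p^f. Let J ⊆ Z_{2p₁} be J = ⟨p⟩ ∪ 2⟨p⟩ ∪ {0}, where ⟨p⟩ is the subgroup of Z_{2p₁}^* generated by p. Then there exists a primitive element γ of F_q such that, with C_i = γ^i⟨γ^N⟩ the cyclotomic classes of order N and D = ⋃_{i=0}^{p₁^{m−1}−1} ⋃_{j∈J} C_{2i + p₁^{m−1}j}, the set {Σ_{x∈D} ψ(γ^a x) : a = 0, 1, …, q−2} has exactly two elements, namely (−1 + (−1)^{(p−1)(m−1)/2}·w)/2 and (−1 − (−1)^{(p−1)(m−1)/2}·w)/2, where w is the principal square root of (−1)^{(p−1)/2}·p^f in C. -/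

import Mathlib

open scoped Classical

/-- The cyclotomic class `C_i = γ^i ⟨γ^N⟩ = {γ^{i+Nk} : k ∈ ℤ}` of order `N` of a finite
field, with respect to the primitive element `γ`. -/
def cycClass {F : Type*} [Field F] (γ : Fˣ) (N i : ℕ) : Set F :=
  {x : F | ∃ k : ℤ, x = ((γ ^ ((i : ℤ) + (N : ℤ) * k) : Fˣ) : F)}

/-- The canonical additive character `ψ(x) = exp(2πi·Tr_{q/p}(x)/p)` of a finite field of
characteristic `p`. -/
noncomputable def psi (p : ℕ) {F : Type*} [Field F] [Fintype F] [Algebra (ZMod p) F]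
    (x : F) : ℂ :=
  Complex.exp (2 * Real.pi * Complex.I * ((Algebra.trace (ZMod p) F x).val : ℂ) / p)

section PartA
open NumberField Ideal

noncomputable def quadCharC (p₁ : ℕ) [Fact p₁.Prime] : DirichletCharacter ℂ p₁ :=
  (quadraticChar (ZMod p₁)).ringHomComp (Int.castRingHom ℂ)

noncomputable def idealCount (K : Type*) [Field K] [NumberField K] (n : ℕ) : ℕ :=
  Nat.card {I : Ideal (𝓞 K) // absNorm I = n}

lemma idealCount_mul (K : Type*) [Field K] [NumberField K] {m n : ℕ} (h : m.Coprime n) (hm : m ≠ 0)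
    (hn : n ≠ 0) : idealCount K m * idealCount K n ≤ idealCount K (m * n) := by
  unfold idealCount
  rw [← Nat.card_prod]
  have hfin : Finite {I : Ideal (𝓞 K) // absNorm I = m * n} := Ideal.finite_setOfPred_absNorm_eq (m * n)
  have cop : ∀ I J : Ideal (𝓞 K), absNorm I = m → absNorm J = n → IsCoprime I J := by
    intro I J hI hJ
    rw [Ideal.isCoprime_iff_exists]
    have h1 : ((m : ℤ) : 𝓞 K) ∈ I := by rw [← hI]; exact_mod_cast absNorm_mem I
    have h2 : ((n : ℤ) : 𝓞 K) ∈ J := by rw [← hJ]; exact_mod_cast absNorm_mem J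
    obtain ⟨a, b, hab⟩ := Nat.isCoprime_iff_coprime.mpr h
    refine ⟨(a : 𝓞 K) * ((m : ℤ) : 𝓞 K), I.mul_mem_left _ h1, (b : 𝓞 K) * ((n : ℤ) : 𝓞 K), J.mul_mem_left _ h2, ?_⟩
    exact_mod_cast congrArg (Int.cast : ℤ → 𝓞 K) hab
  refine Nat.card_le_card_of_injective (fun x => ⟨x.1.1 * x.2.1, by rw [map_mul, x.1.2, x.2.2]⟩) ?_
  rintro ⟨⟨I, hI⟩, ⟨J, hJ⟩⟩ ⟨⟨I', hI'⟩, ⟨J', hJ'⟩⟩ hh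
  simp only [Subtype.mk.injEq] at hh
  have e1 : I = I' := by
    apply dvd_antisymm
    · exact (cop I J' hI hJ').dvd_of_dvd_mul_right (hh ▸ dvd_mul_right I J)
    · exact (cop I' J hI' hJ).dvd_of_dvd_mul_right (hh ▸ dvd_mul_right I' J')
  have e2 : J = J' := by
    apply dvd_antisymm
    · exact (cop I' J hI' hJ).symm.dvd_of_dvd_mul_left (hh ▸ dvd_mul_left J I)
    · exact (cop I J' hI hJ').symm.dvd_of_dvd_mul_left (hh ▸ dvd_mul_left J' I')
  subst e1; subst e2; rfl

lemma minpoly_alpha (p₁ : ℕ) [Fact p₁.Prime] (K : Type*) [Field K] [NumberField K] (α : K)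
    (hα : α ^ 2 = -(p₁ : K)) : minpoly ℚ α = Polynomial.X ^ 2 + Polynomial.C (p₁ : ℚ) := by
  symm
  have hp : 0 < (p₁ : ℚ) := by exact_mod_cast (Fact.out : p₁.Prime).pos
  have hd : (Polynomial.X ^ 2 + Polynomial.C (p₁ : ℚ)).natDegree = 2 := by compute_degree!
  have hm : (Polynomial.X ^ 2 + Polynomial.C (p₁ : ℚ)).Monic := by monicity!
  apply minpoly.eq_of_irreducible_of_monic _ _ hm
  · rw [Polynomial.irreducible_iff_roots_eq_zero_of_degree_le_three (by omega) (by omega)]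
    rw [Multiset.eq_zero_iff_forall_notMem]
    intro x hx
    rw [Polynomial.mem_roots hm.ne_zero] at hx
    simp [Polynomial.IsRoot] at hx
    nlinarith [sq_nonneg x]
  · simp [hα]

lemma finrank_K (p₁ : ℕ) [Fact p₁.Prime] (K : Type*) [Field K] [NumberField K] (α : K)
    (hα : α ^ 2 = -(p₁ : K)) (hKα : Algebra.adjoin ℚ {α} = ⊤) : Module.finrank ℚ K = 2 := by
  have hi : IsIntegral ℚ α := Algebra.IsIntegral.isIntegral α
  have h1 : IntermediateField.adjoin ℚ {α} = ⊤ := by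
    rw [eq_top_iff]
    intro x _
    have : x ∈ Algebra.adjoin ℚ {α} := by rw [hKα]; trivial
    exact IntermediateField.algebra_adjoin_le_adjoin _ _ this
  have h2 := IntermediateField.adjoin.finrank hi
  rw [h1, IntermediateField.finrank_top', minpoly_alpha p₁ K α hα] at h2
  rw [h2]; compute_degree!

lemma trace_alpha (p₁ : ℕ) [Fact p₁.Prime] (K : Type*) [Field K] [NumberField K] (α : K)
    (hα : α ^ 2 = -(p₁ : K)) : Algebra.trace ℚ K α = 0 := by
  rw [trace_eq_finrank_mul_minpoly_nextCoeff, minpoly_alpha p₁ K α hα]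
  have : (Polynomial.X ^ 2 + Polynomial.C (p₁ : ℚ)).natDegree = 2 := by compute_degree!
  rw [Polynomial.nextCoeff_of_natDegree_pos (by omega), this]
  simp

/-- key: ideals of norm `ℓ^k`. -/
lemma idealCount_split (p₁ : ℕ) [Fact p₁.Prime] (K : Type*) [Field K] [NumberField K] (α : K)
    (hα : α ^ 2 = -(p₁ : K)) (hKα : Algebra.adjoin ℚ {α} = ⊤) (l : ℕ) (hl : l.Prime) (hl2 : l ≠ 2)
    (t : ℤ) (ht : (l : ℤ) ∣ t ^ 2 + p₁) (hlp : l ≠ p₁) (k : ℕ) : k + 1 ≤ idealCount K (l ^ k) := by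
  have hIntg : IsIntegral ℤ α := by
    refine ⟨Polynomial.X ^ 2 + Polynomial.C (p₁ : ℤ), by monicity!, ?_⟩
    simp [hα]
  obtain ⟨a, rfl⟩ : ∃ a : 𝓞 K, (a : K) = α := ⟨⟨α, hIntg⟩, rfl⟩
  have ha : a ^ 2 = -(p₁ : 𝓞 K) := by
    apply RingOfIntegers.ext; push_cast; exact hα
  have hlt : ¬ (l : ℤ) ∣ 2 * t := by
    intro hd
    have hlZ : Prime (l : ℤ) := Nat.prime_iff_prime_int.mp hl
    rcases hlZ.dvd_or_dvd hd with h | h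
    · have h' : l ∣ 2 := by exact_mod_cast h
      exact hl2 ((Nat.prime_dvd_prime_iff_eq hl Nat.prime_two).mp h')
    · have h3 : (l : ℤ) ∣ p₁ := by
        have := dvd_sub ht (dvd_pow h (two_ne_zero)); simpa using this
      have h' : l ∣ p₁ := by exact_mod_cast h3
      exact hlp ((Nat.prime_dvd_prime_iff_eq hl Fact.out).mp h')
  obtain ⟨u, v, huv⟩ : IsCoprime (l : ℤ) (2 * t) := by
    rw [(Nat.prime_iff_prime_int.mp hl).coprime_iff_not_dvd]; exact hlt
  have huv' : (u : 𝓞 K) * l + v * (2 * t) = 1 := by exact_mod_cast congrArg (Int.cast : ℤ → 𝓞 K) huv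
  set L : Ideal (𝓞 K) := span {(l : 𝓞 K), a - t} with hL
  set L' : Ideal (𝓞 K) := span {(l : 𝓞 K), a + t} with hL'
  have lL : (l : 𝓞 K) ∈ L := subset_span (by simp)
  have lL' : (l : 𝓞 K) ∈ L' := subset_span (by simp)
  have mL : a - t ∈ L := subset_span (by simp)
  have mL' : a + t ∈ L' := subset_span (by simp)
  have hmul : L * L' = span {(l : 𝓞 K)} := by
    apply le_antisymm
    · rw [hL, hL', span_mul_span', span_le]
      obtain ⟨c, hc⟩ := ht
      have hc' : (t : 𝓞 K) ^ 2 + p₁ = l * c := by exact_mod_cast congrArg (Int.cast : ℤ → 𝓞 K) hc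
      rintro x ⟨y, hy, z, hz, rfl⟩
      simp only [SetLike.mem_coe, mem_span_singleton]
      simp only [Set.mem_insert_iff, Set.mem_singleton_iff] at hy hz
      rcases hy with rfl | rfl
      · exact dvd_mul_right _ _
      · rcases hz with rfl | rfl
        · exact dvd_mul_left _ _
        · refine ⟨-c, ?_⟩
          linear_combination ha - hc'
    · rw [span_singleton_le_iff_mem]
      have e : (l : 𝓞 K) = u * (l * l) + v * (l * (a + t) - (a - t) * l) := by
        linear_combination (-(l : 𝓞 K)) * huv'
      rw [e]
      refine add_mem (mul_mem_left _ _ (mul_mem_mul lL lL')) (mul_mem_left _ _ (sub_mem (mul_mem_mul lL mL') (mul_mem_mul mL lL')))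
  have hcop : IsCoprime L L' := by
    rw [Ideal.isCoprime_iff_exists]
    refine ⟨u * l - v * (a - t), sub_mem (mul_mem_left _ _ lL) (mul_mem_left _ _ mL), v * (a + t), mul_mem_left _ _ mL', ?_⟩
    linear_combination huv'
  have hnorm : absNorm L * absNorm L' = l ^ 2 := by
    rw [← map_mul, hmul, absNorm_span_singleton]
    have : (l : 𝓞 K) = algebraMap ℤ (𝓞 K) l := by simp
    rw [this, Algebra.norm_algebraMap, RingOfIntegers.rank, finrank_K p₁ K _ hα hKα]
    simp [Int.natAbs_pow]
  have hnot : ∀ s : ℤ, (¬ (l : ℤ) ∣ 2 * s) → ¬ ((a + s) ∈ span {(l : 𝓞 K)}) := by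
    intro s hs hmem
    rw [mem_span_singleton] at hmem
    obtain ⟨b, hb⟩ := hmem
    apply hs
    have h1 : Algebra.trace ℚ K ((a : K) + (s : K)) = 2 * s := by
      rw [map_add, trace_alpha p₁ K _ hα, zero_add]
      have : (s : K) = algebraMap ℚ K s := by simp
      rw [this, Algebra.trace_algebraMap, finrank_K p₁ K _ hα hKα]; simp
    have h2 : (a : K) + (s : K) = (l : ℚ) • (b : K) := by
      have := congrArg (algebraMap (𝓞 K) K) hb
      simp at this
      rw [this, Algebra.smul_def]; simp
    rw [h2, map_smul] at h1
    have h3 : IsIntegral ℤ (Algebra.trace ℚ K (b : K)) := Algebra.isIntegral_trace (RingOfIntegers.isIntegral_coe b)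
    obtain ⟨z, hz⟩ := IsIntegrallyClosed.isIntegral_iff.mp h3
    refine ⟨z, ?_⟩
    rw [← hz] at h1
    simp at h1
    exact_mod_cast h1.symm
  have hL1 : absNorm L ≠ 1 := by
    intro h
    rw [absNorm_eq_one_iff] at h
    rw [h, top_mul] at hmul
    exact hnot t hlt (hmul ▸ mL')
  have hL1' : absNorm L' ≠ 1 := by
    intro h
    rw [absNorm_eq_one_iff] at h
    rw [h, mul_top] at hmul
    refine hnot (-t) (by simpa using hlt) (hmul ▸ ?_)
    simpa [sub_eq_add_neg] using mL
  obtain ⟨n1, n2⟩ : absNorm L = l ∧ absNorm L' = l := by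
    have := (Nat.Prime.mul_eq_prime_sq_iff hl hL1 hL1').mp hnorm
    exact this
  have hL0 : L ≠ 0 := by
    intro h; rw [h] at n1; simp at n1; exact hl.ne_zero n1.symm
  have hL0' : L' ≠ 0 := by
    intro h; rw [h] at n2; simp at n2; exact hl.ne_zero n2.symm
  unfold idealCount
  have hfin : Finite {I : Ideal (𝓞 K) // absNorm I = l ^ k} := Ideal.finite_setOfPred_absNorm_eq _
  rw [← Nat.card_fin (k + 1)]
  refine Nat.card_le_card_of_injective (fun i => ⟨L ^ (i : ℕ) * L' ^ (k - (i : ℕ)), ?_⟩) ?_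
  · rw [map_mul, map_pow, map_pow, n1, n2, ← pow_add]; congr 1; omega
  · have key : ∀ i j : ℕ, i < j → j ≤ k → L ^ i * L' ^ (k - i) ≠ L ^ j * L' ^ (k - j) := by
      intro i j hij hjk he
      have e1 : L ^ j = L ^ i * L ^ (j - i) := by rw [← pow_add]; congr 1; omega
      have e2 : L' ^ (k - i) = L' ^ (j - i) * L' ^ (k - j) := by rw [← pow_add]; congr 1; omega
      rw [e1, e2] at he
      have : L' ^ (j - i) = L ^ (j - i) := by
        have h0 : L ^ i * L' ^ (k - j) ≠ 0 := mul_ne_zero (pow_ne_zero _ hL0) (pow_ne_zero _ hL0')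
        apply mul_left_cancel₀ h0
        calc _ = L ^ i * (L' ^ (j - i) * L' ^ (k - j)) := by ring
          _ = _ := by rw [he]; ring
      have hc := hcop.pow (m := j - i) (n := j - i)
      rw [this, isCoprime_self, Ideal.isUnit_iff, ← absNorm_eq_one_iff, map_pow, n1] at hc
      have := Nat.pow_eq_one.mp hc
      rcases this with h | h
      · exact hl.one_lt.ne' h
      · omega
    intro i j hij
    simp only [Subtype.mk.injEq] at hij
    rcases lt_trichotomy i j with h | h | h
    · exact absurd hij (key i j h (by omega))
    · exact h
    · exact absurd hij.symm (key j i h (by omega))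

lemma idealCount_pos_of_exists (K : Type*) [Field K] [NumberField K] (n : ℕ) (I : Ideal (𝓞 K))
    (hI : absNorm I = n) : 1 ≤ idealCount K n := by
  have hfin : Finite {I : Ideal (𝓞 K) // absNorm I = n} := Ideal.finite_setOfPred_absNorm_eq _
  have : Nonempty {I : Ideal (𝓞 K) // absNorm I = n} := ⟨⟨I, hI⟩⟩
  exact Nat.card_pos

end PartA

section PartA2
open NumberField Ideal
open scoped ComplexOrder

lemma quadChar_two (p₁ : ℕ) [Fact p₁.Prime] (h8 : p₁ % 8 = 3) : quadraticChar (ZMod p₁) 2 = -1 := by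
  rw [quadraticChar_two (by rw [ZMod.ringChar_zmod_n]; omega), ZMod.card,
    ZMod.χ₈_nat_eq_if_mod_eight]
  have : p₁ % 2 ≠ 0 := by omega
  simp [this, h8]

lemma quadChar_neg_one (p₁ : ℕ) [Fact p₁.Prime] (h8 : p₁ % 8 = 3) : quadraticChar (ZMod p₁) (-1) = -1 := by
  rw [quadraticChar_neg_one (by rw [ZMod.ringChar_zmod_n]; omega), ZMod.card]
  exact ZMod.χ₄_nat_three_mod_four (by omega)

lemma quadChar_recip (p₁ : ℕ) [Fact p₁.Prime] (h8 : p₁ % 8 = 3) (l : ℕ) (hl : l.Prime) (hl2 : l ≠ 2)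
    (h1 : quadraticChar (ZMod p₁) l = 1) : ∃ t : ℤ, (l : ℤ) ∣ t ^ 2 + p₁ := by
  have : Fact l.Prime := ⟨hl⟩
  have hlp : l ≠ p₁ := by rintro rfl; simp at h1
  have h := quadraticChar_odd_prime (F := ZMod p₁) (by rw [ZMod.ringChar_zmod_n]; omega) hl2
    (by rw [ZMod.ringChar_zmod_n]; exact hlp.symm)
  rw [h1, ZMod.card, ZMod.χ₄_nat_three_mod_four (by omega)] at h
  have h0 : ((-1 : ℤ) : ZMod l) * (p₁ : ZMod l) ≠ 0 := by
    intro h'; rw [h'] at h; simp at h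
  have hs := (quadraticChar_one_iff_isSquare h0).mp h.symm
  obtain ⟨y, hy⟩ := hs
  obtain ⟨t, rfl⟩ := ZMod.intCast_surjective y
  refine ⟨t, ?_⟩
  rw [← ZMod.intCast_zmod_eq_zero_iff_dvd]
  push_cast
  push_cast at hy
  linear_combination -hy

lemma zetaMul_prime_pow_le (p₁ : ℕ) [Fact p₁.Prime] (h8 : p₁ % 8 = 3) (K : Type*) [Field K] [NumberField K] (α : K)
    (hα : α ^ 2 = -(p₁ : K)) (hKα : Algebra.adjoin ℚ {α} = ⊤) (l : ℕ) (hl : l.Prime) (k : ℕ) :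
    (quadCharC p₁).zetaMul (l ^ k) ≤ (idealCount K (l ^ k) : ℂ) := by
  have hval : (quadCharC p₁).zetaMul (l ^ k) =
      ((∑ i ∈ Finset.range (k + 1), (quadraticChar (ZMod p₁) l) ^ i : ℤ) : ℂ) := by
    unfold DirichletCharacter.zetaMul
    rw [ArithmeticFunction.coe_zeta_mul_apply, Nat.sum_divisors_prime_pow hl]
    push_cast
    refine Finset.sum_congr rfl fun i _ => ?_
    have h0 : l ^ i ≠ 0 := pow_ne_zero _ hl.ne_zero
    change (if l ^ i = 0 then (0 : ℂ) else quadCharC p₁ ((l ^ i : ℕ) : ZMod p₁)) = _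
    rw [if_neg h0, Nat.cast_pow, map_pow]
    rfl
  rw [hval]
  have key : (∑ i ∈ Finset.range (k + 1), (quadraticChar (ZMod p₁) l) ^ i : ℤ) ≤ idealCount K (l ^ k) := by
    by_cases h0 : (l : ZMod p₁) = 0
    · rw [h0, quadraticChar_zero, Finset.sum_range_succ']
      simp
      have hlp : l = p₁ := by
        rw [ZMod.natCast_eq_zero_iff] at h0
        exact ((Nat.prime_dvd_prime_iff_eq Fact.out hl).mp h0).symm
      subst hlp
      have hIntg : IsIntegral ℤ α := by
        refine ⟨Polynomial.X ^ 2 + Polynomial.C (l : ℤ), by monicity!, ?_⟩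
        simp [hα]
      obtain ⟨a, rfl⟩ : ∃ a : 𝓞 K, (a : K) = α := ⟨⟨α, hIntg⟩, rfl⟩
      have ha : a ^ 2 = -(l : 𝓞 K) := by
        apply RingOfIntegers.ext; push_cast; exact hα
      refine idealCount_pos_of_exists K _ (span {a} ^ k) ?_
      rw [map_pow]
      congr 1
      have : absNorm (span {a} ^ 2) = l ^ 2 := by
        rw [span_singleton_pow, ha, span_singleton_neg, absNorm_span_singleton]
        have : (l : 𝓞 K) = algebraMap ℤ (𝓞 K) l := by simp
        rw [this, Algebra.norm_algebraMap, RingOfIntegers.rank, finrank_K l K _ hα hKα]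
        simp [Int.natAbs_pow]
      rw [map_pow] at this
      exact Nat.pow_left_injective two_ne_zero this
    · rcases quadraticChar_dichotomy h0 with h | h
      · rw [h]; simp
        have hl2 : l ≠ 2 := by
          rintro rfl
          have := quadChar_two p₁ h8
          rw [Nat.cast_ofNat, this] at h; norm_num at h
        obtain ⟨t, ht⟩ := quadChar_recip p₁ h8 l hl hl2 h
        have := idealCount_split p₁ K α hα hKα l hl hl2 t ht (by rintro rfl; simp at h0) k
        exact_mod_cast this
      · rw [h, neg_one_geom_sum]
        split_ifs with hk
        · positivity
        · have hk' : Even k := by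
            rw [Nat.even_add_one, not_not] at hk; exact hk
          obtain ⟨j, rfl⟩ := hk'
          have := idealCount_pos_of_exists K (l ^ (j + j)) (span {(l : 𝓞 K)} ^ j) (by
            have : (l : 𝓞 K) = algebraMap ℤ (𝓞 K) l := by simp
            rw [map_pow, absNorm_span_singleton, this, Algebra.norm_algebraMap, RingOfIntegers.rank, finrank_K p₁ K _ hα hKα]
            simp [Int.natAbs_pow, ← pow_mul]
            congr 1; omega)
          exact_mod_cast this
  have : (((∑ i ∈ Finset.range (k + 1), (quadraticChar (ZMod p₁) l) ^ i : ℤ) : ℝ) : ℂ) ≤ ((idealCount K (l ^ k) : ℝ) : ℂ) := by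
    rw [Complex.real_le_real]; exact_mod_cast key
  exact_mod_cast this

lemma quadCharC_sq (p₁ : ℕ) [Fact p₁.Prime] : (quadCharC p₁) ^ 2 = 1 := by
  have : (quadCharC p₁).IsQuadratic := (quadraticChar_isQuadratic (ZMod p₁)).comp _
  exact this.sq_eq_one

lemma zetaMul_le (p₁ : ℕ) [Fact p₁.Prime] (h8 : p₁ % 8 = 3) (K : Type*) [Field K] [NumberField K] (α : K)
    (hα : α ^ 2 = -(p₁ : K)) (hKα : Algebra.adjoin ℚ {α} = ⊤) (n : ℕ) (hn : n ≠ 0) :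
    (quadCharC p₁).zetaMul n ≤ (idealCount K n : ℂ) := by
  induction n using Nat.recOnPosPrimePosCoprime with
  | prime_pow l k hl hk => exact zetaMul_prime_pow_le p₁ h8 K α hα hKα l hl k
  | zero => exact absurd rfl hn
  | one =>
    rw [(DirichletCharacter.isMultiplicative_zetaMul _).map_one]
    have := idealCount_pos_of_exists K 1 ⊤ (by simp)
    exact_mod_cast this
  | coprime a b ha hb hab iha ihb =>
    rw [(DirichletCharacter.isMultiplicative_zetaMul _).map_mul_of_coprime hab]
    have h1 := idealCount_mul K hab (by omega) (by omega)
    calc _ ≤ (idealCount K a : ℂ) * (idealCount K b : ℂ) :=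
          mul_le_mul (iha (by omega)) (ihb (by omega)) (DirichletCharacter.zetaMul_nonneg (quadCharC_sq p₁) _) (by exact_mod_cast Nat.zero_le _)
      _ ≤ _ := by exact_mod_cast h1

end PartA2

section PartA3
open NumberField Ideal Filter Topology
open scoped ComplexOrder

lemma quadCharC_ne_one (p₁ : ℕ) [Fact p₁.Prime] (h8 : p₁ % 8 = 3) : quadCharC p₁ ≠ 1 := by
  intro h
  have h1 : quadCharC p₁ (-1) = -1 := by
    change ((quadraticChar (ZMod p₁) (-1) : ℤ) : ℂ) = -1
    rw [quadChar_neg_one p₁ h8]; simp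
  rw [h, MulChar.one_apply (isUnit_neg_one)] at h1
  norm_num at h1

lemma LSeries_zetaMul_eq (p₁ : ℕ) [Fact p₁.Prime] {s : ℂ} (hs : 1 < s.re) :
    LSeries (quadCharC p₁).zetaMul s = riemannZeta s * (quadCharC p₁).LFunction s := by
  rw [DirichletCharacter.zetaMul, ← ArithmeticFunction.coe_mul, LSeries_convolution']
  · simp only [(quadCharC p₁).LFunction_eq_LSeries hs]
    congr 1
    · simp_rw [← ArithmeticFunction.LSeries_zeta_eq_riemannZeta hs, ← ArithmeticFunction.natCoe_apply]
    · exact LSeries_congr (fun h => ((quadCharC p₁).apply_eq_toArithmeticFunction_apply h).symm) s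
  · exact ArithmeticFunction.LSeriesSummable_zeta_iff.mpr hs
  · exact (LSeriesSummable_congr _ fun h ↦ ((quadCharC p₁).apply_eq_toArithmeticFunction_apply h).symm).mpr <|
      ZMod.LSeriesSummable_of_one_lt_re (quadCharC p₁) hs

lemma L_one_le (p₁ : ℕ) [Fact p₁.Prime] (h8 : p₁ % 8 = 3) (K : Type*) [Field K] [NumberField K] (α : K)
    (hα : α ^ 2 = -(p₁ : K)) (hKα : Algebra.adjoin ℚ {α} = ⊤) :
    0 ≤ (quadCharC p₁).LFunction 1 ∧ (quadCharC p₁).LFunction 1 ≤ (dedekindZeta_residue K : ℂ) := by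
  have hof : Tendsto (fun s : ℝ => (s : ℂ)) (𝓝[>] 1) (𝓝[≠] 1) := by
    refine tendsto_nhdsWithin_of_tendsto_nhds_of_eventually_within _ ?_ ?_
    · exact (Complex.continuous_ofReal.tendsto' 1 1 (by simp)).mono_left nhdsWithin_le_nhds
    · filter_upwards [self_mem_nhdsWithin] with s hs
      have : (1:ℝ) < s := hs
      simp
      exact_mod_cast this.ne'
  have t1 : Tendsto (fun s : ℝ => ((s : ℂ) - 1) * riemannZeta s) (𝓝[>] 1) (𝓝 1) :=
    riemannZeta_residue_one.comp hof
  have t2 : Tendsto (fun s : ℝ => (quadCharC p₁).LFunction s) (𝓝[>] 1) (𝓝 ((quadCharC p₁).LFunction 1)) := by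
    have := ((DirichletCharacter.differentiable_LFunction (quadCharC_ne_one p₁ h8)).continuous.tendsto 1)
    exact (this.mono_left nhdsWithin_le_nhds).comp hof
  have t3 := t1.mul t2
  rw [one_mul] at t3
  have t4 := tendsto_sub_one_mul_dedekindZeta_nhdsGT K
  have hge : ∀ᶠ s : ℝ in 𝓝[>] 1, (0 : ℂ) ≤ ((s : ℂ) - 1) * riemannZeta s * (quadCharC p₁).LFunction s := by
    filter_upwards [self_mem_nhdsWithin] with s hs
    have hs1 : (1:ℝ) < s := hs
    rw [mul_assoc, ← LSeries_zetaMul_eq p₁ (by simpa using hs1)]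
    refine mul_nonneg ?_ ?_
    · have : (0:ℝ) ≤ s - 1 := by linarith
      exact_mod_cast this
    · refine tsum_nonneg fun n => ?_
      rw [LSeries.term_def]
      split_ifs with h0
      · exact le_rfl
      · rw [div_eq_mul_inv]
        refine mul_nonneg (DirichletCharacter.zetaMul_nonneg (quadCharC_sq p₁) _) ?_
        have : (0:ℝ) ≤ ((n:ℝ) ^ s)⁻¹ := by positivity
        rw [← Complex.ofReal_natCast, ← Complex.ofReal_cpow (by positivity)]
        exact_mod_cast this
  have hle : ∀ᶠ s : ℝ in 𝓝[>] 1, ((s : ℂ) - 1) * riemannZeta s * (quadCharC p₁).LFunction s ≤ (s - 1) * dedekindZeta K s := by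
    have hne : ∀ᶠ s : ℝ in 𝓝[>] 1, (s - 1) * dedekindZeta K s ≠ 0 :=
      t4.eventually_ne (by exact_mod_cast dedekindZeta_residue_ne_zero K)
    filter_upwards [self_mem_nhdsWithin, hne] with s hs hsum
    have hs1 : (1:ℝ) < s := hs
    rw [mul_assoc, ← LSeries_zetaMul_eq p₁ (by simpa using hs1)]
    refine mul_le_mul_of_nonneg_left ?_ ?_
    · have hS : LSeriesSummable (fun n ↦ (Nat.card {I : Ideal (𝓞 K) // absNorm I = n} : ℂ)) s := by
        by_contra hcon
        apply hsum
        unfold dedekindZeta LSeries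
        rw [tsum_eq_zero_of_not_summable hcon, mul_zero]
      refine ((quadCharC p₁).LSeriesSummable_zetaMul (by simpa using hs1)).tsum_le_tsum (fun n => ?_) hS
      rw [LSeries.term_def, LSeries.term_def]
      split_ifs with h0
      · exact le_rfl
      · rw [div_eq_mul_inv, div_eq_mul_inv]
        refine mul_le_mul_of_nonneg_right (zetaMul_le p₁ h8 K α hα hKα n h0) ?_
        have : (0:ℝ) ≤ ((n:ℝ) ^ s)⁻¹ := by positivity
        rw [← Complex.ofReal_natCast, ← Complex.ofReal_cpow (by positivity)]
        exact_mod_cast this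
    · have : (0:ℝ) ≤ s - 1 := by linarith
      exact_mod_cast this
  exact ⟨ge_of_tendsto t3 hge, le_of_tendsto_of_tendsto t3 t4 hle⟩

lemma residue_le (p₁ : ℕ) [Fact p₁.Prime] (h8 : p₁ % 8 = 3) (K : Type*) [Field K] [NumberField K] (α : K)
    (hα : α ^ 2 = -(p₁ : K)) (hKα : Algebra.adjoin ℚ {α} = ⊤) :
    dedekindZeta_residue K ≤ Real.pi * classNumber K / Real.sqrt p₁ := by
  have hfr := finrank_K p₁ K α hα hKα
  have hpp : 0 < (p₁ : ℝ) := by exact_mod_cast (Fact.out : p₁.Prime).pos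
  have hreal : InfinitePlace.nrRealPlaces K = 0 := by
    rw [InfinitePlace.nrRealPlaces, Fintype.card_eq_zero_iff]
    constructor
    rintro ⟨w, hw⟩
    rw [InfinitePlace.isReal_iff] at hw
    have h1 := congrArg (ComplexEmbedding.IsReal.embedding hw) hα
    simp at h1
    nlinarith [sq_nonneg (ComplexEmbedding.IsReal.embedding hw α)]
  have hcomp : InfinitePlace.nrComplexPlaces K = 1 := by
    have := InfinitePlace.card_add_two_mul_card_eq_rank K
    omega
  have hrank : Units.rank K = 0 := by
    unfold Units.rank
    rw [InfinitePlace.card_eq_nrRealPlaces_add_nrComplexPlaces]; omega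
  have hreg : Units.regulator K = 1 := by
    rw [Units.regulator_eq_regOfFamily_fundSystem]
    have he : IsEmpty (Fin (Units.rank K)) := by rw [hrank]; infer_instance
    obtain ⟨w'⟩ : Nonempty (InfinitePlace K) := inferInstance
    have hc : Fintype.card {w // w ≠ w'} = Units.rank K := by
      unfold Units.rank
      simp [Fintype.card_subtype_compl]
    have e := Fintype.equivFinOfCardEq hc
    rw [Units.regOfFamily_eq_det _ w' e]
    have : IsEmpty {w // w ≠ w'} := e.isEmpty
    simp
  have hw : (2:ℝ) ≤ Units.torsionOrder K := by
    have h1 := Units.even_torsionOrder K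
    have h2 := Units.torsionOrder_pos K
    have : 2 ≤ Units.torsionOrder K := by
      obtain ⟨j, hj⟩ := h1; omega
    exact_mod_cast this
  have hdisc : (p₁ : ℤ) ∣ discr K := by
    have hIntg : IsIntegral ℤ α := by
      refine ⟨Polynomial.X ^ 2 + Polynomial.C (p₁ : ℤ), by monicity!, ?_⟩
      simp [hα]
    obtain ⟨a, rfl⟩ : ∃ a : 𝓞 K, (a : K) = α := ⟨⟨α, hIntg⟩, rfl⟩
    have hfr' : Module.finrank ℤ (𝓞 K) = 2 := by rw [RingOfIntegers.rank, hfr]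
    let b : Module.Basis (Fin 2) ℤ (𝓞 K) := Module.finBasisOfFinrankEq ℤ (𝓞 K) hfr'
    let v : Fin 2 → 𝓞 K := ![1, a]
    have h1 : Algebra.discr ℤ v = (b.toMatrix v).det ^ 2 * Algebra.discr ℤ b := by
      have := Algebra.discr_of_matrix_vecMul (A := ℤ) (b := b) (P := b.toMatrix v)
      rw [← this]
      congr 1
      ext i
      rw [Matrix.vecMul, dotProduct]
      have h2 := b.sum_toMatrix_smul_self v i
      rw [← h2]
      simp
      ring
    rw [discr_eq_discr K b] at h1
    have tr : ∀ x : 𝓞 K, ∀ z : ℤ, Algebra.trace ℚ K (x : K) = z → Algebra.trace ℤ (𝓞 K) x = z := by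
      intro x z hx
      have := Algebra.trace_localization ℤ (nonZeroDivisors ℤ) (Rₘ := ℚ) (Sₘ := K) x
      have h3 : (algebraMap ℤ ℚ) ((Algebra.trace ℤ (𝓞 K)) x) = z := by rw [← this]; exact hx
      simpa using h3
    have ta : Algebra.trace ℤ (𝓞 K) a = 0 := tr a 0 (by rw [trace_alpha p₁ K _ hα]; simp)
    have tone : Algebra.trace ℤ (𝓞 K) 1 = 2 := by
      have := Algebra.trace_algebraMap (R := ℤ) (S := 𝓞 K) 1
      rw [hfr'] at this
      simpa using this
    have ha : a * a = algebraMap ℤ (𝓞 K) (-(p₁ : ℤ)) := by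
      apply RingOfIntegers.ext; simp; rw [← hα]; ring
    have taa : Algebra.trace ℤ (𝓞 K) (a * a) = -2 * p₁ := by
      rw [ha, Algebra.trace_algebraMap, hfr']; simp
    have h4 : Algebra.discr ℤ v = -4 * p₁ := by
      rw [Algebra.discr_def, Matrix.det_fin_two]
      simp [v, Algebra.traceMatrix_apply, Algebra.traceForm_apply, ta, tone, taa]
      ring
    rw [h4] at h1
    have hpZ : Prime (p₁ : ℤ) := Nat.prime_iff_prime_int.mp Fact.out
    have h5 : (p₁ : ℤ) ∣ (b.toMatrix v).det ^ 2 * discr K := ⟨-4, by rw [← h1]; ring⟩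
    rcases hpZ.dvd_or_dvd h5 with h6 | h6
    · exfalso
      have h7 := hpZ.dvd_of_dvd_pow h6
      obtain ⟨c, hc⟩ := h7
      rw [hc] at h1
      have h8' : (-4 : ℤ) = p₁ * (c ^ 2 * discr K) := by
        apply mul_right_cancel₀ hpZ.ne_zero
        rw [h1]; ring
      have h9 : (p₁ : ℤ) ∣ 4 := ⟨-(c ^ 2 * discr K), by linarith⟩
      have h10 : p₁ ∣ 2 ^ 2 := by exact_mod_cast h9
      have h11 := (Nat.Prime.dvd_of_dvd_pow Fact.out h10)
      have := Nat.le_of_dvd (by norm_num) h11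
      have h12 : p₁ = 2 := by omega
      omega
    · exact h6
  have hd : (p₁ : ℝ) ≤ |(discr K : ℝ)| := by
    have : (p₁ : ℤ) ≤ |discr K| := Int.le_of_dvd (abs_pos.mpr (discr_ne_zero K)) ((dvd_abs _ _).mpr hdisc)
    exact_mod_cast this
  rw [dedekindZeta_residue_def, hreal, hcomp, hreg]
  have hs : Real.sqrt p₁ ≤ Real.sqrt |(discr K : ℝ)| := Real.sqrt_le_sqrt hd
  have hs0 : 0 < Real.sqrt p₁ := Real.sqrt_pos.mpr hpp
  have : Real.pi * classNumber K / Real.sqrt p₁ = (2 * Real.pi * classNumber K) / (2 * Real.sqrt p₁) := by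
    field_simp
  rw [this]
  simp only [pow_zero, one_mul, pow_one, mul_one]
  have := Real.pi_pos
  gcongr

end PartA3

section PartA4
open Filter Topology Asymptotics MeasureTheory

lemma quadCharC_neg_one (p₁ : ℕ) [Fact p₁.Prime] (h8 : p₁ % 8 = 3) : quadCharC p₁ (-1) = -1 := by
  change ((quadraticChar (ZMod p₁) (-1) : ℤ) : ℂ) = -1
  rw [quadChar_neg_one p₁ h8]; simp

lemma quadCharC_zero (p₁ : ℕ) [Fact p₁.Prime] : quadCharC p₁ 0 = 0 :=
  MulChar.map_nonunit _ (by simp)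

lemma norm_quadCharC_le (p₁ : ℕ) [Fact p₁.Prime] (a : ZMod p₁) : ‖quadCharC p₁ a‖ ≤ 1 :=
  DirichletCharacter.norm_le_one _ _

lemma sum_quadCharC_range (p₁ : ℕ) [Fact p₁.Prime] (h8 : p₁ % 8 = 3) (n : ℕ) :
    ‖∑ k ∈ Finset.range n, quadCharC p₁ (k : ZMod p₁)‖ ≤ p₁ := by
  have h0 : ∑ k ∈ Finset.range p₁, quadCharC p₁ (k : ZMod p₁) = 0 := by
    rw [← MulChar.sum_eq_zero_of_ne_one (quadCharC_ne_one p₁ h8)]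
    refine Finset.sum_bij (fun k _ => (k : ZMod p₁)) (by simp) ?_ ?_ (by simp)
    · intro a ha b hb hab
      simp at ha hb
      rw [ZMod.natCast_eq_natCast_iff'] at hab
      rwa [Nat.mod_eq_of_lt ha, Nat.mod_eq_of_lt hb] at hab
    · intro b _
      exact ⟨b.val, by simpa using b.val_lt, by simp⟩
  induction n using Nat.strong_induction_on with
  | _ n ih =>
    rcases lt_or_ge n p₁ with h | h
    · refine (norm_sum_le _ _).trans ?_
      refine (Finset.sum_le_sum (fun (k : ℕ) _ => norm_quadCharC_le p₁ (k : ZMod p₁))).trans ?_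
      simp; exact_mod_cast h.le
    · obtain ⟨n', rfl⟩ := Nat.exists_eq_add_of_le h
      rw [Finset.sum_range_add, h0]
      have := ih n' (by have := (Fact.out : p₁.Prime).pos; omega)
      simpa using this

lemma sum_quadCharC_Icc (p₁ : ℕ) [Fact p₁.Prime] (h8 : p₁ % 8 = 3) (n : ℕ) :
    ‖∑ k ∈ Finset.Icc 0 n, quadCharC p₁ (k : ZMod p₁)‖ ≤ p₁ := by
  have : Finset.Icc 0 n = Finset.range (n+1) := by ext; simp
  rw [this]
  exact sum_quadCharC_range p₁ h8 _

lemma sum_Icc_one_eq (p₁ : ℕ) [Fact p₁.Prime] (n : ℕ) :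
    ∑ k ∈ Finset.Icc 1 n, quadCharC p₁ (k : ZMod p₁) = ∑ k ∈ Finset.Icc 0 n, quadCharC p₁ (k : ZMod p₁) := by
  refine Finset.sum_subset (fun x => by simp) ?_
  intro x hx hx'
  have : x = 0 := by simp at hx hx'; omega
  subst this
  exact_mod_cast quadCharC_zero p₁

lemma L_one_integral (p₁ : ℕ) [Fact p₁.Prime] (h8 : p₁ % 8 = 3) :
    (quadCharC p₁).LFunction 1 =
      ∫ t in Set.Ioi (1 : ℝ), (∑ k ∈ Finset.Icc 0 ⌊t⌋₊, quadCharC p₁ (k : ZMod p₁)) * (t : ℂ) ^ (-(2:ℂ)) := by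
  have key : ∀ s : ℝ, 1 < s → (quadCharC p₁).LFunction s =
      s * ∫ t in Set.Ioi (1 : ℝ), (∑ k ∈ Finset.Icc 0 ⌊t⌋₊, quadCharC p₁ (k : ZMod p₁)) * (t : ℂ) ^ (-((s:ℂ)+1)) := by
    intro s hs
    rw [DirichletCharacter.LFunction_eq_LSeries _ (by simpa using hs)]
    rw [LSeries_eq_mul_integral (fun n : ℕ => quadCharC p₁ n) (le_refl 0) (by simp; linarith)
      (DirichletCharacter.LSeriesSummable_of_one_lt_re _ (by simpa using hs))]
    · simp_rw [sum_Icc_one_eq]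
    · simp_rw [sum_Icc_one_eq]
      simp only [Real.rpow_zero]
      exact isBigO_of_le' (c := p₁) _ (fun n => by simpa using sum_quadCharC_Icc p₁ h8 n)
  have t1 : Tendsto (fun s : ℝ => (quadCharC p₁).LFunction s) (𝓝[>] 1) (𝓝 ((quadCharC p₁).LFunction 1)) := by
    have := (DirichletCharacter.differentiable_LFunction (quadCharC_ne_one p₁ h8)).continuous
    have h2 : Continuous (fun s : ℝ => (quadCharC p₁).LFunction s) := this.comp Complex.continuous_ofReal
    exact (h2.tendsto' 1 _ (by simp)).mono_left nhdsWithin_le_nhds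
  refine tendsto_nhds_unique t1 ?_
  have t2 : Tendsto (fun s : ℝ => ∫ t in Set.Ioi (1 : ℝ), (∑ k ∈ Finset.Icc 0 ⌊t⌋₊, quadCharC p₁ (k : ZMod p₁)) * (t : ℂ) ^ (-((s:ℂ)+1)))
      (𝓝[>] 1) (𝓝 (∫ t in Set.Ioi (1 : ℝ), (∑ k ∈ Finset.Icc 0 ⌊t⌋₊, quadCharC p₁ (k : ZMod p₁)) * (t : ℂ) ^ (-(2:ℂ)))) := by
    refine tendsto_integral_filter_of_dominated_convergence (fun t => p₁ * t ^ (-(2:ℝ))) ?_ ?_ ?_ ?_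
    · refine Eventually.of_forall fun s => ?_
      have := locallyIntegrableOn_mul_sum_Icc (m := 0) (fun k : ℕ => quadCharC p₁ (k : ZMod p₁)) (zero_le_one) (g := fun t : ℝ => (t:ℂ) ^ (-((s:ℂ)+1))) (a := 1) ?_
      · have h3 := this.aestronglyMeasurable
        have h4 := h3.mono_measure (Measure.restrict_mono Set.Ioi_subset_Ici_self le_rfl)
        simpa only [mul_comm] using h4
      · refine ContinuousOn.locallyIntegrableOn (fun t ht ↦ ?_) measurableSet_Ici
        exact (Complex.continuousAt_ofReal_cpow_const _ _ (Or.inr (by simp at ht; linarith))).continuousWithinAt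
    · filter_upwards [self_mem_nhdsWithin] with s hs
      filter_upwards [ae_restrict_mem measurableSet_Ioi] with t ht
      simp at hs ht
      rw [norm_mul, Complex.norm_cpow_eq_rpow_re_of_pos (by linarith)]
      refine mul_le_mul (sum_quadCharC_Icc p₁ h8 _) ?_ (by positivity) (by positivity)
      refine Real.rpow_le_rpow_of_exponent_le ht.le ?_
      simp; linarith
    · exact (integrableOn_Ioi_rpow_of_lt (by norm_num) one_pos).const_mul _
    · filter_upwards [ae_restrict_mem measurableSet_Ioi] with t ht
      simp at ht
      refine Tendsto.const_mul _ ?_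
      have hc : Continuous (fun s : ℝ => (t : ℂ) ^ (-((s:ℂ)+1))) := by
        refine Continuous.const_cpow (by fun_prop) (Or.inl ?_)
        exact_mod_cast (by linarith : t ≠ 0)
      exact (hc.tendsto' 1 _ (by norm_num)).mono_left nhdsWithin_le_nhds
  have t3 : Tendsto (fun s : ℝ => (s : ℂ)) (𝓝[>] 1) (𝓝 1) :=
    (Complex.continuous_ofReal.tendsto' 1 1 (by simp)).mono_left nhdsWithin_le_nhds
  have t4 := t3.mul t2
  rw [one_mul] at t4
  refine t4.congr' ?_
  filter_upwards [self_mem_nhdsWithin] with s hs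
  exact (key s hs).symm

lemma L_one_tendsto (p₁ : ℕ) [Fact p₁.Prime] (h8 : p₁ % 8 = 3) :
    Tendsto (fun n => ∑ k ∈ Finset.range n, quadCharC p₁ (k : ZMod p₁) / (k:ℂ)) atTop (𝓝 ((quadCharC p₁).LFunction 1)) := by
  have hder : ∀ t : ℝ, 1 ≤ t → HasDerivAt (fun t : ℝ => ((t : ℂ))⁻¹) (-((t:ℂ) ^ (-(2:ℂ)))) t := by
    intro t ht
    have h0 : (t:ℂ) ≠ 0 := by exact_mod_cast (by linarith : t ≠ 0)
    have := (hasDerivAt_inv h0).comp_ofReal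
    have e : (t:ℂ) ^ (-(2:ℂ)) = ((t:ℂ)^2)⁻¹ := by rw [Complex.cpow_neg]; norm_cast
    rw [e]; exact this
  have := tendsto_sum_mul_atTop_nhds_one_sub_integral₀ (fun k : ℕ => quadCharC p₁ (k : ZMod p₁)) (by exact_mod_cast quadCharC_zero p₁)
    (f := fun t : ℝ => ((t : ℂ))⁻¹) (l := 0) (g := fun t => t ^ (-(2:ℝ)))
    (fun t ht => (hder t ht).differentiableAt) ?_ ?_ ?_ ?_
  · have e : ∫ t in Set.Ioi (1:ℝ), deriv (fun t : ℝ => ((t : ℂ))⁻¹) t * ∑ k ∈ Finset.Icc 0 ⌊t⌋₊, quadCharC p₁ (k : ZMod p₁)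
        = - (quadCharC p₁).LFunction 1 := by
      rw [L_one_integral p₁ h8, ← integral_neg]
      refine setIntegral_congr_fun measurableSet_Ioi fun t ht => ?_
      simp only [Set.mem_Ioi] at ht
      simp only [(hder t ht.le).deriv]
      ring
    rw [e, zero_sub, neg_neg] at this
    rw [← tendsto_add_atTop_iff_nat 1]
    refine this.congr fun n => ?_
    have : Finset.range (n+1) = Finset.Icc 0 n := by ext; simp
    rw [this]
    exact Finset.sum_congr rfl fun k _ => by simp [div_eq_mul_inv, mul_comm]
  · have : LocallyIntegrableOn (fun t : ℝ => -((t:ℂ) ^ (-(2:ℂ)))) (Set.Ici 1) := by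
      refine ContinuousOn.locallyIntegrableOn (fun t ht ↦ ?_) measurableSet_Ici
      exact (Complex.continuousAt_ofReal_cpow_const _ _ (Or.inr (by simp at ht; linarith))).neg.continuousWithinAt
    refine this.congr ?_
    filter_upwards [ae_restrict_mem measurableSet_Ici] with t ht
    exact ((hder t ht).deriv).symm
  · have h1 : Tendsto (fun n : ℕ => (p₁ : ℝ) * ((n:ℝ))⁻¹) atTop (𝓝 0) := by
      have := (tendsto_inv_atTop_nhds_zero_nat (𝕜 := ℝ)).const_mul (p₁ : ℝ)
      simpa using this
    refine squeeze_zero_norm (fun n => ?_) h1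
    rw [norm_mul, mul_comm]
    refine mul_le_mul (sum_quadCharC_Icc p₁ h8 n) (by simp) (by positivity) (by positivity)
  · refine IsBigO.of_bound p₁ ?_
    filter_upwards [eventually_ge_atTop 1] with t ht
    rw [(hder t ht).deriv, norm_mul, mul_comm, norm_neg, Complex.norm_cpow_eq_rpow_re_of_pos (by linarith)]
    refine mul_le_mul (sum_quadCharC_Icc p₁ h8 _) ?_ (by positivity) (by positivity)
    simp
  · exact ⟨Set.Ioi 1, Ioi_mem_atTop 1, integrableOn_Ioi_rpow_of_lt (by norm_num) one_pos⟩

end PartA4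

section PartA5
open Filter Topology Complex NumberField

noncomputable def GG (p₁ : ℕ) [Fact p₁.Prime] : ℂ := gaussSum (quadCharC p₁) (ZMod.stdAddChar (N := p₁))

lemma quadCharC_isQuadratic (p₁ : ℕ) [Fact p₁.Prime] : (quadCharC p₁).IsQuadratic :=
  (quadraticChar_isQuadratic (ZMod p₁)).comp _

lemma GG_sq (p₁ : ℕ) [Fact p₁.Prime] (h8 : p₁ % 8 = 3) : GG p₁ ^ 2 = -(p₁ : ℂ) := by
  unfold GG
  rw [gaussSum_sq (quadCharC_ne_one p₁ h8) (quadCharC_isQuadratic p₁) (ZMod.isPrimitive_stdAddChar p₁),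
    quadCharC_neg_one p₁ h8, ZMod.card]; ring

lemma quad_shift (p₁ : ℕ) [Fact p₁.Prime] (h8 : p₁ % 8 = 3) (n : ZMod p₁) :
    ∑ a, quadCharC p₁ a * ZMod.stdAddChar (n * a) = quadCharC p₁ n * GG p₁ := by
  by_cases hn : n = 0
  · subst hn
    simp [quadCharC_zero, MulChar.sum_eq_zero_of_ne_one (quadCharC_ne_one p₁ h8)]
  · have h1 := gaussSum_mulShift (quadCharC p₁) (ZMod.stdAddChar (N := p₁)) (Units.mk0 n hn)
    have h2 : quadCharC p₁ n * quadCharC p₁ n = 1 := by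
      have := congrArg (fun c : MulChar (ZMod p₁) ℂ => c n) (quadCharC_sq p₁)
      simp only [MulChar.pow_apply' _ two_ne_zero] at this
      rw [← pow_two, this, MulChar.one_apply (Ne.isUnit hn)]
    unfold GG
    rw [← h1, ← mul_assoc]
    simp only [Units.val_mk0, h2, one_mul]
    simp [gaussSum, AddChar.mulShift_apply]

lemma std_val (p₁ : ℕ) [Fact p₁.Prime] (a : ZMod p₁) :
    (ZMod.stdAddChar a : ℂ) = exp (((2 * Real.pi * a.val / p₁ : ℝ) : ℂ) * I) := by
  rw [ZMod.stdAddChar_apply, ZMod.toCircle_apply]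
  congr 1; push_cast; ring

lemma arg_one_sub_exp (θ : ℝ) (h0 : 0 < θ) (h1 : θ < 2 * Real.pi) :
    (1 - exp (θ * I)).arg = (θ - Real.pi) / 2 := by
  have hs : 0 < Real.sin (θ / 2) := Real.sin_pos_of_pos_of_lt_pi (by linarith) (by linarith)
  have : 1 - exp (θ * I) = ((2 * Real.sin (θ / 2) : ℝ) : ℂ) *
      (cos (((θ - Real.pi) / 2 : ℝ) : ℂ) + sin (((θ - Real.pi) / 2 : ℝ) : ℂ) * I) := by
    have e1 : (θ - Real.pi) / 2 = θ / 2 - Real.pi / 2 := by ring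
    rw [← Complex.ofReal_cos, ← Complex.ofReal_sin, e1, Real.cos_sub_pi_div_two, Real.sin_sub_pi_div_two,
      Complex.exp_mul_I, ← Complex.ofReal_cos, ← Complex.ofReal_sin]
    have e2 : θ = 2 * (θ / 2) := by ring
    have e3 : Real.cos θ = 1 - 2 * Real.sin (θ/2)^2 := by
      conv_lhs => rw [e2]
      rw [Real.cos_two_mul, ← Real.sin_sq_add_cos_sq (θ/2)]; ring_nf
    have e4 : Real.sin θ = 2 * Real.sin (θ/2) * Real.cos (θ/2) := by
      conv_lhs => rw [e2]
      rw [Real.sin_two_mul]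
    rw [e3, e4]; push_cast; ring
  rw [this, Complex.arg_mul_cos_add_sin_mul_I (by positivity) ⟨by linarith, by linarith⟩]

/-- The integer `∑ χ(a) a`. -/
noncomputable def XX (p₁ : ℕ) [Fact p₁.Prime] : ℤ := ∑ a : ZMod p₁, quadraticChar (ZMod p₁) a * a.val

lemma std_pow (p₁ : ℕ) [Fact p₁.Prime] (a : ZMod p₁) (n : ℕ) :
   (ZMod.stdAddChar ((n : ZMod p₁) * a) : ℂ) = (ZMod.stdAddChar a) ^ n := by
  rw [← AddChar.map_nsmul_eq_pow, nsmul_eq_mul]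

lemma norm_std (p₁ : ℕ) [Fact p₁.Prime] (a : ZMod p₁) : ‖(ZMod.stdAddChar a : ℂ)‖ = 1 := by
  rw [std_val, Complex.norm_exp_ofReal_mul_I]

lemma L_one_eq (p₁ : ℕ) [Fact p₁.Prime] (h8 : p₁ % 8 = 3) :
    GG p₁ * (quadCharC p₁).LFunction 1 = ∑ a, quadCharC p₁ a * (- log (1 - ZMod.stdAddChar a)) := by
  have hA := Complex.tendsto_tsum_powerSeries_nhdsWithin_lt (L_one_tendsto p₁ h8)
  rw [tendsto_map'_iff] at hA
  have hA' := hA.const_mul (GG p₁)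
  refine tendsto_nhds_unique hA' ?_
  have hB : Tendsto (fun r : ℝ => ∑ a, quadCharC p₁ a * (- log (1 - r * ZMod.stdAddChar a))) (𝓝[<] 1)
      (𝓝 (∑ a, quadCharC p₁ a * (- log (1 - ZMod.stdAddChar a)))) := by
    refine tendsto_finset_sum _ fun a _ => ?_
    by_cases ha : a = 0
    · subst ha; simp [quadCharC_zero]
    refine Tendsto.const_mul _ (Tendsto.neg ?_)
    have hsl : (1 - ZMod.stdAddChar a : ℂ) ∈ slitPlane := by
      left
      have h1 : (ZMod.stdAddChar a : ℂ) ≠ 1 := by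
        intro h
        have := (ZMod.injective_stdAddChar (N := p₁)) (h.trans (AddChar.map_zero_eq_one _).symm)
        exact ha this
      have h2 := norm_std p₁ a
      have h3 := Complex.re_le_norm (ZMod.stdAddChar a : ℂ)
      rw [h2] at h3
      rcases h3.lt_or_eq with h | h
      · simpa using h
      · exfalso; apply h1
        have h4 := Complex.sq_norm (ZMod.stdAddChar a : ℂ)
        rw [h2, Complex.normSq_apply, h] at h4
        apply Complex.ext
        · simpa using h
        · simp; nlinarith
    have hc : ContinuousAt (fun r : ℝ => log (1 - r * ZMod.stdAddChar a)) 1 := by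
      refine ContinuousAt.clog (by fun_prop) (by simpa using hsl)
    have := hc.tendsto
    simp only [ofReal_one, one_mul] at this
    exact this.mono_left nhdsWithin_le_nhds
  refine hB.congr' ?_
  have hev : ∀ᶠ r : ℝ in 𝓝[<] 1, 0 < r := by
    exact nhdsWithin_le_nhds (lt_mem_nhds one_pos)
  filter_upwards [self_mem_nhdsWithin, hev] with r hr hr0
  simp at hr
  have hs : ∀ a : ZMod p₁, HasSum (fun n : ℕ => quadCharC p₁ a * ((r * ZMod.stdAddChar a) ^ n / n)) (quadCharC p₁ a * (- log (1 - r * ZMod.stdAddChar a))) := by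
    intro a
    refine HasSum.mul_left _ (Complex.hasSum_taylorSeries_neg_log ?_)
    rw [norm_mul, norm_std, mul_one]; simp [abs_of_pos hr0, hr]
  have hs2 := hasSum_sum (s := Finset.univ) (fun a _ => hs a)
  rw [← hs2.tsum_eq, Function.comp, ← tsum_mul_left]
  refine tsum_congr fun n => ?_
  have := quad_shift p₁ h8 n
  calc _ = (∑ a, quadCharC p₁ a * ZMod.stdAddChar ((n : ZMod p₁) * a)) * (r^n / n) := by
        rw [Finset.sum_mul]
        refine Finset.sum_congr rfl fun a _ => ?_
        rw [std_pow]; ring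
    _ = _ := by rw [this]; ring

lemma L_one_val (p₁ : ℕ) [Fact p₁.Prime] (h8 : p₁ % 8 = 3) :
    GG p₁ * (quadCharC p₁).LFunction 1 = - I * Real.pi * XX p₁ / p₁ := by
  have hp0 : (p₁ : ℝ) ≠ 0 := by exact_mod_cast (Fact.out : p₁.Prime).ne_zero
  have hp0' : (p₁ : ℂ) ≠ 0 := by exact_mod_cast hp0
  have hpp : (0:ℝ) < p₁ := by exact_mod_cast (Fact.out : p₁.Prime).pos
  have h1 := L_one_eq p₁ h8
  have h2 : ∑ a, quadCharC p₁ a * (- log (1 - ZMod.stdAddChar a)) =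
     ∑ a, quadCharC p₁ a * (log (1 - ZMod.stdAddChar (-a))) := by
    rw [← Equiv.sum_comp (Equiv.neg (ZMod p₁))]
    refine Finset.sum_congr rfl fun a _ => ?_
    have : quadCharC p₁ (-a) = - quadCharC p₁ a := by
      rw [← neg_one_mul, map_mul, quadCharC_neg_one p₁ h8]; ring
    simp only [Equiv.neg_apply, this]; ring
  have h3 : 2 * (∑ a, quadCharC p₁ a * (- log (1 - ZMod.stdAddChar a))) =
      ∑ a, quadCharC p₁ a * (I * Real.pi * (1 - 2 * a.val / p₁)) := by
    rw [two_mul]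
    conv_lhs => enter [2]; rw [h2]
    rw [← Finset.sum_add_distrib]
    refine Finset.sum_congr rfl fun a _ => ?_
    by_cases ha : a = 0
    · subst ha; simp [quadCharC_zero]
    rw [← mul_add]
    congr 1
    have hv0 : (0:ℝ) < a.val := by
      have : a.val ≠ 0 := by simpa using ha
      exact_mod_cast Nat.pos_of_ne_zero this
    have hv1 : (a.val : ℝ) < p₁ := by exact_mod_cast a.val_lt
    have harg := arg_one_sub_exp (2 * Real.pi * a.val / p₁) (by positivity) (by
      rw [div_lt_iff₀ hpp]; nlinarith [Real.pi_pos])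
    rw [← std_val] at harg
    have hconj : (1 - ZMod.stdAddChar (-a) : ℂ) = (starRingEnd ℂ) (1 - ZMod.stdAddChar a) := by
      rw [AddChar.map_neg_eq_conj]; simp
    rw [hconj, Complex.log_conj]
    · have : I * (Real.pi : ℂ) * (1 - 2 * a.val / p₁) = I * ((Real.pi * (1 - 2 * a.val / p₁) : ℝ) : ℂ) := by push_cast; ring
      rw [this]
      apply Complex.ext
      · simp only [add_re, neg_re, conj_re, Complex.I_mul_re, Complex.ofReal_im]; ring
      · simp only [add_im, neg_im, log_im, conj_im, harg]
        rw [Complex.I_mul_im, Complex.ofReal_re]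
        field_simp; ring
    · rw [harg]
      have : 2 * Real.pi * a.val / p₁ < 2 * Real.pi := by rw [div_lt_iff₀ hpp]; nlinarith [Real.pi_pos]
      linarith [Real.pi_pos]
  have h4 : ∑ a, quadCharC p₁ a * (I * Real.pi * (1 - 2 * a.val / p₁)) =
      -2 * I * Real.pi * XX p₁ / p₁ := by
    have : ∀ a : ZMod p₁, quadCharC p₁ a * (I * Real.pi * (1 - 2 * a.val / p₁)) =
      I * Real.pi * quadCharC p₁ a - 2 * I * Real.pi / p₁ * (quadCharC p₁ a * a.val) := by intro a; ring
    simp_rw [this]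
    rw [Finset.sum_sub_distrib, ← Finset.mul_sum, ← Finset.mul_sum, MulChar.sum_eq_zero_of_ne_one (quadCharC_ne_one p₁ h8)]
    have : (XX p₁ : ℂ) = ∑ a, quadCharC p₁ a * a.val := by
      unfold XX; push_cast; rfl
    rw [this]; ring
  rw [h1]
  have := h3.trans h4
  linear_combination this / 2

lemma XX_bound (p₁ : ℕ) [Fact p₁.Prime] (h8 : p₁ % 8 = 3) (K : Type*) [Field K] [NumberField K] (α : K)
    (hα : α ^ 2 = -(p₁ : K)) (hKα : Algebra.adjoin ℚ {α} = ⊤) :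
    |XX p₁| ≤ p₁ * classNumber K := by
  have hpp : (0:ℝ) < p₁ := by exact_mod_cast (Fact.out : p₁.Prime).pos
  have hG : ‖GG p₁‖ = Real.sqrt p₁ := by
    have h := congrArg norm (GG_sq p₁ h8)
    rw [norm_pow, norm_neg, Complex.norm_natCast] at h
    rw [← h, Real.sqrt_sq (norm_nonneg _)]
  have h := congrArg norm (L_one_val p₁ h8)
  obtain ⟨l0, l1⟩ := L_one_le p₁ h8 K α hα hKα
  have hr := residue_le p₁ h8 K α hα hKα
  have hL : ‖(quadCharC p₁).LFunction 1‖ ≤ Real.pi * classNumber K / Real.sqrt p₁ := by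
    obtain ⟨a1, a2⟩ := Complex.le_def.mp l0
    obtain ⟨b1, b2⟩ := Complex.le_def.mp l1
    have e : (quadCharC p₁).LFunction 1 = ((((quadCharC p₁).LFunction 1).re : ℝ) : ℂ) := by
      apply Complex.ext; simp; simpa using a2.symm
    rw [e, Complex.norm_real, Real.norm_of_nonneg (by simpa using a1)]
    refine le_trans (by simpa using b1) hr
  have hs : 0 < Real.sqrt p₁ := Real.sqrt_pos.mpr hpp
  rw [norm_mul, hG] at h
  have e : ‖(-I * Real.pi * XX p₁ / p₁ : ℂ)‖ = Real.pi * |(XX p₁ : ℝ)| / p₁ := by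
    simp [abs_of_pos Real.pi_pos]
  rw [e] at h
  have h5 : Real.pi * |(XX p₁ : ℝ)| / p₁ ≤ Real.pi * classNumber K := by
    rw [← h]
    calc _ ≤ Real.sqrt p₁ * (Real.pi * classNumber K / Real.sqrt p₁) := by gcongr
      _ = _ := by field_simp
  rw [div_le_iff₀ hpp] at h5
  have h6 : |(XX p₁ : ℝ)| ≤ p₁ * classNumber K := by
    have := Real.pi_pos
    nlinarith
  exact_mod_cast h6

end PartA5

section PartB1

noncomputable def psiC (p : ℕ) [Fact p.Prime] (F : Type*) [Field F] [Fintype F] [Algebra (ZMod p) F] : AddChar F ℂ :=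
  (ZMod.stdAddChar (N := p)).compAddMonoidHom (Algebra.trace (ZMod p) F).toAddMonoidHom

lemma psiC_apply (p : ℕ) [Fact p.Prime] (F : Type*) [Field F] [Fintype F] [Algebra (ZMod p) F] (x : F) :
    psiC p F x = ZMod.stdAddChar (Algebra.trace (ZMod p) F x) := rfl

lemma psiC_eq_exp (p : ℕ) [Fact p.Prime] (F : Type*) [Field F] [Fintype F] [Algebra (ZMod p) F] (x : F) :
    psiC p F x = Complex.exp (2 * Real.pi * Complex.I * ((Algebra.trace (ZMod p) F x).val : ℂ) / p) := by
  rw [psiC_apply, ZMod.stdAddChar_apply, ZMod.toCircle_apply]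

lemma psiC_ne_one (p : ℕ) [Fact p.Prime] (F : Type*) [Field F] [Fintype F] [Algebra (ZMod p) F] :
    psiC p F ≠ 1 := by
  intro h
  have : Algebra.IsSeparable (ZMod p) F := inferInstance
  obtain ⟨x, hx⟩ := Algebra.trace_surjective (ZMod p) F 1
  have h1 : psiC p F x = 1 := by rw [h]; rfl
  rw [psiC_apply, hx] at h1
  have := ZMod.injective_stdAddChar (h1.trans (AddChar.map_zero_eq_one _).symm)
  exact one_ne_zero this

lemma psiC_prim (p : ℕ) [Fact p.Prime] (F : Type*) [Field F] [Fintype F] [Algebra (ZMod p) F] :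
    (psiC p F).IsPrimitive := AddChar.IsPrimitive.of_ne_one (psiC_ne_one p F)

lemma psiC_pow_p (p : ℕ) [Fact p.Prime] (F : Type*) [Field F] [Fintype F] [Algebra (ZMod p) F] (x : F) :
    psiC p F (x ^ p) = psiC p F x := by
  rw [psiC_apply, psiC_apply]
  congr 1
  have := Algebra.trace_eq_of_algEquiv (FiniteField.frobeniusAlgEquivOfAlgebraic (ZMod p) F) x
  rw [← this]
  congr 1
  simp [FiniteField.coe_frobeniusAlgEquivOfAlgebraic, ZMod.card]

lemma exists_val (p : ℕ) [hp : Fact p.Prime] : ∃ B : ValuationSubring ℂ, B.valuation (p : ℂ) < 1 := by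
  let A : Subring ℂ := (Int.castRingHom ℂ).range
  let I : Ideal A := Ideal.span {(p : A)}
  have hI : I ≠ ⊤ := by
    intro h
    rw [Ideal.span_singleton_eq_top] at h
    obtain ⟨u, hu⟩ := h
    obtain ⟨z, hz⟩ := (u⁻¹ : Aˣ).1.2
    have h1 : ((u : A) : ℂ) * ((u⁻¹ : Aˣ) : A) = 1 := by
      have := u.mul_inv
      exact_mod_cast congrArg (Subtype.val) this
    rw [hu, ← hz] at h1
    have h2 : (p : ℤ) * z = 1 := by
      have : ((p : ℂ)) * (z : ℂ) = 1 := by simpa using h1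
      exact_mod_cast this
    have h3 := Int.isUnit_iff.mp (IsUnit.of_mul_eq_one _ h2)
    have := hp.out.two_le
    omega
  obtain ⟨B, _, hB⟩ := Ideal.image_subset_nonunits_valuationSubring I hI
  refine ⟨B, ?_⟩
  rw [← ValuationSubring.mem_nonunits_iff]
  apply hB
  exact ⟨(p : A), Ideal.mem_span_singleton_self _, by simp⟩

variable (B : ValuationSubring ℂ)

lemma val_int_le (n : ℤ) : B.valuation (n : ℂ) ≤ 1 := by
  rw [ValuationSubring.valuation_le_one_iff]
  exact intCast_mem B n

lemma val_integral_le (x : ℂ) (hx : IsIntegral ℤ x) : B.valuation x ≤ 1 := by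
  rw [ValuationSubring.valuation_le_one_iff]
  have h1 : IsIntegral B x := hx.tower_top
  obtain ⟨y, hy⟩ := IsIntegrallyClosed.isIntegral_iff.mp h1
  rw [← hy]; exact y.2

lemma val_coprime (p : ℕ) [hp : Fact p.Prime] (hB : B.valuation (p : ℂ) < 1) (n : ℤ) (hn : ¬ (p : ℤ) ∣ n) :
    B.valuation (n : ℂ) = 1 := by
  refine le_antisymm (val_int_le B n) ?_
  by_contra! h
  have hc : IsCoprime (p : ℤ) n := (Prime.coprime_iff_not_dvd (Nat.prime_iff_prime_int.mp hp.out)).mpr hn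
  obtain ⟨a, b, hab⟩ := hc
  have h1 : B.valuation ((a : ℂ) * p + b * n) = 1 := by
    have : ((a : ℂ) * p + b * n) = 1 := by exact_mod_cast congrArg (Int.cast : ℤ → ℂ) hab
    rw [this, map_one]
  have h2 : B.valuation ((a : ℂ) * p + b * n) < 1 := by
    refine Valuation.map_add_lt _ ?_ ?_
    · rw [map_mul]; exact mul_lt_one_of_nonneg_of_lt_one_right (val_int_le B a) zero_le hB
    · rw [map_mul]; exact mul_lt_one_of_nonneg_of_lt_one_right (val_int_le B b) zero_le h
  exact absurd h1 h2.ne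

lemma val_root (n : ℕ) (hn : n ≠ 0) (z : ℂ) (hz : z ^ n = 1) : B.valuation z = 1 := by
  have := congrArg B.valuation hz
  rw [map_pow, map_one] at this
  exact (pow_eq_one_iff.mp this).resolve_right hn

lemma int_dvd_of_val (p : ℕ) [hp : Fact p.Prime] (hB : B.valuation (p : ℂ) < 1) (n : ℤ) (k : ℕ)
    (h : B.valuation (n : ℂ) ≤ B.valuation (p : ℂ) ^ k) : (p : ℤ) ^ k ∣ n := by
  have hp0 : B.valuation (p : ℂ) ≠ 0 := by
    rw [Valuation.ne_zero_iff]; exact_mod_cast hp.out.ne_zero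
  induction k generalizing n with
  | zero => simp
  | succ k ih =>
    have hd : (p : ℤ) ∣ n := by
      by_contra hnd
      rw [val_coprime B p hB n hnd] at h
      have : B.valuation (p : ℂ) ^ (k+1) < 1 := pow_lt_one₀ zero_le hB (by simp)
      exact absurd h (not_le.mpr this)
    obtain ⟨n', rfl⟩ := hd
    rw [pow_succ']
    refine mul_dvd_mul_left _ (ih n' ?_)
    push_cast at h
    rw [map_mul, pow_succ'] at h
    exact le_of_mul_le_mul_left h (zero_lt_iff.mpr hp0)

/-- roots of unity of order prime to `p` stay distinct -/
lemma val_one_sub (p : ℕ) [hp : Fact p.Prime] (hB : B.valuation (p : ℂ) < 1) (n : ℕ) (hn : ¬ p ∣ n + 1) (z : ℂ)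
    (hz : IsPrimitiveRoot z (n + 1)) (k : ℕ) (hk : k < n) : B.valuation (1 - z ^ (k + 1)) = 1 := by
  have h1 := hz.prod_one_sub_pow_eq_order
  have h2 := congrArg B.valuation h1
  rw [map_prod] at h2
  have h3 : B.valuation ((n : ℂ) + 1) = 1 := by
    have := val_coprime B p hB ((n : ℤ) + 1) (by exact_mod_cast hn)
    exact_mod_cast this
  have hle : ∀ i, B.valuation (1 - z ^ (i + 1)) ≤ 1 := by
    intro i
    refine (Valuation.map_sub _ _ _).trans ?_
    rw [map_one, map_pow, val_root B (n+1) (by simp) z hz.pow_eq_one]; simp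
  refine le_antisymm (hle k) ?_
  by_contra! hlt
  rw [h3, ← Finset.mul_prod_erase _ _ (Finset.mem_range.mpr hk)] at h2
  have : ∏ i ∈ (Finset.range n).erase k, B.valuation (1 - z ^ (i + 1)) ≤ 1 :=
    Finset.prod_le_one' (fun i _ => hle i)
  exact absurd h2 (mul_lt_one_of_lt_of_le hlt this).ne

lemma val_p (p : ℕ) [hp : Fact p.Prime] (z : ℂ) (hz : IsPrimitiveRoot z p) :
    B.valuation (p : ℂ) = B.valuation (z - 1) ^ (p - 1) := by
  obtain ⟨n, hn⟩ : ∃ n, p = n + 1 := ⟨p - 1, by have := hp.out.pos; omega⟩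
  rw [hn] at hz
  have h1 := hz.prod_one_sub_pow_eq_order
  have h2 := congrArg B.valuation h1
  rw [map_prod] at h2
  have hpc : (p : ℂ) = (n : ℂ) + 1 := by rw [hn]; push_cast; rfl
  rw [hpc, ← h2]
  have hle : ∀ w : ℂ, IsIntegral ℤ w → ∀ i, B.valuation (1 - w ^ i) ≤ B.valuation (w - 1) := by
    intro w hw i
    have : 1 - w ^ i = - (w - 1) * ∑ j ∈ Finset.range i, w ^ j := by
      rw [neg_mul, mul_geom_sum]; ring
    rw [this, map_mul, Valuation.map_neg]
    refine mul_le_of_le_one_right' ?_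
    exact val_integral_le B _ (IsIntegral.sum _ fun j _ => hw.pow j)
  have hIntg : IsIntegral ℤ z := hz.isIntegral (by simp)
  have : ∀ k ∈ Finset.range n, B.valuation (1 - z ^ (k + 1)) = B.valuation (z - 1) := by
    intro k hk
    refine le_antisymm (hle z hIntg _) ?_
    have hk' := Finset.mem_range.mp hk
    have hc : (k + 1).Coprime (n + 1) := by
      rw [← hn]
      exact (Nat.coprime_of_lt_prime (by omega) (by omega) hp.out).symm
    obtain ⟨i, hi, hiz⟩ := (hz.pow_of_coprime _ hc).eq_pow_of_pow_eq_one hz.pow_eq_one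
    have := hle (z ^ (k+1)) (hIntg.pow _) i
    rw [hiz] at this
    rw [Valuation.map_sub_swap _ z, Valuation.map_sub_swap _ 1 (z ^ (k+1))]
    exact this
  rw [Finset.prod_congr rfl this]
  simp [hn]

end PartB1

section PartB2

variable (B : ValuationSubring ℂ)

lemma teich (p : ℕ) [hp : Fact p.Prime] (hB : B.valuation (p : ℂ) < 1) (F : Type*) [Field F] [Fintype F]
    [Algebra (ZMod p) F] (f : ℕ) (hcard : Fintype.card F = p ^ f) (hq : 2 < p ^ f) :
    ∃ (ω : MulChar F ℂ) (ι : F →+* IsLocalRing.ResidueField B) (hω : ∀ x, ω x ∈ B),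
      (∀ x, IsLocalRing.residue B ⟨ω x, hω x⟩ = ι x) ∧ (∀ θ : MulChar F ℂ, ∃ a : ℕ, θ = ω ^ a) ∧
      orderOf ω = p ^ f - 1 := by
  set k := IsLocalRing.ResidueField B with hk
  have hf0 : f ≠ 0 := by rintro rfl; simp at hq
  have hpq : p ∣ p ^ f := dvd_pow_self p hf0
  have hpm : (p : B) ∈ IsLocalRing.maximalIdeal B := by
    rw [ValuationSubring.valuation_lt_one_iff]; simpa using hB
  have hchar : CharP k p := by
    have h0 : (p : k) = 0 := by
      have : IsLocalRing.residue B (p : B) = 0 := (IsLocalRing.residue_eq_zero_iff _).mpr hpm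
      simpa using this
    have := CharP.exists k
    obtain ⟨c, hc⟩ := this
    have h1 := (CharP.cast_eq_zero_iff k c p).mp h0
    rcases (Nat.dvd_prime hp.out).mp h1 with h | h
    · subst h
      have h2 := CharP.cast_eq_zero k 1
      rw [Nat.cast_one] at h2
      exact absurd h2 one_ne_zero
    · rwa [h] at hc
  let alg : Algebra (ZMod p) k := ZMod.algebra k p
  obtain ⟨n, hn⟩ : ∃ n, p ^ f = n + 2 := ⟨p ^ f - 2, by omega⟩
  have hq1 : p ^ f - 1 = n + 1 := by omega
  have hpn : ¬ p ∣ n + 1 := by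
    intro h
    have h2 : p ∣ n + 1 + 1 := by rw [← hn.trans rfl]; exact hpq
    have := (Nat.dvd_add_right h).mp h2
    exact hp.out.one_lt.ne' (Nat.dvd_one.mp this)
  have hz := Complex.isPrimitiveRoot_exp (n + 1) (by simp)
  set z := Complex.exp (2 * Real.pi * Complex.I / ((n + 1 : ℕ) : ℂ)) with hzdef
  have hzB : z ∈ B := by
    rw [← ValuationSubring.valuation_le_one_iff, val_root B (n+1) (by simp) z hz.pow_eq_one]
  let zB : B := ⟨z, hzB⟩
  let r : k := IsLocalRing.residue B zB
  have hr1 : r ^ (n + 1) = 1 := by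
    have : zB ^ (n + 1) = 1 := Subtype.ext (by simpa [zB] using hz.pow_eq_one)
    rw [← map_pow, this, map_one]
  have hr : IsPrimitiveRoot r (n + 1) := by
    refine IsPrimitiveRoot.mk_of_lt r (by simp) hr1 ?_
    intro l hl0 hl h
    have h1 := val_one_sub B p hB n hpn z hz (l - 1) (by omega)
    have h2 : IsLocalRing.residue B (1 - zB ^ l) = 0 := by
      rw [map_sub, map_one, map_pow]; simp [r] at h; rw [h]; simp
    rw [IsLocalRing.residue_eq_zero_iff, ValuationSubring.valuation_lt_one_iff] at h2
    have h3 : l - 1 + 1 = l := by omega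
    rw [h3] at h1
    simp [zB] at h2
    exact absurd h1 h2.ne
  have hsplit : (Polynomial.map (algebraMap (ZMod p) k) (Polynomial.X ^ Fintype.card F - Polynomial.X)).Splits := by
    have : (Polynomial.map (algebraMap (ZMod p) k) (Polynomial.X ^ Fintype.card F - Polynomial.X)) =
        Polynomial.X * (Polynomial.X ^ (n + 1) - 1) := by
      rw [hcard, hn]; simp; ring
    rw [this]
    exact Polynomial.Splits.mul Polynomial.Splits.X (Polynomial.X_pow_sub_one_splits hr)
  have := FiniteField.isSplittingField_sub F (ZMod p)
  let ι : F →+* k := (Polynomial.IsSplittingField.lift F _ hsplit).toRingHom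
  obtain ⟨g, hg⟩ := IsCyclic.exists_generator (α := Fˣ)
  have hcardU : Fintype.card Fˣ = n + 1 := by rw [Fintype.card_units, hcard]; omega
  have hgo : orderOf g = n + 1 := by
    rw [orderOf_eq_card_of_forall_mem_zpowers hg, Nat.card_eq_fintype_card, hcardU]
  have hιg : ι g ^ (n + 1) = 1 := by
    rw [← map_pow, ← Units.val_pow_eq_pow_val, ← hgo, pow_orderOf_eq_one]; simp
  have hιp : IsPrimitiveRoot (ι g) (n + 1) := by
    refine IsPrimitiveRoot.map_of_injective ?_ ι.injective
    rw [IsPrimitiveRoot.coe_units_iff, ← hgo]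
    exact IsPrimitiveRoot.orderOf g
  obtain ⟨i, hi, hic, hir⟩ := hr.isPrimitiveRoot_iff.mp hιp
  have hzi : IsPrimitiveRoot (z ^ i) (n + 1) := hz.pow_of_coprime i hic
  obtain ⟨u, hu⟩ : ∃ u : ℂˣ, (u : ℂ) = z ^ i := ⟨(hzi.isUnit (by simp)).unit, rfl⟩
  have hum : u ∈ rootsOfUnity (Fintype.card Fˣ) ℂ := by
    rw [mem_rootsOfUnity', hu, hcardU]; exact hzi.pow_eq_one
  let ω := MulChar.ofRootOfUnity hum hg
  have hωg : ω g = z ^ i := by rw [← hu]; exact MulChar.ofRootOfUnity_spec hum hg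
  have hpow : ∀ x : Fˣ, ∃ j : ℕ, x = g ^ j := by
    intro x
    obtain ⟨j, hj⟩ := (mem_powers_iff_mem_zpowers).mpr (hg x)
    exact ⟨j, hj.symm⟩
  have hωB : ∀ x, ω x ∈ B := by
    intro x
    by_cases hx : x = 0
    · subst hx; rw [MulChar.map_zero]; exact zero_mem B
    · obtain ⟨j, hj⟩ := hpow (Units.mk0 x hx)
      have : x = (g : F) ^ j := by rw [← Units.val_pow_eq_pow_val, ← hj]; rfl
      rw [this, map_pow, hωg]
      exact pow_mem (pow_mem hzB _) _
  refine ⟨ω, ι, hωB, ?_, ?_, ?_⟩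
  · intro x
    by_cases hx : x = 0
    · subst hx
      have : (⟨ω 0, hωB 0⟩ : B) = 0 := Subtype.ext (by simp [MulChar.map_zero])
      rw [this]; simp
    · obtain ⟨j, hj⟩ := hpow (Units.mk0 x hx)
      have hxg : x = (g : F) ^ j := by rw [← Units.val_pow_eq_pow_val, ← hj]; rfl
      have : (⟨ω x, hωB x⟩ : B) = (zB ^ i) ^ j := Subtype.ext (by
        simp only [hxg, map_pow, hωg]; simp [zB])
      rw [this, map_pow, map_pow]
      change (r ^ i) ^ j = _
      rw [hir, hxg, map_pow]
  · intro θ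
    have h1 : θ g ^ (n + 1) = 1 := by
      rw [← map_pow, ← Units.val_pow_eq_pow_val, ← hgo, pow_orderOf_eq_one]; simp
    obtain ⟨a, _, ha⟩ := hzi.eq_pow_of_pow_eq_one h1
    refine ⟨a, ?_⟩
    refine MulChar.ext fun x => ?_
    obtain ⟨j, rfl⟩ := hpow x
    rw [MulChar.pow_apply_coe, Units.val_pow_eq_pow_val, map_pow, map_pow, hωg, ← ha]; ring
  · rw [hq1]
    rw [orderOf_eq_iff (by simp)]
    constructor
    · refine MulChar.ext fun x => ?_
      obtain ⟨j, rfl⟩ := hpow x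
      rw [MulChar.pow_apply_coe, Units.val_pow_eq_pow_val, map_pow, hωg, ← pow_mul, mul_comm, pow_mul, hzi.pow_eq_one, one_pow,
        ← Units.val_pow_eq_pow_val, MulChar.one_apply_coe]
    · intro m hm hm0 h
      have := congrArg (fun c : MulChar F ℂ => c g) h
      simp only [MulChar.pow_apply_coe, hωg, MulChar.one_apply_coe] at this
      exact hzi.pow_ne_one_of_pos_of_lt hm0.ne' hm this

end PartB2

section PartB3

variable (B : ValuationSubring ℂ)

lemma finrank_eq_f (p : ℕ) [hp : Fact p.Prime] (F : Type*) [Field F] [Fintype F]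
    [Algebra (ZMod p) F] (f : ℕ) (hcard : Fintype.card F = p ^ f) : Module.finrank (ZMod p) F = f := by
  have h := Module.card_eq_pow_finrank (K := ZMod p) (V := F)
  rw [hcard, ZMod.card] at h
  exact (Nat.pow_right_injective hp.out.two_le h).symm

lemma sum_inv_trace (p : ℕ) [hp : Fact p.Prime] (F : Type*) [Field F] [Fintype F]
    [Algebra (ZMod p) F] (f : ℕ) (hcard : Fintype.card F = p ^ f) (hf : f ≠ 0) :
    ∑ x : F, x⁻¹ * algebraMap (ZMod p) F (Algebra.trace (ZMod p) F x) = -1 := by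
  simp_rw [FiniteField.algebraMap_trace_eq_sum_pow, finrank_eq_f p F f hcard, Finset.mul_sum]
  rw [Finset.sum_comm, Finset.sum_eq_single_of_mem 0 (by simp; omega)]
  · simp only [pow_zero, pow_one]
    have : ∀ x : F, x⁻¹ * x = if x = 0 then 0 else 1 := by
      intro x; split_ifs with h
      · simp [h]
      · field_simp
    simp_rw [this]
    rw [Finset.sum_ite]
    simp only [Finset.sum_const_zero, zero_add, Finset.sum_const, nsmul_eq_mul, mul_one, ← ne_eq]
    rw [Finset.filter_ne', Finset.card_erase_of_mem (Finset.mem_univ _), Finset.card_univ, Nat.cast_sub Fintype.card_pos]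
    simp
  · intro i hi hi0
    have hpi : 1 < p ^ i := Nat.one_lt_pow hi0 hp.out.one_lt
    have h := FiniteField.sum_pow_lt_card_sub_one F (p ^ i - 1) (by
      rw [hcard]
      have := Nat.pow_lt_pow_right hp.out.one_lt (Finset.mem_range.mp hi)
      omega)
    rw [← h]
    refine Finset.sum_congr rfl fun x _ => ?_
    rw [Nat.card_eq_fintype_card, ZMod.card]
    by_cases hx : x = 0
    · subst hx; simp; rw [zero_pow (by omega)]
    · rw [pow_sub₀ _ hx hpi.le]; simp; ring

lemma one_add_pow_expand (π : ℂ) (hπ : π ∈ B) (t : ℕ) : ∃ c ∈ B, (1 + π) ^ t = 1 + t * π + π ^ 2 * c := by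
  induction t with
  | zero => exact ⟨0, zero_mem B, by simp⟩
  | succ t ih =>
    obtain ⟨c, hc, h⟩ := ih
    refine ⟨t + c + π * c, add_mem (add_mem (natCast_mem B t) hc) (mul_mem hπ hc), ?_⟩
    rw [pow_succ, h]; push_cast; ring

noncomputable def piP (p : ℕ) [hp : Fact p.Prime] : ℂ := ZMod.stdAddChar (1 : ZMod p) - 1

lemma std_one_prim (p : ℕ) [hp : Fact p.Prime] : IsPrimitiveRoot (ZMod.stdAddChar (1 : ZMod p) : ℂ) p := by
  have := Complex.isPrimitiveRoot_exp p hp.out.ne_zero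
  have e : (ZMod.stdAddChar (1 : ZMod p) : ℂ) = Complex.exp (2 * Real.pi * Complex.I / p) := by
    have := ZMod.stdAddChar_coe (N := p) 1
    simpa using this
  rw [e]; exact this

lemma val_p_eq (p : ℕ) [hp : Fact p.Prime] : B.valuation (p : ℂ) = B.valuation (piP p) ^ (p - 1) :=
  val_p B p _ (std_one_prim p)

lemma piP_lt (p : ℕ) [hp : Fact p.Prime] (hB : B.valuation (p : ℂ) < 1) : B.valuation (piP p) < 1 := by
  by_contra! h
  rw [val_p_eq B p] at hB
  exact absurd hB (not_lt.mpr (one_le_pow₀ h))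

lemma val_g_teich (p : ℕ) [hp : Fact p.Prime] (hB : B.valuation (p : ℂ) < 1) (F : Type*) [Field F] [Fintype F]
    [Algebra (ZMod p) F] (f : ℕ) (hcard : Fintype.card F = p ^ f) (hf : f ≠ 0)
    (ω : MulChar F ℂ) (hω1 : ω ≠ 1) (ι : F →+* IsLocalRing.ResidueField B) (hω : ∀ x, ω x ∈ B)
    (hι : ∀ x, IsLocalRing.residue B ⟨ω x, hω x⟩ = ι x) :
    B.valuation (piP p) ≤ B.valuation (gaussSum ω⁻¹ (psiC p F)) := by
  have hlt := piP_lt B p hB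
  have hπ : piP p ∈ B := by rw [← ValuationSubring.valuation_le_one_iff]; exact hlt.le
  let t : F → ℕ := fun x => (Algebra.trace (ZMod p) F x).val
  choose c hcB hc using fun t => one_add_pow_expand B (piP p) hπ t
  have hψ : ∀ x, psiC p F x = 1 + t x * piP p + piP p ^ 2 * c (t x) := by
    intro x
    rw [← hc]
    have : (1 + piP p) = ZMod.stdAddChar (1 : ZMod p) := by unfold piP; ring
    rw [this, psiC_apply, ← std_pow]; simp [t]
  have hS : gaussSum ω⁻¹ (psiC p F) = piP p * ((∑ x, ω x⁻¹ * t x) + piP p * ∑ x, ω x⁻¹ * c (t x)) := by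
    unfold gaussSum
    have h0 : ∑ x, ω⁻¹ x = 0 := MulChar.sum_eq_zero_of_ne_one (inv_ne_one.mpr hω1)
    have : ∀ x, ω⁻¹ x * psiC p F x = ω⁻¹ x + piP p * (ω x⁻¹ * t x) + piP p * (piP p * (ω x⁻¹ * c (t x))) := by
      intro x
      rw [hψ, MulChar.inv_apply']; ring
    simp_rw [this]
    rw [Finset.sum_add_distrib, Finset.sum_add_distrib, h0]
    simp only [← Finset.mul_sum]; ring
  let SB : B := ∑ x, (⟨ω x⁻¹, hω _⟩ : B) * (t x : B)
  have hSB : (SB : ℂ) = ∑ x, ω x⁻¹ * t x := by simp [SB]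
  have hres : IsLocalRing.residue B SB = -1 := by
    have h1 := congrArg ι (sum_inv_trace p F f hcard hf)
    rw [map_sum, map_neg, map_one] at h1
    rw [← h1, map_sum]
    refine Finset.sum_congr rfl fun x _ => ?_
    rw [map_mul, map_mul, hι, map_natCast]
    congr 1
    have : algebraMap (ZMod p) F (Algebra.trace (ZMod p) F x) = ((t x : ℕ) : F) := by
      rw [← map_natCast (algebraMap (ZMod p) F)]; simp [t]
    rw [this, map_natCast]
  have hv1 : B.valuation (∑ x, ω x⁻¹ * t x) = 1 := by
    rw [← hSB]
    refine le_antisymm ((ValuationSubring.valuation_le_one_iff _ _).mpr SB.2) ?_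
    by_contra! h
    rw [← ValuationSubring.valuation_lt_one_iff, ← IsLocalRing.residue_eq_zero_iff, hres] at h
    simp at h
  have hv2 : B.valuation (piP p * ∑ x, ω x⁻¹ * c (t x)) < 1 := by
    rw [map_mul]
    refine mul_lt_one_of_lt_of_le hlt ?_
    rw [ValuationSubring.valuation_le_one_iff]
    exact sum_mem fun x _ => mul_mem (hω _) (hcB _)
  rw [hS, map_mul, Valuation.map_add_eq_of_lt_left _ (by rw [hv1]; exact hv2), hv1, mul_one]

lemma gauss_frob (p : ℕ) [hp : Fact p.Prime] (F : Type*) [Field F] [Fintype F]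
    [Algebra (ZMod p) F] (χ : MulChar F ℂ) (i : ℕ) : gaussSum (χ ^ (p ^ i)) (psiC p F) = gaussSum χ (psiC p F) := by
  induction i with
  | zero => simp
  | succ i ih =>
    rw [← ih, pow_succ, pow_mul]
    generalize χ ^ (p ^ i) = θ
    unfold gaussSum
    have : CharP F p := charP_of_injective_algebraMap (algebraMap (ZMod p) F).injective p
    have h := Equiv.sum_comp (Equiv.ofBijective _ (bijective_frobenius F p)) (fun x => θ x * psiC p F x)
    rw [← h]
    refine Finset.sum_congr rfl fun x _ => ?_
    simp [frobenius_def, psiC_pow_p, MulChar.pow_apply' _ hp.out.ne_zero]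

lemma val_char_le (F : Type*) [Field F] [Fintype F] (χ : MulChar F ℂ) (x : F) : B.valuation (χ x) ≤ 1 := by
  by_cases hx : x = 0
  · subst hx; rw [MulChar.map_zero, map_zero]; exact zero_le
  · refine (val_root B (Fintype.card F - 1) ?_ _ ?_).le
    · have := Fintype.one_lt_card (α := F); omega
    · rw [← map_pow, FiniteField.pow_card_sub_one_eq_one x hx, map_one]

lemma val_gauss_mul (p : ℕ) [hp : Fact p.Prime] (F : Type*) [Field F] [Fintype F]
    [Algebra (ZMod p) F] (χ φ : MulChar F ℂ) (h : χ * φ ≠ 1) :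
    B.valuation (gaussSum χ (psiC p F)) * B.valuation (gaussSum φ (psiC p F)) ≤ B.valuation (gaussSum (χ * φ) (psiC p F)) := by
  rw [← map_mul, ← jacobiSum_mul_nontrivial h, map_mul]
  refine mul_le_of_le_one_right' ?_
  unfold jacobiSum
  refine Valuation.map_sum_le _ fun x _ => ?_
  rw [map_mul]
  exact mul_le_one' (val_char_le B F χ _) (val_char_le B F φ _)

end PartB3

section PartB4

variable (B : ValuationSubring ℂ)

lemma val_add_step (p : ℕ) [hp : Fact p.Prime] (F : Type*) [Field F] [Fintype F]
    [Algebra (ZMod p) F] (f : ℕ) (τ : MulChar F ℂ) (hτ : orderOf τ = p ^ f - 1)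
    (h1 : B.valuation (piP p) ≤ B.valuation (gaussSum τ (psiC p F)))
    (a s i d : ℕ) (hlt : a + d * p ^ i < p ^ f - 1)
    (hP : B.valuation (piP p) ^ s ≤ B.valuation (gaussSum (τ ^ a) (psiC p F))) :
    B.valuation (piP p) ^ (s + d) ≤ B.valuation (gaussSum (τ ^ (a + d * p ^ i)) (psiC p F)) := by
  induction d with
  | zero => simpa using hP
  | succ d ih =>
    have hpi : 0 < p ^ i := pow_pos hp.out.pos i
    have e : a + (d + 1) * p ^ i = a + d * p ^ i + p ^ i := by ring
    have h2 := ih (by rw [e] at hlt; omega)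
    rw [e, pow_add τ]
    refine le_trans ?_ (val_gauss_mul B p F _ _ ?_)
    · rw [← add_assoc, pow_succ]
      refine mul_le_mul' h2 ?_
      rw [gauss_frob]; exact h1
    · rw [← pow_add, ← e]
      refine pow_ne_one_of_lt_orderOf ?_ (by rw [hτ]; exact hlt)
      rw [e]; omega

lemma val_digit_sum (p : ℕ) [hp : Fact p.Prime] (F : Type*) [Field F] [Fintype F]
    [Algebra (ZMod p) F] (f : ℕ) (τ : MulChar F ℂ) (hτ : orderOf τ = p ^ f - 1)
    (h1 : B.valuation (piP p) ≤ B.valuation (gaussSum τ (psiC p F)))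
    (d e : ℕ → ℕ) (r : ℕ) (hlt : ∑ i ∈ Finset.range r, d i * p ^ e i < p ^ f - 1) :
    B.valuation (piP p) ^ (∑ i ∈ Finset.range r, d i) ≤
      B.valuation (gaussSum (τ ^ (∑ i ∈ Finset.range r, d i * p ^ e i)) (psiC p F)) := by
  induction r with
  | zero => simp [gaussSum_one_left (psiC_ne_one p F)]
  | succ r ih =>
    rw [Finset.sum_range_succ] at hlt ⊢
    rw [Finset.sum_range_succ]
    exact val_add_step B p F f τ hτ h1 _ _ _ _ hlt (ih (by omega))

lemma val_lower (p : ℕ) [hp : Fact p.Prime] (F : Type*) [Field F] [Fintype F]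
    [Algebra (ZMod p) F] (f : ℕ) (τ : MulChar F ℂ) (hτ : orderOf τ = p ^ f - 1)
    (h1 : B.valuation (piP p) ≤ B.valuation (gaussSum τ (psiC p F)))
    (n c u : ℕ) (hn : n * c = p ^ f - 1) (hu : u < n) (hc : 0 < c) :
    ∃ D, n * D + (∑ i ∈ Finset.range f, (p ^ i * u) % n) = p * (∑ i ∈ Finset.range f, (p ^ i * u) % n) ∧
      B.valuation (piP p) ^ D ≤ B.valuation (gaussSum (τ ^ (u * c)) (psiC p F)) := by
  set x : ℕ → ℕ := fun i => (p ^ i * u) % n with hx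
  set d : ℕ → ℕ := fun i => p * x i / n with hd
  have hrec : ∀ i, n * d i + x (i + 1) = p * x i := by
    intro i
    have : x (i + 1) = (p * x i) % n := by
      simp only [hx]; rw [Nat.mul_mod_mod, pow_succ']; congr 1; ring
    rw [this]; exact Nat.div_add_mod _ _
  have hx0 : x 0 = u := by simp [hx, Nat.mod_eq_of_lt hu]
  have hpf : 1 ≤ p ^ f := Nat.one_le_pow _ _ hp.out.pos
  have hxf : x f = u := by
    have e : p ^ f * u = u + n * (c * u) := by
      have : p ^ f = n * c + 1 := by omega
      rw [this]; ring
    simp only [hx]; rw [e, Nat.add_mul_mod_self_left, Nat.mod_eq_of_lt hu]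
  have hsum1 : ∀ r ≤ f, n * (∑ i ∈ Finset.range r, d i * p ^ (f - 1 - i)) + x r * p ^ (f - r) = p ^ f * u := by
    intro r hr
    induction r with
    | zero => simp [hx0]; ring
    | succ r ih =>
      rw [← ih (by omega), Finset.sum_range_succ, mul_add]
      have e : f - r = (f - 1 - r) + 1 := by omega
      have e2 : f - (r + 1) = f - 1 - r := by omega
      rw [e2, e, pow_succ]
      have := hrec r
      calc _ = n * ∑ i ∈ Finset.range r, d i * p ^ (f - 1 - i) + (n * d r + x (r+1)) * p ^ (f - 1 - r) := by ring
        _ = _ := by rw [this]; ring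
  have hS : ∑ i ∈ Finset.range f, d i * p ^ (f - 1 - i) = u * c := by
    have h := hsum1 f le_rfl
    rw [hxf, Nat.sub_self, pow_zero, mul_one] at h
    have e : p ^ f * u = u + n * (u * c) := by
      have : p ^ f = n * c + 1 := by omega
      rw [this]; ring
    have hnpos : 0 < n := by omega
    apply Nat.eq_of_mul_eq_mul_left hnpos
    omega
  refine ⟨∑ i ∈ Finset.range f, d i, ?_, ?_⟩
  · have h2 : ∑ i ∈ Finset.range f, x (i + 1) = ∑ i ∈ Finset.range f, x i := by
      have a1 := Finset.sum_range_succ x f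
      have a2 := Finset.sum_range_succ' x f
      omega
    rw [← h2]
    conv_rhs => rw [h2]
    rw [Finset.mul_sum, Finset.mul_sum, ← Finset.sum_add_distrib]
    exact Finset.sum_congr rfl fun i _ => hrec i
  · rw [← hS]
    refine val_digit_sum B p F f τ hτ h1 d _ f ?_
    rw [hS, ← hn]
    exact Nat.mul_lt_mul_of_pos_right hu hc

lemma gauss_mul_inv (p : ℕ) [hp : Fact p.Prime] (F : Type*) [Field F] [Fintype F]
    [Algebra (ZMod p) F] (χ : MulChar F ℂ) (hχ : χ ≠ 1) :
    gaussSum χ (psiC p F) * gaussSum χ⁻¹ (psiC p F) = χ (-1) * Fintype.card F := by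
  have h := gaussSum_mul_gaussSum_eq_card hχ (psiC_prim p F)
  have h2 := gaussSum_mulShift χ⁻¹ (psiC p F) (-1)
  have h3 : χ⁻¹ (-1) = χ (-1) := by rw [MulChar.inv_apply']; simp
  have h4 : (psiC p F).mulShift ((-1 : Fˣ) : F) = (psiC p F)⁻¹ := by
    rw [AddChar.inv_mulShift]; simp
  rw [h4] at h2
  rw [← h2, ← h]
  simp [h3]; ring

lemma val_upper (p : ℕ) [hp : Fact p.Prime] (F : Type*) [Field F] [Fintype F]
    [Algebra (ZMod p) F] (f : ℕ) (hcard : Fintype.card F = p ^ f) (τ : MulChar F ℂ) (hτ : orderOf τ = p ^ f - 1)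
    (h1 : B.valuation (piP p) ≤ B.valuation (gaussSum τ (psiC p F)))
    (n c u : ℕ) (hn : n * c = p ^ f - 1) (hu : u < n) (hu0 : 0 < u) (hc : 0 < c) (hnp : n.Coprime p) :
    ∃ D, n * D + (∑ i ∈ Finset.range f, (p ^ i * u) % n) = p * (∑ i ∈ Finset.range f, (p ^ i * u) % n) ∧
      B.valuation (gaussSum (τ ^ (u * c)) (psiC p F)) ≤ B.valuation (piP p) ^ D := by
  obtain ⟨D, hD, hv⟩ := val_lower B p F f τ hτ h1 n c u hn hu hc
  obtain ⟨D', hD', hv'⟩ := val_lower B p F f τ hτ h1 n c (n - u) hn (by omega) hc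
  refine ⟨D, hD, ?_⟩
  have hsum : (∑ i ∈ Finset.range f, (p ^ i * u) % n) + (∑ i ∈ Finset.range f, (p ^ i * (n - u)) % n) = n * f := by
    rw [← Finset.sum_add_distrib]
    have : ∀ i ∈ Finset.range f, (p ^ i * u) % n + (p ^ i * (n - u)) % n = n := by
      intro i _
      have hdvd : n ∣ (p ^ i * u) % n + (p ^ i * (n - u)) % n := by
        rw [Nat.dvd_iff_mod_eq_zero, ← Nat.add_mod, ← mul_add, Nat.add_sub_cancel' hu.le]; simp
      have a1 : (p ^ i * u) % n < n := Nat.mod_lt _ (by omega)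
      have a2 : (p ^ i * (n - u)) % n < n := Nat.mod_lt _ (by omega)
      have a3 : (p ^ i * u) % n ≠ 0 := by
        intro h
        have h2 := Nat.dvd_of_mod_eq_zero h
        have h3 := (Nat.Coprime.dvd_mul_left (Nat.Coprime.pow_right i hnp)).mp h2
        exact absurd (Nat.le_of_dvd hu0 h3) (by omega)
      obtain ⟨z, hz⟩ := hdvd
      have : z = 1 := by
        have hz1 : 0 < z := by
          rcases Nat.eq_zero_or_pos z with h | h
          · subst h; omega
          · exact h
        have hz2 : z < 2 := by
          by_contra! h
          have := Nat.mul_le_mul_left n h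
          omega
        omega
      rw [hz, this, mul_one]
    rw [Finset.sum_congr rfl this]; simp; ring
  have hDD : D + D' = (p - 1) * f := by
    have hnpos : 0 < n := by omega
    apply Nat.eq_of_mul_eq_mul_left hnpos
    have hp1 := hp.out.pos
    obtain ⟨r, hr⟩ : ∃ r, p = r + 1 := ⟨p - 1, by omega⟩
    have e : p - 1 = r := by omega
    rw [e]
    generalize (∑ i ∈ Finset.range f, (p ^ i * u) % n) = S at *
    generalize (∑ i ∈ Finset.range f, (p ^ i * (n - u)) % n) = S' at *
    rw [hr] at hD hD'
    have a : n * (D + D') = r * (S + S') := by linarith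
    rw [a, hsum]; ring
  have hinv : τ ^ ((n - u) * c) = (τ ^ (u * c))⁻¹ := by
    rw [eq_inv_iff_mul_eq_one, ← pow_add, ← add_mul, Nat.sub_add_cancel hu.le, hn, ← hτ, pow_orderOf_eq_one]
  have hne : τ ^ (u * c) ≠ 1 := by
    refine pow_ne_one_of_lt_orderOf (by positivity) ?_
    rw [hτ, ← hn]; exact Nat.mul_lt_mul_of_pos_right hu hc
  have hprod := congrArg B.valuation (gauss_mul_inv p F _ hne)
  rw [map_mul, map_mul, hcard, ← hinv] at hprod
  have hm1 : B.valuation ((τ ^ (u * c)) (-1)) = 1 := by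
    refine val_root B 2 (by simp) _ ?_
    rw [← map_pow]; simp
  have hq : B.valuation ((p ^ f : ℕ) : ℂ) = B.valuation (piP p) ^ (D + D') := by
    push_cast
    rw [map_pow, val_p_eq B p, ← pow_mul, hDD]
  rw [hm1, one_mul, hq, pow_add] at hprod
  have hpi0 : B.valuation (piP p) ≠ 0 := by
    rw [Valuation.ne_zero_iff]
    unfold piP
    rw [sub_ne_zero]
    exact (std_one_prim p).ne_one hp.out.one_lt
  have hpos : 0 < B.valuation (piP p) ^ D' := zero_lt_iff.mpr (pow_ne_zero _ hpi0)
  refine le_of_mul_le_mul_right ?_ hpos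
  rw [← hprod]
  exact mul_le_mul_right hv' _

end PartB4

section PartB5

lemma orbit_iff (p₁ : ℕ) [hp₁ : Fact p₁.Prime] (h8 : p₁ % 8 = 3) (m : ℕ) (hm : 1 ≤ m) (p f : ℕ)
    (hf : orderOf (p : ZMod (p₁ ^ m)) = f) (h2f : 2 * f = Nat.totient (p₁ ^ m)) (hfo : f % 2 = 1) :
    quadraticChar (ZMod p₁) (p : ZMod p₁) = 1 ∧
    ∀ u v : ℕ, quadraticChar (ZMod p₁) (u : ZMod p₁) ≠ 0 →
      quadraticChar (ZMod p₁) (u : ZMod p₁) = quadraticChar (ZMod p₁) (v : ZMod p₁) →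
      ∃ i < f, (v : ZMod (p₁ ^ m)) = (p : ZMod (p₁ ^ m)) ^ i * u := by
  have hd : p₁ ∣ p₁ ^ m := dvd_pow_self p₁ (by omega)
  haveI : NeZero (p₁ ^ m) := ⟨pow_ne_zero _ hp₁.out.ne_zero⟩
  have hpp : (p : ZMod (p₁ ^ m)) ^ f = 1 := by rw [← hf, pow_orderOf_eq_one]
  have hpq : (p : ZMod p₁) ^ f = 1 := by
    have := congrArg (ZMod.castHom hd (ZMod p₁)) hpp
    rwa [map_pow, map_natCast, map_one] at this
  have hchi : quadraticChar (ZMod p₁) (p : ZMod p₁) = 1 := by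
    have h1 : (quadraticChar (ZMod p₁) (p : ZMod p₁)) ^ f = 1 := by rw [← map_pow, hpq]; simp
    obtain ⟨k, hk⟩ : ∃ k, f = 2 * k + 1 := ⟨f / 2, by omega⟩
    have hne : (p : ZMod p₁) ≠ 0 := by
      intro h0; rw [h0, zero_pow (by omega)] at hpq; exact zero_ne_one hpq
    rw [hk, pow_succ, pow_mul, quadraticChar_sq_one hne] at h1
    simpa using h1
  refine ⟨hchi, ?_⟩
  have hcop : p.Coprime (p₁ ^ m) := by
    rw [← ZMod.isUnit_iff_coprime]
    exact IsUnit.of_pow_eq_one hpp (by omega)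
  set P : (ZMod (p₁ ^ m))ˣ := ZMod.unitOfCoprime p hcop with hP
  have hPv : (P : ZMod (p₁ ^ m)) = p := ZMod.coe_unitOfCoprime p hcop
  let Φ : (ZMod (p₁ ^ m))ˣ →* ℤ :=
    (quadraticChar (ZMod p₁)).toMonoidHom.comp
      ((ZMod.castHom hd (ZMod p₁)).toMonoidHom.comp (Units.coeHom _))
  have hΦ : ∀ x, Φ x = quadraticChar (ZMod p₁) (ZMod.castHom hd (ZMod p₁) x) := fun x => rfl
  have hle : Subgroup.zpowers P ≤ Φ.ker := by
    rw [Subgroup.zpowers_le, MonoidHom.mem_ker, hΦ, hPv, map_natCast, hchi]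
  have hordP : orderOf P = f := by rw [← orderOf_units, hPv, hf]
  have hindex : (Subgroup.zpowers P).index = 2 := by
    have h1 := (Subgroup.zpowers P).card_mul_index
    rw [Nat.card_zpowers, hordP, Nat.card_eq_fintype_card, ZMod.card_units_eq_totient, ← h2f, mul_comm 2] at h1
    exact Nat.eq_of_mul_eq_mul_left (by omega) h1
  have hker : Φ.ker ≠ ⊤ := by
    intro h
    have : (-1 : (ZMod (p₁ ^ m))ˣ) ∈ Φ.ker := by rw [h]; trivial
    rw [MonoidHom.mem_ker, hΦ] at this
    rw [Units.val_neg, Units.val_one, map_neg, map_one, quadChar_neg_one p₁ h8] at this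
    exact absurd this (by decide)
  have heq : Subgroup.zpowers P = Φ.ker := by
    have h1 := Subgroup.relIndex_mul_index hle
    have h2 : Φ.ker.index ≠ 1 := by rwa [Ne, Subgroup.index_eq_one]
    rw [hindex] at h1
    have h3 : Φ.ker.index ∣ 2 := ⟨_, by rw [mul_comm]; exact h1.symm⟩
    rcases (Nat.dvd_prime Nat.prime_two).mp h3 with h | h
    · exact absurd h h2
    · rw [h] at h1
      have : (Subgroup.zpowers P).relIndex Φ.ker = 1 := by omega
      exact le_antisymm hle (Subgroup.relIndex_eq_one.mp this)
  intro u v hu huv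
  have hcopr : ∀ x : ℕ, quadraticChar (ZMod p₁) (x : ZMod p₁) ≠ 0 → x.Coprime (p₁ ^ m) := by
    intro x hx
    apply Nat.Coprime.pow_right
    rw [Nat.coprime_comm, Nat.Prime.coprime_iff_not_dvd hp₁.out, ← ZMod.natCast_eq_zero_iff]
    intro h0; rw [h0] at hx; simp at hx
  set U := ZMod.unitOfCoprime u (hcopr u hu) with hU
  set V := ZMod.unitOfCoprime v (hcopr v (huv ▸ hu)) with hV
  have hmem : V * U⁻¹ ∈ Φ.ker := by
    rw [MonoidHom.mem_ker]
    have h1 : Φ V = Φ U := by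
      rw [hΦ, hΦ, ZMod.coe_unitOfCoprime, ZMod.coe_unitOfCoprime, map_natCast (ZMod.castHom hd (ZMod p₁)), map_natCast (ZMod.castHom hd (ZMod p₁)), huv]
    rw [map_mul, h1, ← map_mul, mul_inv_cancel, map_one]
  rw [← heq, Subgroup.mem_zpowers_iff] at hmem
  have hmem2 : V * U⁻¹ ∈ Submonoid.powers P := by
    rw [mem_powers_iff_mem_zpowers]; exact Subgroup.mem_zpowers_iff.mpr hmem
  obtain ⟨i, hi, hi2⟩ := (Submonoid.mem_powers_iff _ _).mp hmem2 |>.imp fun n hn => (⟨trivial, hn⟩ : True ∧ _)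
  refine ⟨i % f, Nat.mod_lt _ (by omega), ?_⟩
  have h3 : V = P ^ (i % f) * U := by
    rw [← hordP, pow_mod_orderOf, hi2]; group
  have := congrArg Units.val h3
  rw [Units.val_mul, Units.val_pow_eq_pow_val, hPv] at this
  rwa [hU, hV, ZMod.coe_unitOfCoprime, ZMod.coe_unitOfCoprime] at this

lemma sum_chi_full (p₁ : ℕ) [hp₁ : Fact p₁.Prime] (h8 : p₁ % 8 = 3) :
   (∑ x ∈ Finset.range p₁, quadraticChar (ZMod p₁) (x : ZMod p₁)) = 0 ∧
   (∑ x ∈ Finset.range p₁, quadraticChar (ZMod p₁) (x : ZMod p₁) * x) = XX p₁ := by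
  have key : ∀ g : ZMod p₁ → ℤ, ∑ x ∈ Finset.range p₁, g (x : ZMod p₁) = ∑ a, g a := by
    intro g
    refine Finset.sum_bij' (fun x _ => (x : ZMod p₁)) (fun a _ => a.val) ?_ ?_ ?_ ?_ ?_
    · intros; simp
    · intro a _; simpa using ZMod.val_lt a
    · intro x hx; exact ZMod.val_cast_of_lt (by simpa using hx)
    · intro a _; simp
    · intros; rfl
  refine ⟨?_, ?_⟩
  · rw [key]
    have : ringChar (ZMod p₁) ≠ 2 := by rw [ZMod.ringChar_zmod_n]; omega
    exact quadraticChar_sum_zero this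
  · unfold XX
    rw [← key (fun a => quadraticChar (ZMod p₁) a * a.val)]
    refine Finset.sum_congr rfl fun x hx => ?_
    rw [ZMod.val_cast_of_lt (by simpa using hx)]

lemma sum_chi_mul (p₁ : ℕ) [hp₁ : Fact p₁.Prime] (h8 : p₁ % 8 = 3) (M : ℕ) :
   (∑ x ∈ Finset.range (M * p₁), quadraticChar (ZMod p₁) (x : ZMod p₁) * x) = M * XX p₁ := by
  obtain ⟨h0, h1⟩ := sum_chi_full p₁ h8
  induction M with
  | zero => simp
  | succ M ih =>
    rw [add_mul, Finset.sum_range_add, ih, one_mul]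
    have : ∀ x ∈ Finset.range p₁, quadraticChar (ZMod p₁) ((M * p₁ + x : ℕ) : ZMod p₁) * ((M * p₁ + x : ℕ) : ℤ)
        = quadraticChar (ZMod p₁) (x : ZMod p₁) * x + (M * p₁) * quadraticChar (ZMod p₁) (x : ZMod p₁) := by
      intro x _; push_cast; simp; ring
    rw [Finset.sum_congr rfl this, Finset.sum_add_distrib, ← Finset.mul_sum, h0, h1]
    push_cast; ring

lemma orbit_sum (p₁ : ℕ) [hp₁ : Fact p₁.Prime] (h8 : p₁ % 8 = 3) (m : ℕ) (hm : 1 ≤ m) (p f : ℕ)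
    (hf : orderOf (p : ZMod (p₁ ^ m)) = f) (h2f : 2 * f = Nat.totient (p₁ ^ m)) (hfo : f % 2 = 1)
    (u : ℕ) (hu : quadraticChar (ZMod p₁) (u : ZMod p₁) ≠ 0) :
    ((∑ i ∈ Finset.range f, (p ^ i * u) % (p₁ ^ m) : ℕ) : ℤ) =
     ∑ x ∈ (Finset.range (p₁ ^ m)).filter (fun x : ℕ => quadraticChar (ZMod p₁) (x : ZMod p₁) = quadraticChar (ZMod p₁) (u : ZMod p₁)), (x : ℤ) := by
  obtain ⟨hchi, horb⟩ := orbit_iff p₁ h8 m hm p f hf h2f hfo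
  have hd : p₁ ∣ p₁ ^ m := dvd_pow_self p₁ (by omega)
  have hpos : 0 < p₁ ^ m := pow_pos hp₁.out.pos m
  push_cast
  have hmodc : ∀ y : ℕ, ((y % p₁ ^ m : ℕ) : ZMod p₁) = y := by
    intro y
    rw [ZMod.natCast_eq_natCast_iff]
    exact (Nat.mod_modEq y (p₁ ^ m)).of_dvd hd
  refine Finset.sum_bij (fun i _ => (p ^ i * u) % (p₁ ^ m)) ?_ ?_ ?_ ?_
  · intro i _
    simp only [Finset.mem_filter, Finset.mem_range]
    refine ⟨Nat.mod_lt _ hpos, ?_⟩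
    rw [hmodc]; push_cast; rw [map_mul, map_pow, hchi]; simp
  · intro i hi j hj hij
    simp only [Finset.mem_range] at hi hj
    have h1 : ((p ^ i * u : ℕ) : ZMod (p₁ ^ m)) = ((p ^ j * u : ℕ) : ZMod (p₁ ^ m)) :=
      (ZMod.natCast_eq_natCast_iff _ _ _).mpr hij
    push_cast at h1
    have hU : IsUnit (u : ZMod (p₁ ^ m)) := by
      rw [ZMod.isUnit_iff_coprime]
      apply Nat.Coprime.pow_right
      rw [Nat.coprime_comm, Nat.Prime.coprime_iff_not_dvd hp₁.out, ← ZMod.natCast_eq_zero_iff]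
      intro h0; rw [h0] at hu; simp at hu
    have h2 := hU.mul_right_cancel h1
    exact pow_injOn_Iio_orderOf (by simpa [hf] using hi) (by simpa [hf] using hj) h2
  · intro x hx
    simp only [Finset.mem_filter, Finset.mem_range] at hx
    obtain ⟨i, hi, h⟩ := horb u x hu hx.2.symm
    refine ⟨i, by simpa using hi, ?_⟩
    have h1 : ((x : ℕ) : ZMod (p₁ ^ m)) = ((p ^ i * u : ℕ) : ZMod (p₁ ^ m)) := by push_cast; exact h
    rw [ZMod.natCast_eq_natCast_iff] at h1
    have := h1.symm
    rw [Nat.ModEq, Nat.mod_eq_of_lt hx.1] at this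
    exact this
  · intros; push_cast; rfl

lemma pow_succ_pred (p₁ m : ℕ) (hm : 1 ≤ m) : p₁ ^ m = p₁ ^ (m - 1) * p₁ := by
  rw [← pow_succ]; congr 1; omega

lemma orbit_sum2 (p₁ : ℕ) [hp₁ : Fact p₁.Prime] (h8 : p₁ % 8 = 3) (m : ℕ) (hm : 1 ≤ m) (p f : ℕ)
    (hf : orderOf (p : ZMod (p₁ ^ m)) = f) (h2f : 2 * f = Nat.totient (p₁ ^ m)) (hfo : f % 2 = 1)
    (u : ℕ) (hu : quadraticChar (ZMod p₁) (u : ZMod p₁) ≠ 0) :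
    2 * ((∑ i ∈ Finset.range f, (p ^ i * u) % (p₁ ^ m) : ℕ) : ℤ) = (p₁ ^ m : ℕ) * f +
      quadraticChar (ZMod p₁) (u : ZMod p₁) * ((p₁ ^ (m - 1) : ℕ) * XX p₁) := by
  rw [orbit_sum p₁ h8 m hm p f hf h2f hfo u hu]
  have hd : p₁ ∣ p₁ ^ m := dvd_pow_self p₁ (by omega)
  have hun : (u : ZMod p₁) ≠ 0 := by intro h; rw [h] at hu; simp at hu
  have he : quadraticChar (ZMod p₁) (u : ZMod p₁) = 1 ∨ quadraticChar (ZMod p₁) (u : ZMod p₁) = -1 :=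
    quadraticChar_dichotomy hun
  set e := quadraticChar (ZMod p₁) (u : ZMod p₁) with hedef
  have htri : ∀ x : ℕ, quadraticChar (ZMod p₁) (x : ZMod p₁) = 0 ∨ quadraticChar (ZMod p₁) (x : ZMod p₁) = 1 ∨ quadraticChar (ZMod p₁) (x : ZMod p₁) = -1 := by
    intro x
    by_cases h : (x : ZMod p₁) = 0
    · left; rw [h]; simp
    · right; exact quadraticChar_dichotomy h
  -- sum of all unit residues
  have hall : 2 * ∑ x ∈ Finset.range (p₁ ^ m), (quadraticChar (ZMod p₁) (x : ZMod p₁)) ^ 2 * (x : ℤ) = (p₁ ^ m : ℕ) * (2 * f) := by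
    have hcount : ∑ x ∈ Finset.range (p₁ ^ m), (quadraticChar (ZMod p₁) (x : ZMod p₁)) ^ 2 = 2 * f := by
      have : ((2 * f : ℕ) : ℤ) = ∑ x ∈ Finset.range (p₁ ^ m), (quadraticChar (ZMod p₁) (x : ZMod p₁)) ^ 2 := by
        rw [h2f, Nat.totient_eq_card_coprime, Finset.card_filter]
        push_cast
        refine Finset.sum_congr rfl fun x _ => ?_
        have h1 : (p₁ ^ m).Coprime x ↔ ((x : ZMod p₁) ≠ 0) := by
          rw [Nat.coprime_pow_left_iff (by omega), Nat.Prime.coprime_iff_not_dvd hp₁.out, Ne, ZMod.natCast_eq_zero_iff]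
        by_cases hx : (x : ZMod p₁) = 0
        · rw [if_neg (by rw [h1]; simpa using hx), hx]; simp
        · rw [if_pos (by rw [h1]; exact hx), quadraticChar_sq_one hx]
      rw [← this]; push_cast; rfl
    have hrefl : ∑ x ∈ Finset.range (p₁ ^ m), (quadraticChar (ZMod p₁) (x : ZMod p₁)) ^ 2 * (x : ℤ)
       = ∑ x ∈ Finset.range (p₁ ^ m), (quadraticChar (ZMod p₁) (x : ZMod p₁)) ^ 2 * ((p₁ ^ m : ℕ) - x : ℤ) := by
      have a1 := Finset.sum_range_succ (fun x : ℕ => (quadraticChar (ZMod p₁) (x : ZMod p₁)) ^ 2 * (x : ℤ)) (p₁ ^ m)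
      have a2 := Finset.sum_range_succ (fun x : ℕ => (quadraticChar (ZMod p₁) (x : ZMod p₁)) ^ 2 * ((p₁ ^ m : ℕ) - x : ℤ)) (p₁ ^ m)
      have hz : quadraticChar (ZMod p₁) ((p₁ ^ m : ℕ) : ZMod p₁) = 0 := by
        rw [(ZMod.natCast_eq_zero_iff _ _).mpr hd]; simp
      rw [hz] at a1 a2
      simp only [ne_eq, OfNat.ofNat_ne_zero, not_false_eq_true, zero_pow, zero_mul, add_zero] at a1 a2
      rw [← a1, ← a2, ← Finset.sum_range_reflect]
      refine Finset.sum_congr rfl fun x hx => ?_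
      have hx' : x ≤ p₁ ^ m := by simp at hx; omega
      have e1 : p₁ ^ m + 1 - 1 - x = p₁ ^ m - x := by omega
      rw [e1, Nat.cast_sub hx', Nat.cast_sub hx', (ZMod.natCast_eq_zero_iff _ _).mpr hd, zero_sub, ← neg_one_mul, map_mul, mul_pow, quadChar_neg_one p₁ h8]
      simp
    have : ∑ x ∈ Finset.range (p₁ ^ m), (quadraticChar (ZMod p₁) (x : ZMod p₁)) ^ 2 * ((p₁ ^ m : ℕ) - x : ℤ)
        = (p₁ ^ m : ℕ) * (2 * f) - ∑ x ∈ Finset.range (p₁ ^ m), (quadraticChar (ZMod p₁) (x : ZMod p₁)) ^ 2 * (x : ℤ) := by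
      rw [← hcount, Finset.mul_sum, ← Finset.sum_sub_distrib]
      exact Finset.sum_congr rfl fun x _ => by ring
    rw [two_mul]; nth_rw 1 [hrefl]; rw [this]; ring
  have hsig : ∑ x ∈ Finset.range (p₁ ^ m), quadraticChar (ZMod p₁) (x : ZMod p₁) * (x : ℤ) = (p₁ ^ (m - 1) : ℕ) * XX p₁ := by
    rw [← sum_chi_mul p₁ h8, ← pow_succ_pred p₁ m hm]
  have hsplit : 2 * ∑ x ∈ (Finset.range (p₁ ^ m)).filter (fun x : ℕ => quadraticChar (ZMod p₁) (x : ZMod p₁) = e), (x : ℤ)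
     = ∑ x ∈ Finset.range (p₁ ^ m), (quadraticChar (ZMod p₁) (x : ZMod p₁)) ^ 2 * (x : ℤ) + e * ∑ x ∈ Finset.range (p₁ ^ m), quadraticChar (ZMod p₁) (x : ZMod p₁) * (x : ℤ) := by
    rw [Finset.sum_filter, Finset.mul_sum, Finset.mul_sum, ← Finset.sum_add_distrib]
    refine Finset.sum_congr rfl fun x _ => ?_
    rcases htri x with h | h | h <;> rcases he with h' | h' <;> rw [h, h'] <;> norm_num <;> ring
  rw [hsplit, hsig]
  linarith

lemma stick (p₁ : ℕ) [hp₁ : Fact p₁.Prime] (h8 : p₁ % 8 = 3) (m : ℕ) (hm : 1 ≤ m)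
    (K : Type*) [Field K] [NumberField K] (α : K)
    (hα : α ^ 2 = -(p₁ : K)) (hKα : Algebra.adjoin ℚ {α} = ⊤)
    (p f : ℕ) [hp : Fact p.Prime] (hf : orderOf (p : ZMod (p₁ ^ m)) = f)
    (h2f : 2 * f = Nat.totient (p₁ ^ m)) (hfo : f % 2 = 1)
    (F : Type*) [Field F] [Fintype F] [Algebra (ZMod p) F] (hcard : Fintype.card F = p ^ f)
    (hpn : (p₁ ^ m).Coprime p) (hq : 2 < p ^ f) :
    ∃ B : ValuationSubring ℂ, B.valuation (p : ℂ) < 1 ∧ ∀ θ : MulChar F ℂ, θ ^ (p₁ ^ m) = 1 →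
      θ ^ (p₁ ^ (m - 1)) ≠ 1 → ∀ k, 2 * k + NumberField.classNumber K ≤ f →
      B.valuation (gaussSum θ (psiC p F)) ≤ B.valuation (p : ℂ) ^ k := by
  obtain ⟨B, hB⟩ := exists_val p
  refine ⟨B, hB, ?_⟩
  obtain ⟨ω, ι, hω, hι, hgen, hord⟩ := teich B p hB F f hcard hq
  have hω1 : ω ≠ 1 := by intro h; rw [h, orderOf_one] at hord; omega
  have h1 := val_g_teich B p hB F f hcard (by omega) ω hω1 ι hω hι
  have hord' : orderOf ω⁻¹ = p ^ f - 1 := by rw [orderOf_inv, hord]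
  intro θ hθ hθ' k hk
  have hpos : 0 < p₁ ^ m := pow_pos hp₁.out.pos m
  have hdvd : p₁ ^ m ∣ p ^ f - 1 := by
    have : (p : ZMod (p₁ ^ m)) ^ f = 1 := by rw [← hf, pow_orderOf_eq_one]
    have h2 : ((p ^ f : ℕ) : ZMod (p₁ ^ m)) = ((1 : ℕ) : ZMod (p₁ ^ m)) := by push_cast; exact this
    rw [ZMod.natCast_eq_natCast_iff] at h2
    exact (Nat.modEq_iff_dvd' (by omega)).mp h2.symm
  obtain ⟨c, hc⟩ := hdvd
  have hcpos : 0 < c := by rcases Nat.eq_zero_or_pos c with h | h; (rw [h] at hc; omega); exact h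
  obtain ⟨a, ha⟩ := hgen θ⁻¹
  have ha : θ = ω⁻¹ ^ a := by rw [inv_pow, ← ha, inv_inv]
  have hda : c ∣ a := by
    rw [ha, ← pow_mul] at hθ
    have h3 := orderOf_dvd_of_pow_eq_one hθ
    rw [hord', hc, mul_comm a] at h3
    exact Nat.dvd_of_mul_dvd_mul_left hpos h3
  obtain ⟨b, hb⟩ := hda
  set u := b % p₁ ^ m with hu
  have hθu : θ = ω⁻¹ ^ (u * c) := by
    rw [ha, pow_eq_pow_iff_modEq, hord', hc, hb, mul_comm c b]
    exact ((Nat.mod_modEq b (p₁ ^ m)).mul_right' c).symm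
  have hnu : ¬ p₁ ∣ u := by
    rintro ⟨t, ht⟩
    apply hθ'
    rw [hθu, ← pow_mul, ← orderOf_dvd_iff_pow_eq_one, hord', hc, ht, pow_succ_pred p₁ m hm]
    exact ⟨t, by ring⟩
  have hchi : quadraticChar (ZMod p₁) (u : ZMod p₁) ≠ 0 := by
    rw [Ne, quadraticChar_eq_zero_iff, ZMod.natCast_eq_zero_iff]; exact hnu
  have hu0 : 0 < u := Nat.pos_of_ne_zero (by intro h; exact hnu (h ▸ dvd_zero _))
  obtain ⟨D, hD, hv⟩ := val_upper B p F f hcard ω⁻¹ hord' h1 (p₁ ^ m) c u hc.symm (Nat.mod_lt _ hpos) hu0 hcpos hpn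
  have hsum := orbit_sum2 p₁ h8 m hm p f hf h2f hfo u hchi
  generalize (∑ i ∈ Finset.range f, (p ^ i * u) % (p₁ ^ m)) = S at *
  have hDk : (p - 1) * k ≤ D := by
    have hX := XX_bound p₁ h8 K α hα hKα
    set H := NumberField.classNumber K
    have hp1 := hp.out.one_lt
    obtain ⟨r, hr⟩ : ∃ r, p = r + 1 := ⟨p - 1, by omega⟩
    have hpr : p - 1 = r := by omega
    rw [hpr]
    have hDz : ((p₁ ^ m : ℕ) : ℤ) * D = r * S := by
      have : p₁ ^ m * D = r * S := by rw [hr] at hD; linarith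
      exact_mod_cast this
    set M := p₁ ^ (m - 1)
    have hMpos : 0 < M := pow_pos hp₁.out.pos _
    have hM : ((p₁ ^ m : ℕ) : ℤ) = M * p₁ := by rw [pow_succ_pred p₁ m hm]; push_cast; rfl
    have hun : (u : ZMod p₁) ≠ 0 := by rw [Ne, ZMod.natCast_eq_zero_iff]; exact hnu
    have habs := abs_le.mp hX
    have hge : -((p₁ : ℤ) * H) ≤ quadraticChar (ZMod p₁) (u : ZMod p₁) * XX p₁ := by
      rcases quadraticChar_dichotomy hun with h | h <;> rw [h] <;> linarith [habs.1, habs.2]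
    have h2S : ((p₁ ^ m : ℕ) : ℤ) * (2 * k) ≤ 2 * S := by
      rw [hsum]
      have e1 : -(M * ((p₁ : ℤ) * H)) ≤ quadraticChar (ZMod p₁) (u : ZMod p₁) * (M * XX p₁) := by
        have := mul_le_mul_of_nonneg_left hge (Int.natCast_nonneg M)
        linarith
      have e2 : ((p₁ ^ m : ℕ) : ℤ) * (2 * k + H) ≤ ((p₁ ^ m : ℕ) : ℤ) * f :=
        mul_le_mul_of_nonneg_left (by exact_mod_cast hk) (Int.natCast_nonneg _)
      have e3 : ((p₁ ^ m : ℕ) : ℤ) * H = M * ((p₁ : ℤ) * H) := by rw [hM]; ring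
      linarith
    have h3 : ((p₁ ^ m : ℕ) : ℤ) * (r * k) ≤ ((p₁ ^ m : ℕ) : ℤ) * D := by
      rw [hDz]
      have := mul_le_mul_of_nonneg_left h2S (Int.natCast_nonneg r)
      linarith
    have h4 := le_of_mul_le_mul_left h3 (by exact_mod_cast hpos)
    exact_mod_cast h4
  rw [hθu]
  refine hv.trans ?_
  rw [val_p_eq, ← pow_mul]
  exact pow_le_pow_right_of_le_one' (piP_lt B p hB).le hDk

end PartB5

section PartC1

lemma rat_sum (p : ℕ) [hp : Fact p.Prime] (F : Type*) [Field F] [Fintype F] [Algebra (ZMod p) F]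
    (R : F → ℤ) (hR : ∀ (t : ZMod p) (x : F), t ≠ 0 → R (algebraMap (ZMod p) F t * x) = R x) :
    ∃ z : ℤ, ((p : ℂ) - 1) * ∑ x, (R x : ℂ) * psiC p F x = z := by
  have hin : ∀ x : F, ∃ z : ℤ, ∑ t : ZMod p, psiC p F (algebraMap (ZMod p) F t * x) = z := by
    intro x
    have h1 : ∀ t : ZMod p, psiC p F (algebraMap (ZMod p) F t * x) = ZMod.stdAddChar (t * Algebra.trace (ZMod p) F x) := by
      intro t
      rw [psiC_apply, ← Algebra.smul_def, map_smul, smul_eq_mul]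
    simp_rw [h1]
    have := AddChar.sum_mulShift (Algebra.trace (ZMod p) F x) (ZMod.isPrimitive_stdAddChar p)
    rw [this]
    split_ifs
    · exact ⟨_, (Int.cast_natCast _).symm⟩
    · exact ⟨0, by simp⟩
  choose z hz using hin
  have h0 : ∑ t : ZMod p, ∑ x, (R x : ℂ) * psiC p F (algebraMap (ZMod p) F t * x) =
      ((p : ℂ) - 1) * ∑ x, (R x : ℂ) * psiC p F x + ∑ x, (R x : ℂ) := by
    have : ∀ t : ZMod p, ∑ x, (R x : ℂ) * psiC p F (algebraMap (ZMod p) F t * x) =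
        (∑ x, (R x : ℂ) * psiC p F x) + if t = 0 then (∑ x, (R x : ℂ)) - (∑ x, (R x : ℂ) * psiC p F x) else 0 := by
      intro t
      split_ifs with ht
      · subst ht; simp
      · rw [add_zero]
        have hne : algebraMap (ZMod p) F t ≠ 0 := by simpa using ht
        rw [← Equiv.sum_comp (Equiv.mulLeft₀ _ hne) (fun x => (R x : ℂ) * psiC p F x)]
        refine Finset.sum_congr rfl fun x _ => ?_
        simp [hR t x ht]
    simp_rw [this]
    rw [Finset.sum_add_distrib]
    simp [ZMod.card]
    ring
  rw [Finset.sum_comm] at h0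
  simp_rw [← Finset.mul_sum, hz] at h0
  refine ⟨∑ x, R x * z x - ∑ x, R x, ?_⟩
  push_cast
  rw [h0]; ring

lemma rat_int (x : ℂ) (hx : IsIntegral ℤ x) (a b : ℤ) (ha : a ≠ 0) (h : a * x = b) : ∃ z : ℤ, x = z := by
  have hxq : x = algebraMap ℚ ℂ (b / a : ℚ) := by
    have : (a : ℂ) ≠ 0 := by exact_mod_cast ha
    simp
    field_simp
    rw [mul_comm]; exact h
  rw [hxq, isIntegral_algebraMap_iff (algebraMap ℚ ℂ).injective] at hx
  obtain ⟨z, hz⟩ := IsIntegrallyClosed.isIntegral_iff.mp hx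
  refine ⟨z, ?_⟩
  rw [hxq, ← hz]; simp

lemma int_sqfree (p₁ : ℕ) [hp₁ : Fact p₁.Prime] (x : ℂ) (a b : ℤ) (ha : a ≠ 0) (h : a * x = b)
    (hx : IsIntegral ℤ ((p₁ : ℂ) * x ^ 2)) : ∃ z : ℤ, x = z := by
  obtain ⟨e, he⟩ := rat_int _ hx (a ^ 2) (p₁ * b ^ 2) (pow_ne_zero _ ha) (by push_cast; rw [← h]; ring)
  have he' : (p₁ : ℤ) * b ^ 2 = e * a ^ 2 := by
    have : ((p₁ : ℤ) * b ^ 2 : ℂ) = e * a ^ 2 := by push_cast; rw [← he, ← h]; ring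
    exact_mod_cast this
  -- x integral: x^2 * p₁ = e; show p₁ ∣ e
  have hpz : Prime (p₁ : ℤ) := Nat.prime_iff_prime_int.mp hp₁.out
  obtain ⟨e', hee⟩ : (p₁ : ℤ) ∣ e := by
    by_contra hcon
    have hb0 : b ≠ 0 := by
      rintro rfl
      have : e * a ^ 2 = 0 := by rw [← he']; ring
      rcases mul_eq_zero.mp this with h | h
      · exact hcon (h ▸ dvd_zero _)
      · exact ha (pow_eq_zero_iff (by norm_num) |>.mp h)
    have e1 : emultiplicity (p₁ : ℤ) ((p₁ : ℤ) * b ^ 2) = 1 + 2 * emultiplicity (p₁ : ℤ) b := by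
      rw [emultiplicity_mul hpz, emultiplicity_pow hpz]
      have := FiniteMultiplicity.emultiplicity_self (hpz.not_unit |> fun hu => (Int.finiteMultiplicity_iff.mpr ⟨by simpa using hp₁.out.ne_one, by simpa using hp₁.out.ne_zero⟩ : FiniteMultiplicity (p₁:ℤ) p₁))
      rw [this]; simp
    have e2 : emultiplicity (p₁ : ℤ) (e * a ^ 2) = 2 * emultiplicity (p₁ : ℤ) a := by
      rw [emultiplicity_mul hpz, emultiplicity_pow hpz, emultiplicity_eq_zero.mpr hcon]; simp
    have f1 : FiniteMultiplicity (p₁ : ℤ) b := Int.finiteMultiplicity_iff.mpr ⟨by simpa using hp₁.out.ne_one, hb0⟩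
    have f2 : FiniteMultiplicity (p₁ : ℤ) a := Int.finiteMultiplicity_iff.mpr ⟨by simpa using hp₁.out.ne_one, ha⟩
    rw [he', e2, f1.emultiplicity_eq_multiplicity, f2.emultiplicity_eq_multiplicity] at e1
    have : 2 * multiplicity (p₁ : ℤ) a = 1 + 2 * multiplicity (p₁ : ℤ) b := by exact_mod_cast e1
    omega
  refine rat_int x ?_ a b ha h
  have hp0 : (p₁ : ℂ) ≠ 0 := by exact_mod_cast hp₁.out.ne_zero
  have : x ^ 2 = e' := by
    apply mul_left_cancel₀ hp0
    rw [he, hee]; push_cast; ring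
  refine IsIntegral.of_pow (n := 2) (by norm_num) ?_
  rw [this]; exact isIntegral_algebraMap (R := ℤ) (A := ℂ) (x := e')

lemma chi_sq_sum_pow (p₁ : ℕ) [hp₁ : Fact p₁.Prime] (M : ℕ) (z : ℂ) (hz : z = 0 ∨ z ^ (M * p₁) = 1) :
    ∃ r : ℤ, ∑ u ∈ Finset.range (M * p₁), (quadCharC p₁ (u : ZMod p₁)) ^ 2 * z ^ u = r := by
  have geo : ∀ (w : ℂ) (L : ℕ), w = 0 ∨ w ^ L = 1 → ∃ r : ℤ, ∑ u ∈ Finset.range L, w ^ u = r := by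
    intro w L hw
    rcases hw with rfl | hw
    · rcases Nat.eq_zero_or_pos L with rfl | hL
      · exact ⟨0, by simp⟩
      · refine ⟨1, ?_⟩
        rw [Finset.sum_eq_single 0]
        · simp
        · intro b _ hb; exact zero_pow hb
        · intro h; simp at h; omega
    · by_cases h1 : w = 1
      · exact ⟨L, by simp [h1]⟩
      · refine ⟨0, ?_⟩
        rw [geom_sum_eq h1, hw]; simp
  obtain ⟨r1, h1⟩ := geo z (M * p₁) hz
  obtain ⟨r2, h2⟩ := geo (z ^ p₁) M (by
    rcases hz with rfl | h
    · left; exact zero_pow hp₁.out.ne_zero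
    · right; rw [← pow_mul, mul_comm, h])
  refine ⟨r1 - r2, ?_⟩
  have key : ∑ u ∈ Finset.range (M * p₁), (if p₁ ∣ u then z ^ u else 0) = ∑ t ∈ Finset.range M, (z ^ p₁) ^ t := by
    rw [← Finset.sum_filter]
    symm
    refine Finset.sum_bij (fun t _ => p₁ * t) ?_ ?_ ?_ ?_
    · intro t ht
      simp only [Finset.mem_filter, Finset.mem_range] at ht ⊢
      exact ⟨by rw [mul_comm]; exact Nat.mul_lt_mul_of_pos_right ht hp₁.out.pos, dvd_mul_right _ _⟩
    · intro a _ b _ h; exact Nat.eq_of_mul_eq_mul_left hp₁.out.pos h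
    · intro u hu
      simp only [Finset.mem_filter, Finset.mem_range] at hu
      obtain ⟨t, ht⟩ := hu.2
      refine ⟨t, ?_, ht.symm⟩
      rw [Finset.mem_range]
      have := hu.1; rw [ht, mul_comm] at this
      exact lt_of_mul_lt_mul_right this (Nat.zero_le _)
    · intro t _; rw [pow_mul]
  push_cast
  rw [← h1, ← h2, ← key, ← Finset.sum_sub_distrib]
  refine Finset.sum_congr rfl fun u _ => ?_
  have hsq : (quadCharC p₁ (u : ZMod p₁)) ^ 2 = if p₁ ∣ u then 0 else 1 := by
    split_ifs with h
    · rw [(ZMod.natCast_eq_zero_iff _ _).mpr h, quadCharC_zero]; simp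
    · have hu : (u : ZMod p₁) ≠ 0 := by rwa [Ne, ZMod.natCast_eq_zero_iff]
      rw [← MulChar.pow_apply' _ (by norm_num), quadCharC_sq, MulChar.one_apply (IsUnit.mk0 _ hu)]
  rw [hsq]; split_ifs <;> simp

lemma chi_sum_pow (p₁ : ℕ) [hp₁ : Fact p₁.Prime] (h8 : p₁ % 8 = 3) (M : ℕ) (hM : M ≠ 0) (z : ℂ) (hz : z = 0 ∨ z ^ (M * p₁) = 1) :
    ∃ r : ℤ, ∑ u ∈ Finset.range (M * p₁), (quadCharC p₁ (u : ZMod p₁)) * z ^ u = r * GG p₁ := by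
  rcases hz with rfl | hz
  · refine ⟨0, ?_⟩
    rw [Int.cast_zero, zero_mul]
    refine Finset.sum_eq_zero fun u _ => ?_
    rcases Nat.eq_zero_or_pos u with rfl | h
    · simp [quadCharC_zero]
    · rw [zero_pow (by omega), mul_zero]
  have hfac : ∀ L, ∑ u ∈ Finset.range (L * p₁), (quadCharC p₁ (u : ZMod p₁)) * z ^ u =
      (∑ t ∈ Finset.range L, (z ^ p₁) ^ t) * ∑ a ∈ Finset.range p₁, (quadCharC p₁ (a : ZMod p₁)) * z ^ a := by
    intro L
    induction L with
    | zero => simp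
    | succ L ih =>
      rw [add_mul, Finset.sum_range_add, ih, one_mul, Finset.sum_range_succ, add_mul, Finset.mul_sum (Finset.range p₁) _ ((z ^ p₁) ^ L)]
      congr 1
      refine Finset.sum_congr rfl fun a _ => ?_
      push_cast; simp; ring
  rw [hfac]
  by_cases h1 : z ^ p₁ = 1
  · obtain ⟨b, hb, hbz⟩ := (std_one_prim p₁).eq_pow_of_pow_eq_one h1
    refine ⟨M * quadraticChar (ZMod p₁) (b : ZMod p₁), ?_⟩
    have h3 := quad_shift p₁ h8 (b : ZMod p₁)
    have h4 : ∑ a ∈ Finset.range p₁, (quadCharC p₁ (a : ZMod p₁)) * z ^ a = ∑ a : ZMod p₁, quadCharC p₁ a * ZMod.stdAddChar ((b : ZMod p₁) * a) := by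
      refine Finset.sum_bij' (fun x _ => (x : ZMod p₁)) (fun a _ => a.val) ?_ ?_ ?_ ?_ ?_
      · intros; simp
      · intro a _; simpa using ZMod.val_lt a
      · intro x hx; exact ZMod.val_cast_of_lt (by simpa using hx)
      · intro a _; simp
      · intro a _
        rw [← hbz, ← pow_mul, ← std_pow, mul_one]; push_cast; rfl
    rw [h4, h3, h1]
    simp only [one_pow, Finset.sum_const, Finset.card_range, nsmul_eq_mul, mul_one]
    push_cast
    rw [mul_assoc]; rfl
  · refine ⟨0, ?_⟩
    rw [geom_sum_eq h1, ← pow_mul, mul_comm p₁, hz]; simp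

end PartC1

section PartC2

lemma not_sq_odd (p : ℕ) [hp : Fact p.Prime] (b : ℤ) (k : ℕ) (hk : k % 2 = 1) (h : b ^ 2 = 4 * (p : ℤ) ^ k) : False := by
  obtain ⟨s, hs⟩ : ∃ s, k = 2 * s + 1 := ⟨k / 2, by omega⟩
  have hp0 : (p : ℚ) ≠ 0 := by exact_mod_cast hp.out.ne_zero
  have hq : ((b : ℚ)) ^ 2 = 4 * (p : ℚ) ^ k := by exact_mod_cast h
  have h1 : IsSquare (p : ℚ) := by
    refine ⟨b / (2 * p ^ s), ?_⟩
    rw [div_mul_div_comm, ← pow_two, hq, hs, pow_succ, pow_mul]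
    field_simp
    ring
  rw [Rat.isSquare_natCast_iff] at h1
  exact (Nat.prime_iff.mp hp.out).not_isSquare h1

lemma h_odd (p₁ p h : ℕ) (hp₁ : p₁.Prime) (h3 : p₁ ≠ 3) (hcl : 1 + p₁ = 4 * p ^ h) : h % 2 = 1 := by
  by_contra hc
  obtain ⟨s, hs⟩ : ∃ s, h = 2 * s := ⟨h / 2, by omega⟩
  rw [hs, pow_mul', pow_two] at hcl
  set y := p ^ s
  have hy : 1 ≤ y := by
    rcases Nat.eq_zero_or_pos y with h | h
    · rw [h] at hcl; omega
    · exact h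
  obtain ⟨t, ht⟩ : ∃ t, y = t + 1 := ⟨y - 1, by omega⟩
  have hfac : p₁ = (2 * t + 1) * (2 * t + 3) := by rw [ht] at hcl; nlinarith
  rw [hfac] at hp₁
  rcases Nat.eq_zero_or_pos t with h0 | h0
  · apply h3; rw [hfac, h0]
  · exact Nat.not_prime_mul (by omega) (by omega) hp₁

lemma gauss_integral (p : ℕ) [hp : Fact p.Prime] (F : Type*) [Field F] [Fintype F] [Algebra (ZMod p) F]
    (χ : MulChar F ℂ) : IsIntegral ℤ (gaussSum χ (psiC p F)) := by
  unfold gaussSum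
  refine IsIntegral.sum _ fun x _ => IsIntegral.mul ?_ ?_
  · by_cases hx : x = 0
    · subst hx; rw [MulChar.map_zero]; exact isIntegral_zero
    · refine IsIntegral.of_pow (n := Fintype.card F - 1) (by have := Fintype.one_lt_card (α := F); omega) ?_
      rw [← map_pow, FiniteField.pow_card_sub_one_eq_one x hx, map_one]; exact isIntegral_one
  · refine IsIntegral.of_pow (n := p) hp.out.pos ?_
    rw [← AddChar.map_nsmul_eq_pow]
    have : p • x = 0 := by
      haveI : CharP F p := charP_of_injective_algebraMap (algebraMap (ZMod p) F).injective p
      simp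
    rw [this, AddChar.map_zero_eq_one]; exact isIntegral_one

lemma sum_chi_zero (p₁ : ℕ) [hp₁ : Fact p₁.Prime] (h8 : p₁ % 8 = 3) (M : ℕ) :
   (∑ x ∈ Finset.range (M * p₁), quadraticChar (ZMod p₁) (x : ZMod p₁)) = 0 := by
  obtain ⟨h0, h1⟩ := sum_chi_full p₁ h8
  induction M with
  | zero => simp
  | succ M ih =>
    rw [add_mul, Finset.sum_range_add, ih, one_mul, zero_add, ← h0]
    refine Finset.sum_congr rfl fun x _ => ?_
    push_cast; simp

/-- sums of Gauss sums against a function of the exponent vanishing at zero -/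
lemma sum_gauss_swap (p : ℕ) [hp : Fact p.Prime] (F : Type*) [Field F] [Fintype F] [Algebra (ZMod p) F]
    (θ : MulChar F ℂ) (L : ℕ) (c : ℕ → ℂ) (hc : c 0 = 0) :
    ∑ u ∈ Finset.range L, c u * gaussSum (θ ^ u) (psiC p F) =
      ∑ x, (∑ u ∈ Finset.range L, c u * (θ x) ^ u) * psiC p F x := by
  simp_rw [gaussSum, Finset.mul_sum, Finset.sum_mul]
  rw [Finset.sum_comm]
  refine Finset.sum_congr rfl fun x _ => Finset.sum_congr rfl fun u _ => ?_
  rcases Nat.eq_zero_or_pos u with rfl | h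
  · rw [hc]; simp
  · rw [MulChar.pow_apply' _ (by omega)]; ring

lemma theta_prime_field (p : ℕ) [hp : Fact p.Prime] (F : Type*) [Field F] [Fintype F] [Algebra (ZMod p) F]
    (θ : MulChar F ℂ) (n : ℕ) (hn : n.Coprime (p - 1)) (hθ : θ ^ n = 1) (t : ZMod p) (ht : t ≠ 0) :
    θ (algebraMap (ZMod p) F t) = 1 := by
  have hne : algebraMap (ZMod p) F t ≠ 0 := by simpa using ht
  have h1 : θ (algebraMap (ZMod p) F t) ^ n = 1 := by
    rcases Nat.eq_zero_or_pos n with rfl | h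
    · simp
    rw [← MulChar.pow_apply' _ (by omega), hθ, MulChar.one_apply (IsUnit.mk0 _ hne)]
  have h2 : θ (algebraMap (ZMod p) F t) ^ (p - 1) = 1 := by
    rw [← map_pow, ← map_pow, ZMod.pow_card_sub_one_eq_one ht]; simp
  have := orderOf_dvd_of_pow_eq_one h1
  have h3 := Nat.dvd_gcd this (orderOf_dvd_of_pow_eq_one h2)
  rw [hn] at h3
  exact orderOf_eq_one_iff.mp (Nat.dvd_one.mp h3)

lemma theta_val (F : Type*) [Field F] [Fintype F] (θ : MulChar F ℂ) (n : ℕ) (hn : n ≠ 0) (hθ : θ ^ n = 1) (x : F) :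
    θ x = 0 ∨ (θ x) ^ n = 1 := by
  by_cases hx : x = 0
  · left; rw [hx, MulChar.map_zero]
  · right; rw [← MulChar.pow_apply' _ hn, hθ, MulChar.one_apply (IsUnit.mk0 _ hx)]

end PartC2

section PartC3

lemma basic_p (p₁ p h : ℕ) (hp₁ : p₁.Prime) (h8 : p₁ % 8 = 3) (h3 : p₁ ≠ 3) (hp : p.Prime) (hcl : 1 + p₁ = 4 * p ^ h) :
    p % 2 = 1 ∧ 3 ≤ p ∧ p < p₁ := by
  have hho := h_odd p₁ p h hp₁ h3 hcl
  have hodd : (p ^ h) % 2 = 1 := by omega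
  have h2 : p % 2 = 1 := by
    rcases Nat.mod_two_eq_zero_or_one p with h0 | h0
    · exfalso
      have : 2 ∣ p ^ h := dvd_pow (Nat.dvd_of_mod_eq_zero h0) (by omega)
      omega
    · exact h0
  have hle : p ≤ p ^ h := Nat.le_self_pow (by omega) p
  have := hp.two_le
  exact ⟨h2, by omega, by omega⟩

lemma theta_pow_congr (F : Type*) [Field F] [Fintype F] (θ : MulChar F ℂ) (n : ℕ) (hθ : θ ^ n = 1)
    (u v : ℕ) (huv : (u : ZMod n) = (v : ZMod n)) : θ ^ u = θ ^ v := by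
  rw [pow_eq_pow_iff_modEq]
  rw [ZMod.natCast_eq_natCast_iff] at huv
  exact huv.of_dvd (orderOf_dvd_of_pow_eq_one hθ)

lemma quadCharC_eq (p₁ : ℕ) [Fact p₁.Prime] (a : ZMod p₁) : quadCharC p₁ a = ((quadraticChar (ZMod p₁) a : ℤ) : ℂ) := rfl

lemma gauss_orbit (p₁ : ℕ) [hp₁ : Fact p₁.Prime] (h8 : p₁ % 8 = 3) (m : ℕ) (hm : 1 ≤ m)
    (p f : ℕ) [hp : Fact p.Prime] (hf : orderOf (p : ZMod (p₁ ^ m)) = f)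
    (h2f : 2 * f = Nat.totient (p₁ ^ m)) (hfo : f % 2 = 1)
    (F : Type*) [Field F] [Fintype F] [Algebra (ZMod p) F]
    (θ : MulChar F ℂ) (hθ : θ ^ (p₁ ^ m) = 1) (u v : ℕ)
    (hu : quadraticChar (ZMod p₁) (u : ZMod p₁) ≠ 0)
    (huv : quadraticChar (ZMod p₁) (u : ZMod p₁) = quadraticChar (ZMod p₁) (v : ZMod p₁)) :
    gaussSum (θ ^ v) (psiC p F) = gaussSum (θ ^ u) (psiC p F) := by
  obtain ⟨i, _, hi⟩ := (orbit_iff p₁ h8 m hm p f hf h2f hfo).2 u v hu huv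
  have : θ ^ v = (θ ^ u) ^ (p ^ i) := by
    rw [← pow_mul]
    refine theta_pow_congr F θ _ hθ _ _ ?_
    push_cast; rw [hi, mul_comm]
  rw [this, gauss_frob]

lemma gauss_eval (p₁ : ℕ) [hp₁ : Fact p₁.Prime] (h8 : p₁ % 8 = 3) (h3 : p₁ ≠ 3) (m : ℕ) (hm : 1 ≤ m)
    (K : Type*) [Field K] [NumberField K] (α : K)
    (hα : α ^ 2 = -(p₁ : K)) (hKα : Algebra.adjoin ℚ {α} = ⊤)
    (p f : ℕ) [hp : Fact p.Prime] (hcl : 1 + p₁ = 4 * p ^ (NumberField.classNumber K))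
    (hf : orderOf (p : ZMod (p₁ ^ m)) = f)
    (h2f : 2 * f = Nat.totient (p₁ ^ m)) (hfo : f % 2 = 1)
    (F : Type*) [Field F] [Fintype F] [Algebra (ZMod p) F] (hcard : Fintype.card F = p ^ f)
    (θ : MulChar F ℂ) (hθ : θ ^ (p₁ ^ m) = 1) (hθ' : θ ^ (p₁ ^ (m - 1)) ≠ 1) :
    ∃ (A : ℂ) (δ : ℤ), A ≠ 0 ∧ (δ = 1 ∨ δ = -1) ∧ ∀ u : ℕ, quadraticChar (ZMod p₁) (u : ZMod p₁) ≠ 0 →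
      gaussSum (θ ^ u) (psiC p F) = A * (1 + δ * quadCharC p₁ (u : ZMod p₁) * GG p₁) := by
  obtain ⟨hpo, hp3, hpp⟩ := basic_p p₁ p _ hp₁.out h8 h3 hp.out hcl
  have hho := h_odd p₁ p _ hp₁.out h3 hcl
  set H := NumberField.classNumber K with hH
  have hcop : (p₁ ^ m).Coprime p := Nat.Coprime.pow_left _ ((Nat.coprime_primes hp₁.out hp.out).mpr (by omega))
  have hcop1 : (p₁ ^ m).Coprime (p - 1) := by
    apply Nat.Coprime.pow_left
    rw [Nat.Prime.coprime_iff_not_dvd hp₁.out]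
    intro hd; have := Nat.le_of_dvd (by omega) hd; omega
  have hq : 2 < p ^ f := by
    have : p ≤ p ^ f := Nat.le_self_pow (by omega) p
    omega
  obtain ⟨B, hB, hst⟩ := stick p₁ h8 m hm K α hα hKα p f hf h2f hfo F hcard hcop hq
  have hnpos : 0 < p₁ ^ m := pow_pos hp₁.out.pos m
  have hMpos : 0 < p₁ ^ (m - 1) := pow_pos hp₁.out.pos _
  have hnM := pow_succ_pred p₁ m hm
  have hd : p₁ ∣ p₁ ^ m := dvd_pow_self p₁ (by omega)
  have hG0 : GG p₁ ≠ 0 := by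
    intro h0
    have := GG_sq p₁ h8
    rw [h0] at this
    have h1 : (p₁ : ℂ) = 0 := by linear_combination this
    exact hp₁.out.ne_zero (by exact_mod_cast h1)
  have hn1 : quadraticChar (ZMod p₁) ((p₁ ^ m - 1 : ℕ) : ZMod p₁) = -1 := by
    rw [Nat.cast_sub (by omega), (ZMod.natCast_eq_zero_iff _ _).mpr hd, Nat.cast_one, zero_sub, quadChar_neg_one p₁ h8]
  have h11 : quadraticChar (ZMod p₁) ((1 : ℕ) : ZMod p₁) = 1 := by simp
  set gp := gaussSum θ (psiC p F) with hgp
  set gm := gaussSum (θ ^ (p₁ ^ m - 1)) (psiC p F) with hgm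
  have hg1 : ∀ u : ℕ, quadraticChar (ZMod p₁) (u : ZMod p₁) = 1 → gaussSum (θ ^ u) (psiC p F) = gp := by
    intro u hu
    rw [gauss_orbit p₁ h8 m hm p f hf h2f hfo F θ hθ 1 u (by rw [h11]; decide) (by rw [h11, hu]), pow_one]
  have hg2 : ∀ u : ℕ, quadraticChar (ZMod p₁) (u : ZMod p₁) = -1 → gaussSum (θ ^ u) (psiC p F) = gm := by
    intro u hu
    rw [gauss_orbit p₁ h8 m hm p f hf h2f hfo F θ hθ (p₁ ^ m - 1) u (by rw [hn1]; decide) (by rw [hn1, hu])]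
  have htri : ∀ x : ℕ, quadraticChar (ZMod p₁) (x : ZMod p₁) = 0 ∨ quadraticChar (ZMod p₁) (x : ZMod p₁) = 1 ∨ quadraticChar (ZMod p₁) (x : ZMod p₁) = -1 := by
    intro x
    by_cases h : (x : ZMod p₁) = 0
    · left; rw [h]; simp
    · right; exact quadraticChar_dichotomy h
  -- rationality
  set E : ℤ := ∑ u ∈ Finset.range (p₁ ^ (m - 1) * p₁), (quadraticChar (ZMod p₁) (u : ZMod p₁)) ^ 2 with hE
  have hE0 : 0 < E := by
    refine Finset.sum_pos' (fun u _ => sq_nonneg _) ⟨1, ?_, ?_⟩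
    · rw [Finset.mem_range, ← hnM]
      exact Nat.one_lt_pow (by omega) hp₁.out.one_lt
    · rw [h11]; norm_num
  have hS0 := sum_chi_zero p₁ h8 (p₁ ^ (m - 1))
  have hS0C : ∑ x ∈ Finset.range (p₁ ^ (m - 1) * p₁), quadCharC p₁ (x : ZMod p₁) = 0 := by
    have := congrArg (Int.cast : ℤ → ℂ) hS0
    push_cast at this
    exact this
  have hEC : ∑ x ∈ Finset.range (p₁ ^ (m - 1) * p₁), (quadCharC p₁ (x : ZMod p₁)) ^ 2 = E := by
    rw [hE]; push_cast; rfl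
  have hB1 : ∑ u ∈ Finset.range (p₁ ^ (m - 1) * p₁), (quadCharC p₁ (u : ZMod p₁)) ^ 2 * gaussSum (θ ^ u) (psiC p F)
      = E * ((gp + gm) / 2) := by
    have : ∀ u ∈ Finset.range (p₁ ^ (m - 1) * p₁), (quadCharC p₁ (u : ZMod p₁)) ^ 2 * gaussSum (θ ^ u) (psiC p F)
       = (quadCharC p₁ (u : ZMod p₁)) ^ 2 * ((gp + gm) / 2) + quadCharC p₁ (u : ZMod p₁) * ((gp - gm) / 2) := by
      intro u _
      rcases htri u with h | h | h
      · rw [quadCharC_eq, h]; simp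
      · rw [hg1 u h, quadCharC_eq, h]; push_cast; ring
      · rw [hg2 u h, quadCharC_eq, h]; push_cast; ring
    rw [Finset.sum_congr rfl this, Finset.sum_add_distrib, ← Finset.sum_mul, ← Finset.sum_mul, hS0C, hEC]; ring
  have hC1 : ∑ u ∈ Finset.range (p₁ ^ (m - 1) * p₁), quadCharC p₁ (u : ZMod p₁) * gaussSum (θ ^ u) (psiC p F)
      = E * ((gp - gm) / 2) := by
    have : ∀ u ∈ Finset.range (p₁ ^ (m - 1) * p₁), quadCharC p₁ (u : ZMod p₁) * gaussSum (θ ^ u) (psiC p F)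
       = quadCharC p₁ (u : ZMod p₁) * ((gp + gm) / 2) + (quadCharC p₁ (u : ZMod p₁)) ^ 2 * ((gp - gm) / 2) := by
      intro u _
      rcases htri u with h | h | h
      · rw [quadCharC_eq, h]; simp
      · rw [hg1 u h, quadCharC_eq, h]; push_cast; ring
      · rw [hg2 u h, quadCharC_eq, h]; push_cast; ring
    rw [Finset.sum_congr rfl this, Finset.sum_add_distrib, ← Finset.sum_mul, ← Finset.sum_mul, hS0C, hEC]; ring
  have hinv : ∀ (t : ZMod p) (x : F), t ≠ 0 → θ (algebraMap (ZMod p) F t * x) = θ x := by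
    intro t x ht
    rw [map_mul, theta_prime_field p F θ _ hcop1 hθ t ht, one_mul]
  have hθn : θ ^ (p₁ ^ (m - 1) * p₁) = 1 := by rw [← hnM]; exact hθ
  have hpZ : ((p : ℤ) - 1) * E ≠ 0 := by
    apply mul_ne_zero _ hE0.ne'
    have : (3 : ℤ) ≤ p := by exact_mod_cast hp3
    omega
  obtain ⟨zB, hzB⟩ : ∃ z : ℤ, ((p : ℂ) - 1) * (E * ((gp + gm) / 2)) = z := by
    rw [← hB1, sum_gauss_swap p F θ _ (fun u => (quadCharC p₁ (u : ZMod p₁)) ^ 2) (by simp [quadCharC_zero])]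
    have hr : ∀ z : ℂ, ∃ r : ℤ, (z = 0 ∨ z ^ (p₁ ^ (m - 1) * p₁) = 1) → ∑ u ∈ Finset.range (p₁ ^ (m - 1) * p₁), (quadCharC p₁ (u : ZMod p₁)) ^ 2 * z ^ u = r := by
      intro z
      by_cases hz : z = 0 ∨ z ^ (p₁ ^ (m - 1) * p₁) = 1
      · obtain ⟨r, hr⟩ := chi_sq_sum_pow p₁ (p₁ ^ (m - 1)) z hz
        exact ⟨r, fun _ => hr⟩
      · exact ⟨0, fun h => absurd h hz⟩
    choose r hr using hr
    obtain ⟨z, hz⟩ := rat_sum p F (fun x => r (θ x)) (fun t x ht => by simp only [hinv t x ht])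
    refine ⟨z, ?_⟩
    rw [← hz]
    congr 1
    refine Finset.sum_congr rfl fun x _ => ?_
    rw [hr _ (theta_val F θ _ (by rw [← hnM]; omega) hθn x)]
  obtain ⟨zC, hzC⟩ : ∃ z : ℤ, ((p : ℂ) - 1) * (E * ((gp - gm) / 2)) = z * GG p₁ := by
    rw [← hC1, sum_gauss_swap p F θ _ (fun u => (quadCharC p₁ (u : ZMod p₁))) (by simp [quadCharC_zero])]
    have hr : ∀ z : ℂ, ∃ r : ℤ, (z = 0 ∨ z ^ (p₁ ^ (m - 1) * p₁) = 1) → ∑ u ∈ Finset.range (p₁ ^ (m - 1) * p₁), (quadCharC p₁ (u : ZMod p₁)) * z ^ u = r * GG p₁ := by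
      intro z
      by_cases hz : z = 0 ∨ z ^ (p₁ ^ (m - 1) * p₁) = 1
      · obtain ⟨r, hr⟩ := chi_sum_pow p₁ h8 (p₁ ^ (m - 1)) (by omega) z hz
        exact ⟨r, fun _ => hr⟩
      · exact ⟨0, fun h => absurd h hz⟩
    choose r hr using hr
    obtain ⟨z, hz⟩ := rat_sum p F (fun x => r (θ x)) (fun t x ht => by simp only [hinv t x ht])
    refine ⟨z, ?_⟩
    rw [← hz, mul_assoc, Finset.sum_mul]
    congr 1
    refine Finset.sum_congr rfl fun x _ => ?_
    rw [hr _ (theta_val F θ _ (by rw [← hnM]; omega) hθn x)]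
    ring
  have hgpi : IsIntegral ℤ gp := gauss_integral p F _
  have hgmi : IsIntegral ℤ gm := gauss_integral p F _
  obtain ⟨b0, hb0⟩ : ∃ z : ℤ, gp + gm = z := by
    refine rat_int _ (hgpi.add hgmi) (((p : ℤ) - 1) * E) (2 * zB) hpZ ?_
    push_cast; rw [← hzB]; ring
  obtain ⟨c0, hc0⟩ : ∃ z : ℤ, (gp - gm) / GG p₁ = z := by
    refine int_sqfree p₁ _ (((p : ℤ) - 1) * E) (2 * zC) hpZ ?_ ?_
    · push_cast
      field_simp
      linear_combination 2 * hzC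
    · have : (p₁ : ℂ) * ((gp - gm) / GG p₁) ^ 2 = -(gp - gm) ^ 2 := by
        rw [div_pow, GG_sq p₁ h8]
        have : (p₁ : ℂ) ≠ 0 := by exact_mod_cast hp₁.out.ne_zero
        field_simp
      rw [this]
      exact ((hgpi.sub hgmi).pow 2).neg
  have hc0' : gp - gm = c0 * GG p₁ := by rw [← hc0]; field_simp
  -- norm equation
  have hinvθ : θ ^ (p₁ ^ m - 1) = θ⁻¹ := by
    rw [eq_inv_iff_mul_eq_one, ← pow_succ, Nat.sub_add_cancel (by omega), hθ]
  have hθ1 : θ ≠ 1 := by rintro rfl; exact hθ' (one_pow _)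
  have hθm1 : θ (-1) = 1 := by
    have := theta_prime_field p F θ _ hcop1 hθ (-1) (by simp)
    simpa using this
  have hprod : gp * gm = (p : ℂ) ^ f := by
    rw [hgm, hinvθ, hgp, gauss_mul_inv p F θ hθ1, hθm1, hcard]; push_cast; ring
  have hnorm : b0 ^ 2 + p₁ * c0 ^ 2 = 4 * (p : ℤ) ^ f := by
    have : (b0 : ℂ) ^ 2 + p₁ * c0 ^ 2 = 4 * (p : ℂ) ^ f := by
      have e1 : (p₁ : ℂ) * c0 ^ 2 = -(gp - gm) ^ 2 := by
        rw [hc0', mul_pow, GG_sq p₁ h8]; ring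
      rw [e1, ← hb0, ← hprod]; ring
    exact_mod_cast this
  have hHf : H ≤ f := by
    by_contra! hlt
    have hc00 : c0 = 0 := by
      by_contra hc
      have h1 : (1 : ℤ) ≤ c0 ^ 2 := by
        have := sq_pos_of_ne_zero hc
        omega
      have h2 : p ^ f * p ≤ p ^ H := by rw [← pow_succ]; exact Nat.pow_le_pow_right (by omega) hlt
      have h2' : p ^ f * 3 ≤ p ^ f * p := Nat.mul_le_mul_left _ hp3
      have h4 : 4 * p ^ f < p₁ := by omega
      have h5 : (4 * (p : ℤ) ^ f) < p₁ := by exact_mod_cast h4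
      nlinarith [sq_nonneg b0]
    rw [hc00] at hnorm
    exact not_sq_odd p b0 f hfo (by linarith)
  obtain ⟨k, hk⟩ : ∃ k, f = 2 * k + H := ⟨(f - H) / 2, by omega⟩
  have hvp : B.valuation gp ≤ B.valuation (p : ℂ) ^ k := hst θ hθ hθ' k (by omega)
  have hvm : B.valuation gm ≤ B.valuation (p : ℂ) ^ k := by
    refine hst _ ?_ ?_ k (by omega)
    · rw [hinvθ, inv_pow, hθ, inv_one]
    · rw [hinvθ, inv_pow, Ne, inv_eq_one]; exact hθ'
  have hvG : B.valuation (GG p₁) = 1 := by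
    have h1 := congrArg B.valuation (GG_sq p₁ h8)
    rw [map_pow, Valuation.map_neg] at h1
    have h2 : B.valuation (p₁ : ℂ) = 1 := by
      have := val_coprime B p hB (p₁ : ℤ) (by
        intro hdv
        have := (Nat.prime_dvd_prime_iff_eq hp.out hp₁.out).mp (by exact_mod_cast hdv)
        omega)
      simpa using this
    rw [h2] at h1
    exact (pow_eq_one_iff.mp h1).resolve_right (by norm_num)
  obtain ⟨b, hb⟩ : (p : ℤ) ^ k ∣ b0 := by
    apply int_dvd_of_val B p hB
    rw [← hb0]
    exact Valuation.map_add_le _ hvp hvm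
  obtain ⟨c, hc⟩ : (p : ℤ) ^ k ∣ c0 := by
    apply int_dvd_of_val B p hB
    have : B.valuation (c0 : ℂ) = B.valuation (gp - gm) := by
      rw [hc0', map_mul, hvG, mul_one]
    rw [this]
    exact Valuation.map_sub_le _ hvp hvm
  have hpk : ((p : ℤ) ^ k) ^ 2 ≠ 0 := by
    have := hp.out.ne_zero
    positivity
  have hn2 : b ^ 2 + p₁ * c ^ 2 = 1 + p₁ := by
    have h5 : (1 + p₁ : ℤ) = 4 * p ^ H := by exact_mod_cast hcl
    rw [h5]
    apply mul_left_cancel₀ hpk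
    rw [hb, hc, hk, pow_add, pow_mul'] at hnorm
    linear_combination hnorm
  have hcne : c ≠ 0 := by
    rintro rfl
    have h5 : (1 + p₁ : ℤ) = 4 * p ^ H := by exact_mod_cast hcl
    exact not_sq_odd p b H hho (by rw [← h5, ← hn2]; ring)
  have hc2 : c ^ 2 = 1 := by
    have h1 : 0 < c ^ 2 := sq_pos_of_ne_zero hcne
    have h2 : (3 : ℤ) ≤ p₁ := by have := hp₁.out.two_le; omega
    by_contra hne
    have h3 : 2 ≤ c ^ 2 := by omega
    nlinarith [sq_nonneg b]
  have hb2 : b ^ 2 = 1 := by rw [hc2] at hn2; linarith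
  have hbc : b * c = 1 ∨ b * c = -1 := by
    have : (b * c) ^ 2 = 1 := by rw [mul_pow, hb2, hc2]; norm_num
    simpa using this
  have hgpv : gp = (p : ℂ) ^ k * b / 2 * (1 + (b * c : ℤ) * GG p₁) := by
    have hb2C : (b : ℂ) ^ 2 = 1 := by exact_mod_cast hb2
    have e1 : gp + gm = (p : ℂ) ^ k * b := by rw [hb0, hb]; push_cast; ring
    have e2 : gp - gm = (p : ℂ) ^ k * c * GG p₁ := by rw [hc0', hc]; push_cast; ring
    push_cast
    linear_combination (e1 + e2) / 2 - (p : ℂ) ^ k * c * GG p₁ / 2 * hb2C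
  have hgmv : gm = (p : ℂ) ^ k * b / 2 * (1 - (b * c : ℤ) * GG p₁) := by
    have hb2C : (b : ℂ) ^ 2 = 1 := by exact_mod_cast hb2
    have e1 : gp + gm = (p : ℂ) ^ k * b := by rw [hb0, hb]; push_cast; ring
    have e2 : gp - gm = (p : ℂ) ^ k * c * GG p₁ := by rw [hc0', hc]; push_cast; ring
    push_cast
    linear_combination (e1 - e2) / 2 + (p : ℂ) ^ k * c * GG p₁ / 2 * hb2C
  refine ⟨(p : ℂ) ^ k * b / 2, b * c, ?_, hbc, ?_⟩
  · have h1 : (b : ℂ) ≠ 0 := by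
      have : b ≠ 0 := by rintro rfl; norm_num at hb2
      exact_mod_cast this
    have h2 : (p : ℂ) ≠ 0 := by exact_mod_cast hp.out.ne_zero
    exact div_ne_zero (mul_ne_zero (pow_ne_zero _ h2) h1) two_ne_zero
  · intro u hu
    rcases htri u with h | h | h
    · exact absurd h hu
    · rw [hg1 u h, hgpv, quadCharC_eq, h]; push_cast; ring
    · rw [hg2 u h, hgmv, quadCharC_eq, h]; push_cast; ring

end PartC3

section PartD1

noncomputable def etaC (F : Type*) [Field F] [Fintype F] : MulChar F ℂ := (quadraticChar F).ringHomComp (Int.castRingHom ℂ)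

lemma etaC_apply (F : Type*) [Field F] [Fintype F] (x : F) : etaC F x = ((quadraticChar F x : ℤ) : ℂ) := rfl

lemma etaC_sq (F : Type*) [Field F] [Fintype F] : (etaC F) ^ 2 = 1 :=
  ((quadraticChar_isQuadratic F).comp (Int.castRingHom ℂ)).sq_eq_one

lemma etaC_ne_one (F : Type*) [Field F] [Fintype F] (h2 : ringChar F ≠ 2) : etaC F ≠ 1 := by
  obtain ⟨a, ha⟩ := quadraticChar_exists_neg_one' h2
  intro h
  have h1 := DFunLike.congr_fun h (a : F)
  rw [etaC_apply, ha, MulChar.one_apply a.isUnit] at h1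
  norm_num at h1

lemma jacobi_eta (F : Type*) [Field F] [Fintype F] (h2 : ringChar F ≠ 2) (θ : MulChar F ℂ) (hθ : θ ≠ 1)
    (h4 : θ 4 = 1) : jacobiSum θ θ = jacobiSum θ (etaC F) := by
  have h20 : (2 : F) ≠ 0 := Ring.two_ne_zero h2
  have h40 : (4 : F) ≠ 0 := by have : (4 : F) = 2 * 2 := by norm_num
                               rw [this]; exact mul_ne_zero h20 h20
  have hq : θ (4⁻¹) = 1 := by
    have : θ (4⁻¹) * θ 4 = 1 := by rw [← map_mul, inv_mul_cancel₀ h40, map_one]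
    rwa [h4, mul_one] at this
  unfold jacobiSum
  have e1 : ∑ x : F, θ x * θ (1 - x) = ∑ y : F, θ (1 - y ^ 2) := by
    let e : F ≃ F := (Equiv.subLeft 1).trans (Equiv.mulLeft₀ (2⁻¹ : F) (inv_ne_zero h20))
    rw [← Equiv.sum_comp e]
    refine Finset.sum_congr rfl fun y _ => ?_
    have he : e y = 2⁻¹ * (1 - y) := rfl
    rw [← map_mul, he]
    have : 2⁻¹ * (1 - y) * (1 - 2⁻¹ * (1 - y)) = 4⁻¹ * (1 - y ^ 2) := by
      have h' : (4 : F) = 2 * 2 := by norm_num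
      rw [h']
      field_simp
      ring
    rw [this, map_mul, hq, one_mul]
  have e2 : ∑ y : F, θ (1 - y ^ 2) = ∑ a : F, θ (1 - a) * (etaC F a + 1) := by
    rw [← Finset.sum_fiberwise (s := Finset.univ) (g := fun y : F => y ^ 2)]
    refine Finset.sum_congr rfl fun a _ => ?_
    have : ∀ y ∈ Finset.univ.filter (fun y : F => y ^ 2 = a), θ (1 - y ^ 2) = θ (1 - a) := by
      intro y hy; simp at hy; rw [hy]
    rw [Finset.sum_congr rfl this, Finset.sum_const, nsmul_eq_mul, mul_comm]
    congr 1
    have hc := quadraticChar_card_sqrts h2 a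
    have hc2 : ((Finset.univ.filter (fun y : F => y ^ 2 = a)).card : ℤ) = quadraticChar F a + 1 := by
      rw [← hc]; congr 2; ext y; simp
    rw [etaC_apply]
    exact_mod_cast congrArg (Int.cast : ℤ → ℂ) hc2
  have e3 : ∑ a : F, θ (1 - a) = 0 := by
    have h5 := Equiv.sum_comp (Equiv.subLeft (1 : F)) (fun x => θ x)
    simp only [Equiv.subLeft_apply] at h5
    rw [h5]
    exact MulChar.sum_eq_zero_of_ne_one hθ
  rw [e1, e2]
  simp_rw [mul_add, mul_one]
  rw [Finset.sum_add_distrib, e3, add_zero, ← Equiv.sum_comp (Equiv.subLeft (1 : F))]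
  refine Finset.sum_congr rfl fun a _ => ?_
  simp

lemma gauss_eta (p : ℕ) [hp : Fact p.Prime] (F : Type*) [Field F] [Fintype F] [Algebra (ZMod p) F]
    (h2 : ringChar F ≠ 2) (θ : MulChar F ℂ) (hθ : θ ^ 2 ≠ 1)
    (h4 : θ 4 = 1) : gaussSum (θ * etaC F) (psiC p F) * gaussSum θ (psiC p F) =
      gaussSum (etaC F) (psiC p F) * gaussSum (θ ^ 2) (psiC p F) := by
  have hθ1 : θ ≠ 1 := by rintro rfl; simp at hθ
  have hne : θ * etaC F ≠ 1 := by
    intro h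
    apply hθ
    have := congrArg (· ^ 2) h
    simp only [mul_pow, etaC_sq, one_pow, mul_one] at this
    exact this
  have h1 := jacobiSum_mul_nontrivial (χ := θ) (φ := θ) (by rwa [← pow_two]) (psiC p F)
  have h2' := jacobiSum_mul_nontrivial hne (psiC p F)
  rw [← jacobi_eta F h2 θ hθ1 h4] at h2'
  have hg : gaussSum θ (psiC p F) ≠ 0 := by
    intro h0
    have := gauss_mul_inv p F θ hθ1
    rw [h0, zero_mul] at this
    have hθm : θ (-1) ≠ 0 := by
      intro h; have h5 : θ (-1) * θ (-1) = 1 := by rw [← map_mul]; simp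
      rw [h] at h5; simp at h5
    rcases mul_eq_zero.mp this.symm with h | h
    · exact hθm h
    · have := Fintype.card_ne_zero (α := F); exact this (by exact_mod_cast h)
  rw [← pow_two] at h1
  apply mul_right_cancel₀ hg
  linear_combination gaussSum (θ ^ 2) (psiC p F) * h2' - gaussSum (θ * etaC F) (psiC p F) * h1
end PartD1

section PartD2

lemma zeta_prim (n : ℕ) [NeZero n] : IsPrimitiveRoot (ZMod.stdAddChar (1 : ZMod n) : ℂ) n := by
  have h := ZMod.stdAddChar_coe (N := n) 1
  rw [Int.cast_one] at h
  rw [h]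
  have := Complex.isPrimitiveRoot_exp n (NeZero.ne n)
  convert this using 2
  push_cast; ring

lemma zeta_pow_M (p₁ : ℕ) [hp₁ : Fact p₁.Prime] (m : ℕ) (hm : 1 ≤ m) [NeZero (p₁ ^ m)] :
    (ZMod.stdAddChar (1 : ZMod (p₁ ^ m)) : ℂ) ^ (p₁ ^ (m - 1)) = ZMod.stdAddChar (1 : ZMod p₁) := by
  have h := ZMod.stdAddChar_coe (N := p₁ ^ m) 1
  have h' := ZMod.stdAddChar_coe (N := p₁) 1
  rw [Int.cast_one] at h h'
  rw [h, h', ← Complex.exp_nat_mul]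
  congr 1
  have hp0 : (p₁ : ℂ) ≠ 0 := by exact_mod_cast hp₁.out.ne_zero
  rw [pow_succ_pred p₁ m hm]
  push_cast
  field_simp

lemma theta_exists (p₁ : ℕ) [hp₁ : Fact p₁.Prime] (h8 : p₁ % 8 = 3) (h3 : p₁ ≠ 3) (m : ℕ) (hm : 1 ≤ m)
    [NeZero (p₁ ^ m)]
    (K : Type*) [Field K] [NumberField K] (α : K)
    (hα : α ^ 2 = -(p₁ : K)) (hKα : Algebra.adjoin ℚ {α} = ⊤)
    (p f : ℕ) [hp : Fact p.Prime] (hcl : 1 + p₁ = 4 * p ^ (NumberField.classNumber K))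
    (hf : orderOf (p : ZMod (p₁ ^ m)) = f)
    (h2f : 2 * f = Nat.totient (p₁ ^ m)) (hfo : f % 2 = 1)
    (F : Type*) [Field F] [Fintype F] [Algebra (ZMod p) F] (hcard : Fintype.card F = p ^ f) :
    ∃ (γ : Fˣ) (θ : MulChar F ℂ) (A : ℂ), (∀ x : Fˣ, x ∈ Subgroup.zpowers γ) ∧
      θ (γ : F) = ZMod.stdAddChar (1 : ZMod (p₁ ^ m)) ∧ θ ^ (p₁ ^ m) = 1 ∧ A ≠ 0 ∧
      ∀ u : ℕ, quadraticChar (ZMod p₁) (u : ZMod p₁) ≠ 0 →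
      gaussSum (θ ^ u) (psiC p F) = A * (1 + quadCharC p₁ (u : ZMod p₁) * GG p₁) := by
  obtain ⟨γ, hγ⟩ := IsCyclic.exists_generator (α := Fˣ)
  have hprim := zeta_prim (p₁ ^ m)
  have hnpos : 0 < p₁ ^ m := pow_pos hp₁.out.pos m
  have hpf : 1 ≤ p ^ f := Nat.one_le_pow _ _ hp.out.pos
  have hdvd : p₁ ^ m ∣ p ^ f - 1 := by
    have : (p : ZMod (p₁ ^ m)) ^ f = 1 := by rw [← hf, pow_orderOf_eq_one]
    have h2 : ((p ^ f : ℕ) : ZMod (p₁ ^ m)) = ((1 : ℕ) : ZMod (p₁ ^ m)) := by push_cast; exact this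
    rw [ZMod.natCast_eq_natCast_iff] at h2
    exact (Nat.modEq_iff_dvd' (by omega)).mp h2.symm
  set ζ : ℂ := ZMod.stdAddChar (1 : ZMod (p₁ ^ m)) with hζ
  let Z : ℂˣ := Units.mk0 ζ (hprim.ne_zero hnpos.ne')
  have hZ : Z ∈ rootsOfUnity (Fintype.card Fˣ) ℂ := by
    rw [mem_rootsOfUnity]
    ext
    rw [Fintype.card_units, hcard]
    obtain ⟨c, hc⟩ := hdvd
    rw [hc]
    simp [Z, pow_mul, hprim.pow_eq_one]
  set θ := MulChar.ofRootOfUnity hZ hγ with hθdef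
  have hθγ : θ (γ : F) = ζ := MulChar.ofRootOfUnity_spec hZ hγ
  have hpw : ∀ k, θ ^ k = 1 ↔ ζ ^ k = 1 := by
    intro k
    rw [MulChar.eq_iff hγ, MulChar.pow_apply_coe, hθγ, MulChar.one_apply_coe]
  have hθn : θ ^ (p₁ ^ m) = 1 := (hpw _).mpr hprim.pow_eq_one
  have hθM : θ ^ (p₁ ^ (m - 1)) ≠ 1 := by
    rw [Ne, hpw]
    have := pow_succ_pred p₁ m hm
    refine hprim.pow_ne_one_of_pos_of_lt (pow_pos hp₁.out.pos _).ne' ?_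
    exact Nat.pow_lt_pow_right hp₁.out.one_lt (by omega)
  obtain ⟨A, δ, hA, hδ, hg⟩ := gauss_eval p₁ h8 h3 m hm K α hα hKα p f hcl hf h2f hfo F hcard θ hθn hθM
  rcases hδ with rfl | rfl
  · refine ⟨γ, θ, A, hγ, hθγ, hθn, hA, ?_⟩
    intro u hu; rw [hg u hu]; push_cast; ring
  · refine ⟨γ⁻¹, θ⁻¹, A, ?_, ?_, ?_, hA, ?_⟩
    · intro x; rw [Subgroup.zpowers_inv]; exact hγ x
    · rw [MulChar.inv_apply']
      rw [← hθγ]; simp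
    · rw [inv_pow, hθn, inv_one]
    · intro u hu
      have e : θ⁻¹ ^ u = θ ^ (u * (p₁ ^ m - 1)) := by
        rw [mul_comm, pow_mul]
        congr 1
        rw [eq_comm, eq_inv_iff_mul_eq_one, ← pow_succ, Nat.sub_add_cancel (by omega), hθn]
      have hc : ((u * (p₁ ^ m - 1) : ℕ) : ZMod p₁) = -1 * (u : ZMod p₁) := by
        rw [Nat.cast_mul, Nat.cast_sub (by omega), (ZMod.natCast_eq_zero_iff _ _).mpr (dvd_pow_self p₁ (by omega))]
        simp
      rw [e, hg]
      · rw [hc, map_mul, quadCharC_neg_one p₁ h8]; push_cast; ring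
      · rw [hc, map_mul, quadChar_neg_one p₁ h8]; simpa using hu

/-- function on residues mod `M * p₁` built from `t` -/
noncomputable def FFn (p₁ M : ℕ) (t : ZMod p₁ → ℂ) (e : ℕ) [NeZero p₁] : ℂ :=
  ∑ i ∈ Finset.range M, ∑ j : ZMod p₁, if e ≡ 2 * i + M * j.val [MOD (M * p₁)] then t j else 0

lemma beta_inj (p₁ M : ℕ) [hp₁ : Fact p₁.Prime] (hM : M % 2 = 1) (i i' : ℕ) (hi : i < M) (hi' : i' < M)
    (a b : ℕ) (h : 2 * i + M * a ≡ 2 * i' + M * b [MOD (M * p₁)]) : i = i' ∧ a ≡ b [MOD p₁] := by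
  have h1 : 2 * i ≡ 2 * i' [MOD M] := by
    have := h.of_dvd (dvd_mul_right M p₁)
    unfold Nat.ModEq at this ⊢
    simpa using this
  have h2 : i ≡ i' [MOD M] := Nat.ModEq.cancel_left_of_coprime (by
    rw [Nat.gcd_comm]; exact (Nat.coprime_two_left.mpr (Nat.odd_iff.mpr hM))) h1
  have h3 : i = i' := by
    unfold Nat.ModEq at h2; rwa [Nat.mod_eq_of_lt hi, Nat.mod_eq_of_lt hi'] at h2
  subst h3
  refine ⟨rfl, ?_⟩
  have h4 := Nat.ModEq.add_left_cancel' _ h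
  exact Nat.ModEq.mul_left_cancel' (by omega) h4

lemma beta_surj (p₁ M : ℕ) [hp₁ : Fact p₁.Prime] (hM : M % 2 = 1) (e : ℕ) :
    ∃ i < M, ∃ j : ZMod p₁, e ≡ 2 * i + M * j.val [MOD (M * p₁)] := by
  -- solve 2 i ≡ e mod M
  obtain ⟨k, hk⟩ : ∃ k, M = 2 * k + 1 := ⟨M / 2, by omega⟩
  set i := ((k + 1) * e) % M with hi
  have hiM : i < M := Nat.mod_lt _ (by omega)
  have h1 : 2 * i ≡ e [MOD M] := by
    have : 2 * i ≡ 2 * ((k + 1) * e) [MOD M] := (Nat.mod_modEq _ _).mul_left 2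
    refine this.trans ?_
    have e1 : 2 * ((k + 1) * e) = e + M * e := by rw [hk]; ring
    rw [e1]; unfold Nat.ModEq; simp
  -- divide e minus 2 i by M
  obtain ⟨c, hc⟩ := (Nat.modEq_iff_dvd.mp h1)
  refine ⟨i, hiM, (c : ZMod p₁), ?_⟩
  rw [Nat.modEq_iff_dvd]
  have h2 : ((((c : ℤ) : ZMod p₁).val : ℤ) : ZMod p₁) = ((c : ℤ) : ZMod p₁) := by simp
  rw [ZMod.intCast_eq_intCast_iff, Int.modEq_iff_dvd] at h2
  obtain ⟨d, hd⟩ := h2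
  refine ⟨-d, ?_⟩
  push_cast at hc ⊢
  linear_combination -hc - M * hd

lemma FFn_eq (p₁ M : ℕ) [hp₁ : Fact p₁.Prime] (hM : M % 2 = 1) (t : ZMod p₁ → ℂ) (e i : ℕ) (hi : i < M) (j : ZMod p₁)
    (h : e ≡ 2 * i + M * j.val [MOD (M * p₁)]) : FFn p₁ M t e = t j := by
  unfold FFn
  rw [Finset.sum_eq_single_of_mem i (Finset.mem_range.mpr hi), Finset.sum_eq_single j, if_pos h]
  · intro j' _ hj'
    rw [if_neg]
    intro h'
    have := (beta_inj p₁ M hM i i hi hi _ _ (h.symm.trans h')).2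
    rw [← ZMod.natCast_eq_natCast_iff] at this
    simp at this
    exact hj' this.symm
  · simp
  · intro i' hi' hne
    refine Finset.sum_eq_zero fun j' _ => ?_
    rw [if_neg]
    intro h'
    exact hne (beta_inj p₁ M hM i i' hi (Finset.mem_range.mp hi') _ _ (h.symm.trans h')).1.symm

/-- Fourier coefficient -/
noncomputable def cf (p₁ M : ℕ) [NeZero p₁] (ζ : ℂ) (t : ZMod p₁ → ℂ) (u : ℕ) : ℂ :=
  ((M * p₁ : ℕ) : ℂ)⁻¹ * (∑ i ∈ Finset.range M, (ζ⁻¹) ^ (2 * i * u)) * ∑ j : ZMod p₁, t j * (ζ⁻¹) ^ (M * j.val * u)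

lemma prim_pow_iff (n : ℕ) (hn : n ≠ 0) (ζ : ℂ) (hζ : IsPrimitiveRoot ζ n) (e b : ℕ) : ζ ^ e = ζ ^ b ↔ e ≡ b [MOD n] := by
  have hz0 : ζ ≠ 0 := hζ.ne_zero hn
  have h1 : IsPrimitiveRoot (Units.mk0 ζ hz0) n := by
    rw [← IsPrimitiveRoot.coe_units_iff]; exact hζ
  rw [h1.eq_orderOf, ← pow_eq_pow_iff_modEq, Units.ext_iff]
  simp

lemma fourier_FFn (p₁ M : ℕ) [hp₁ : Fact p₁.Prime] (hM : 0 < M) (ζ : ℂ) (hζ : IsPrimitiveRoot ζ (M * p₁)) (t : ZMod p₁ → ℂ) (e : ℕ) :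
    ∑ u ∈ Finset.range (M * p₁), cf p₁ M ζ t u * (ζ ^ e) ^ u = FFn p₁ M t e := by
  have hn0 : M * p₁ ≠ 0 := mul_ne_zero hM.ne' hp₁.out.ne_zero
  have hn0C : ((M * p₁ : ℕ) : ℂ) ≠ 0 := by exact_mod_cast hn0
  have hz0 : ζ ≠ 0 := hζ.ne_zero hn0
  have key : ∀ b : ℕ, ∑ u ∈ Finset.range (M * p₁), (ζ ^ e * ζ⁻¹ ^ b) ^ u = if e ≡ b [MOD (M * p₁)] then ((M * p₁ : ℕ) : ℂ) else 0 := by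
    intro b
    split_ifs with h
    · have : ζ ^ e = ζ ^ b := by
        rw [prim_pow_iff _ hn0 ζ hζ]; exact h
      rw [this, inv_pow, mul_inv_cancel₀ (pow_ne_zero _ hz0)]; simp
    · have hne : ζ ^ e * ζ⁻¹ ^ b ≠ 1 := by
        rw [inv_pow, Ne, mul_inv_eq_one₀ (pow_ne_zero _ hz0), prim_pow_iff _ hn0 ζ hζ]; exact h
      rw [geom_sum_eq hne, mul_pow, ← pow_mul, ← pow_mul, mul_comm e, mul_comm b, pow_mul _ (M * p₁), pow_mul _ (M * p₁), inv_pow, hζ.pow_eq_one]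
      simp
  unfold FFn cf
  have e1 : ∀ u ∈ Finset.range (M * p₁), ((M * p₁ : ℕ) : ℂ)⁻¹ * (∑ i ∈ Finset.range M, (ζ⁻¹) ^ (2 * i * u)) * (∑ j : ZMod p₁, t j * (ζ⁻¹) ^ (M * j.val * u)) * (ζ ^ e) ^ u
      = ∑ i ∈ Finset.range M, ∑ j : ZMod p₁, ((M * p₁ : ℕ) : ℂ)⁻¹ * t j * (ζ ^ e * ζ⁻¹ ^ (2 * i + M * j.val)) ^ u := by
    intro u _
    rw [mul_assoc _ (∑ i ∈ Finset.range M, (ζ⁻¹) ^ (2 * i * u)), Finset.sum_mul_sum, Finset.mul_sum, Finset.sum_mul]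
    refine Finset.sum_congr rfl fun i _ => ?_
    rw [Finset.mul_sum, Finset.sum_mul]
    refine Finset.sum_congr rfl fun j _ => ?_
    rw [mul_pow, pow_add, mul_pow, ← pow_mul, ← pow_mul]
    ring
  rw [Finset.sum_congr rfl e1, Finset.sum_comm]
  refine Finset.sum_congr rfl fun i _ => ?_
  rw [Finset.sum_comm]
  refine Finset.sum_congr rfl fun j _ => ?_
  rw [← Finset.mul_sum, key]
  split_ifs
  · field_simp
  · simp

/-- the two functions -/
noncomputable def sM (p₁ : ℕ) [Fact p₁.Prime] (ε : ℂ) (j : ZMod p₁) : ℂ := (if j = 0 then 1 else 0) + ε * quadCharC p₁ j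

lemma cf_sM (p₁ M : ℕ) [hp₁ : Fact p₁.Prime] (h8 : p₁ % 8 = 3) (ζ : ℂ) (hζ : ζ ^ M = ZMod.stdAddChar (1 : ZMod p₁)) (ε : ℂ) (u : ℕ) :
    ∑ j : ZMod p₁, sM p₁ ε j * (ζ⁻¹) ^ (M * j.val * u) = 1 - ε * quadCharC p₁ (u : ZMod p₁) * GG p₁ := by
  have h1 : ∀ j : ZMod p₁, (ζ⁻¹) ^ (M * j.val * u) = ZMod.stdAddChar (-(u : ZMod p₁) * j) := by
    intro j
    rw [inv_pow, mul_assoc, pow_mul, hζ, ← std_pow, neg_mul, AddChar.map_neg_eq_inv]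
    push_cast
    simp [mul_comm]
  simp_rw [h1, sM, add_mul]
  rw [Finset.sum_add_distrib]
  have h2 : ∑ x : ZMod p₁, ε * quadCharC p₁ x * (ZMod.stdAddChar (-(u : ZMod p₁) * x) : ℂ) = ε * (quadCharC p₁ (-(u : ZMod p₁)) * GG p₁) := by
    rw [← quad_shift p₁ h8, Finset.mul_sum]
    exact Finset.sum_congr rfl fun x _ => by ring
  rw [h2, ← neg_one_mul, map_mul, quadCharC_neg_one p₁ h8]
  simp
  ring

end PartD2

section PartD3

lemma coef_rel (p₁ : ℕ) [hp₁ : Fact p₁.Prime] (h8 : p₁ % 8 = 3) (m : ℕ) (hm : 1 ≤ m)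
    (p : ℕ) [hp : Fact p.Prime] (hp2 : p % 2 = 1) (hp3 : 3 ≤ p) (hpp₁ : p < p₁)
    (F : Type*) [Field F] [Fintype F] [Algebra (ZMod p) F] (h2 : ringChar F ≠ 2)
    (ζ : ℂ) (hζ : IsPrimitiveRoot ζ (p₁ ^ m)) (hζM : ζ ^ (p₁ ^ (m - 1)) = ZMod.stdAddChar (1 : ZMod p₁))
    (γ : Fˣ) (hγ : ∀ x : Fˣ, x ∈ Subgroup.zpowers γ)
    (θ : MulChar F ℂ) (hθγ : θ (γ : F) = ζ) (hθn : θ ^ (p₁ ^ m) = 1) (A : ℂ) (hA : A ≠ 0)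
    (hg : ∀ u : ℕ, quadraticChar (ZMod p₁) (u : ZMod p₁) ≠ 0 →
      gaussSum (θ ^ u) (psiC p F) = A * (1 + quadCharC p₁ (u : ZMod p₁) * GG p₁))
    (u : ℕ) (hu : u < p₁ ^ m) :
    cf p₁ (p₁ ^ (m - 1)) ζ (sM p₁ (-1)) u * gaussSum (θ ^ u * etaC F) (psiC p F) =
      cf p₁ (p₁ ^ (m - 1)) ζ (sM p₁ 1) u * gaussSum (etaC F) (psiC p F) := by
  have hn0 : p₁ ^ m ≠ 0 := pow_ne_zero _ hp₁.out.ne_zero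
  have hz0 : ζ ≠ 0 := hζ.ne_zero hn0
  have hodd : Nat.Coprime 2 (p₁ ^ m) := by
    apply Nat.Coprime.pow_right
    exact Nat.coprime_two_left.mpr (Nat.odd_iff.mpr (by omega))
  have hz2 : ∀ v, ζ ^ (2 * v) = 1 → p₁ ^ m ∣ v := by
    intro v hv
    rw [hζ.pow_eq_one_iff_dvd] at hv
    exact hodd.symm.dvd_of_dvd_mul_left hv
  unfold cf
  rw [cf_sM p₁ _ h8 ζ hζM, cf_sM p₁ _ h8 ζ hζM]
  by_cases hq : quadraticChar (ZMod p₁) (u : ZMod p₁) = 0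
  · have hu0 : (u : ZMod p₁) = 0 := quadraticChar_eq_zero_iff.mp hq
    rw [hu0, quadCharC_zero]
    rcases Nat.eq_zero_or_pos u with rfl | hupos
    · simp
    · have hs : ∑ i ∈ Finset.range (p₁ ^ (m - 1)), (ζ⁻¹) ^ (2 * i * u) = 0 := by
        have e : ∀ i ∈ Finset.range (p₁ ^ (m - 1)), (ζ⁻¹) ^ (2 * i * u) = ((ζ⁻¹) ^ (2 * u)) ^ i := by
          intro i _; rw [← pow_mul]; congr 1; ring
        rw [Finset.sum_congr rfl e, geom_sum_eq]
        · rw [(ZMod.natCast_eq_zero_iff _ _)] at hu0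
          obtain ⟨c, rfl⟩ := hu0
          have : ((ζ⁻¹) ^ (2 * (p₁ * c))) ^ (p₁ ^ (m - 1)) = 1 := by
            rw [← pow_mul, show 2 * (p₁ * c) * p₁ ^ (m - 1) = p₁ ^ m * (2 * c) by
              rw [pow_succ_pred p₁ m hm]; ring, pow_mul, inv_pow, hζ.pow_eq_one]
            simp
          rw [this]; simp
        · intro h
          rw [inv_pow, inv_eq_one] at h
          exact absurd (Nat.le_of_dvd hupos (hz2 u h)) (by omega)
      rw [hs]; simp
  · have h4 : (θ ^ u) 4 = 1 := by
      have ht : ((4 : ℕ) : ZMod p) ≠ 0 := by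
        rw [Ne, ZMod.natCast_eq_zero_iff]
        intro h
        have : p ∣ 2 := hp.out.dvd_of_dvd_pow (show p ∣ 2 ^ 2 by norm_num; exact h)
        have := Nat.le_of_dvd (by norm_num) this
        omega
      have hcop : Nat.Coprime (p₁ ^ m) (p - 1) := by
        apply Nat.Coprime.pow_left
        rw [hp₁.out.coprime_iff_not_dvd]
        intro h
        have := Nat.le_of_dvd (by omega) h
        omega
      have := theta_prime_field p F (θ ^ u) (p₁ ^ m) hcop (by rw [← pow_mul, mul_comm, pow_mul, hθn, one_pow]) _ ht
      rwa [map_natCast, Nat.cast_ofNat] at this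
    have hsq : (θ ^ u) ^ 2 = θ ^ (2 * u) := by rw [← pow_mul, mul_comm]
    have hne : (θ ^ u) ^ 2 ≠ 1 := by
      rw [hsq]
      intro h
      have h1 : ζ ^ (2 * u) = 1 := by
        have := DFunLike.congr_fun h (γ : F)
        rwa [MulChar.pow_apply_coe, hθγ, MulChar.one_apply_coe] at this
      have h5 := hz2 u h1
      apply hq
      rw [quadraticChar_eq_zero_iff, ZMod.natCast_eq_zero_iff]
      exact (dvd_pow_self p₁ (by omega)).trans h5
    have key := gauss_eta p F h2 (θ ^ u) hne h4
    have hχ2 : quadCharC p₁ ((2 * u : ℕ) : ZMod p₁) = - quadCharC p₁ (u : ZMod p₁) := by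
      rw [quadCharC_eq, quadCharC_eq]
      push_cast
      rw [map_mul, quadChar_two p₁ h8]; push_cast; ring
    rw [hsq, hg u hq, hg (2 * u) (by push_cast; rw [map_mul, quadChar_two p₁ h8]; simpa using hq), hχ2] at key
    have key2 : gaussSum (θ ^ u * etaC F) (psiC p F) * (1 + quadCharC p₁ (u : ZMod p₁) * GG p₁) =
        gaussSum (etaC F) (psiC p F) * (1 - quadCharC p₁ (u : ZMod p₁) * GG p₁) := by
      apply mul_left_cancel₀ hA
      linear_combination key
    linear_combination (((p₁ ^ (m - 1) * p₁ : ℕ) : ℂ)⁻¹ * (∑ i ∈ Finset.range (p₁ ^ (m - 1)), (ζ⁻¹) ^ (2 * i * u))) * key2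

lemma eta_gen (F : Type*) [Field F] [Fintype F] (h2 : ringChar F ≠ 2)
    (γ : Fˣ) (hγ : ∀ x : Fˣ, x ∈ Subgroup.zpowers γ) : etaC F (γ : F) = -1 := by
  have h1 := etaC_ne_one F h2
  rcases quadraticChar_dichotomy (F := F) (a := (γ : F)) γ.ne_zero with h | h
  · exfalso; apply h1
    rw [MulChar.eq_iff hγ, etaC_apply, h, MulChar.one_apply_coe]; simp
  · rw [etaC_apply, h]; simp

lemma sum_units_F (F : Type*) [Field F] [Fintype F] (g : F → ℂ) : ∑ x : F, g x = g 0 + ∑ x : Fˣ, g (x : F) := by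
  rw [Fintype.sum_eq_add_sum_subtype_ne g 0]
  congr 1
  rw [← Equiv.sum_comp (unitsEquivNeZero (G₀ := F))]
  rfl

/-- the main exponential sum -/
lemma T_eval (p₁ : ℕ) [hp₁ : Fact p₁.Prime] (m : ℕ) (hm : 1 ≤ m)
    (p : ℕ) [hp : Fact p.Prime]
    (F : Type*) [Field F] [Fintype F] [Algebra (ZMod p) F] (h2 : ringChar F ≠ 2)
    (ζ : ℂ) (hζ : IsPrimitiveRoot ζ (p₁ ^ m))
    (γ : Fˣ) (hγ : ∀ x : Fˣ, x ∈ Subgroup.zpowers γ)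
    (θ : MulChar F ℂ) (hθγ : θ (γ : F) = ζ) (s s' : ZMod p₁ → ℂ)
    (hcf : ∀ u < p₁ ^ m, cf p₁ (p₁ ^ (m - 1)) ζ s u * gaussSum (θ ^ u * etaC F) (psiC p F) =
      cf p₁ (p₁ ^ (m - 1)) ζ s' u * gaussSum (etaC F) (psiC p F))
    (a e : ℕ) (hae : p₁ ^ m ∣ a + e) :
    ∑ x : Fˣ, etaC F (x : F) * (∑ u ∈ Finset.range (p₁ ^ m), cf p₁ (p₁ ^ (m - 1)) ζ s u * (θ (x : F)) ^ u) *
      psiC p F ((γ : F) ^ a * x) = (-1) ^ a * gaussSum (etaC F) (psiC p F) * FFn p₁ (p₁ ^ (m - 1)) s' e := by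
  have hn := pow_succ_pred p₁ m hm
  have hn0 : p₁ ^ m ≠ 0 := pow_ne_zero _ hp₁.out.ne_zero
  have hMpos : 0 < p₁ ^ (m - 1) := pow_pos hp₁.out.pos _
  have hz0 : ζ ≠ 0 := hζ.ne_zero hn0
  have hη : etaC F (γ : F) = -1 := eta_gen F h2 γ hγ
  have hsh : ∀ u, ∑ x : Fˣ, (θ ^ u * etaC F) (x : F) * psiC p F ((γ : F) ^ a * x) =
      (ζ ^ e) ^ u * (-1) ^ a * gaussSum (θ ^ u * etaC F) (psiC p F) := by
    intro u
    have h1 := gaussSum_mulShift (θ ^ u * etaC F) (psiC p F) (γ ^ a)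
    have h3 : gaussSum (θ ^ u * etaC F) ((psiC p F).mulShift ((γ ^ a : Fˣ) : F)) =
        ∑ x : Fˣ, (θ ^ u * etaC F) (x : F) * psiC p F ((γ : F) ^ a * x) := by
      unfold gaussSum
      rw [sum_units_F]
      rw [MulChar.map_nonunit _ (by simp), zero_mul, zero_add]
      simp [AddChar.mulShift_apply]
    rw [← h3, ← h1]
    have h4 : (θ ^ u * etaC F) ((γ ^ a : Fˣ) : F) = (ζ ^ u) ^ a * (-1) ^ a := by
      rw [Units.val_pow_eq_pow_val, map_pow, MulChar.mul_apply, MulChar.pow_apply_coe, hθγ, hη, mul_pow]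
    have h5 : (ζ ^ e) ^ u * (ζ ^ u) ^ a = 1 := by
      obtain ⟨c, hc⟩ := hae
      rw [← pow_mul, ← pow_mul, ← pow_add, show e * u + u * a = p₁ ^ m * (c * u) by
        rw [← mul_assoc, ← hc]; ring, pow_mul, hζ.pow_eq_one, one_pow]
    have h6 : ((-1 : ℂ) ^ a) * (-1) ^ a = 1 := by rw [← mul_pow]; simp
    rw [h4]
    have h7 : (ζ ^ e) ^ u * (ζ ^ u) ^ a * (((-1 : ℂ) ^ a) * (-1) ^ a) = 1 := by rw [h5, h6, one_mul]
    linear_combination (-(gaussSum (θ ^ u * etaC F) ((psiC p F).mulShift ((γ ^ a : Fˣ) : F)))) * h7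
  have hF := fourier_FFn p₁ (p₁ ^ (m - 1)) hMpos ζ (by rw [← hn]; exact hζ) s' e
  rw [← hn] at hF
  rw [← hF, Finset.mul_sum]
  have e1 : ∀ x : Fˣ, etaC F (x : F) * (∑ u ∈ Finset.range (p₁ ^ m), cf p₁ (p₁ ^ (m - 1)) ζ s u * (θ (x : F)) ^ u) *
      psiC p F ((γ : F) ^ a * x) = ∑ u ∈ Finset.range (p₁ ^ m), cf p₁ (p₁ ^ (m - 1)) ζ s u * ((θ ^ u * etaC F) (x : F) * psiC p F ((γ : F) ^ a * x)) := by
    intro x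
    rw [Finset.mul_sum, Finset.sum_mul]
    refine Finset.sum_congr rfl fun u _ => ?_
    rw [MulChar.mul_apply, MulChar.pow_apply_coe]; ring
  simp_rw [e1]
  rw [Finset.sum_comm]
  refine Finset.sum_congr rfl fun u hu => ?_
  rw [← Finset.mul_sum, hsh]
  linear_combination (ζ ^ e) ^ u * (-1) ^ a * hcf u (Finset.mem_range.mp hu)

end PartD3

section PartD4

lemma sM_dich (p₁ : ℕ) [hp₁ : Fact p₁.Prime] (ε : ℂ) (hε : ε = 1 ∨ ε = -1) (j : ZMod p₁) :
    sM p₁ ε j = 1 ∨ sM p₁ ε j = -1 := by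
  unfold sM
  rw [quadCharC_eq]
  by_cases hj : j = 0
  · left; simp [hj]
  · rcases quadraticChar_dichotomy hj with h | h <;> rcases hε with rfl | rfl <;> simp [hj, h]

lemma J_iff (p₁ : ℕ) [hp₁ : Fact p₁.Prime] (h8 : p₁ % 8 = 3) (m : ℕ) (hm : 1 ≤ m) (p f : ℕ) (hp2 : p % 2 = 1)
    (hf : orderOf (p : ZMod (p₁ ^ m)) = f) (h2f : 2 * f = Nat.totient (p₁ ^ m)) (hfo : f % 2 = 1)
    (J : Set (ZMod (2 * p₁)))
    (hJ : J = {x : ZMod (2 * p₁) | ∃ k : ℕ, x = (p : ZMod (2 * p₁)) ^ k} ∪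
      {x : ZMod (2 * p₁) | ∃ k : ℕ, x = 2 * (p : ZMod (2 * p₁)) ^ k} ∪ {0}) (v : ℕ) :
    (v : ZMod (2 * p₁)) ∈ J ↔ (-1 : ℂ) ^ v = sM p₁ (-1) (v : ZMod p₁) := by
  obtain ⟨hχp, horb⟩ := orbit_iff p₁ h8 m hm p f hf h2f hfo
  have hcop : Nat.Coprime 2 p₁ := Nat.coprime_two_left.mpr (Nat.odd_iff.mpr (by omega))
  have horb' : ∀ u v : ℕ, quadraticChar (ZMod p₁) (u : ZMod p₁) ≠ 0 →
      quadraticChar (ZMod p₁) (u : ZMod p₁) = quadraticChar (ZMod p₁) (v : ZMod p₁) →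
      ∃ i, v ≡ p ^ i * u [MOD p₁] := by
    intro u v h1 h2
    obtain ⟨i, -, hi⟩ := horb u v h1 h2
    refine ⟨i, ?_⟩
    have : ((v : ℕ) : ZMod (p₁ ^ m)) = ((p ^ i * u : ℕ) : ZMod (p₁ ^ m)) := by rw [hi]; push_cast; rfl
    rw [ZMod.natCast_eq_natCast_iff] at this
    exact this.of_dvd (dvd_pow_self p₁ (by omega))
  have hpk : ∀ k, p ^ k % 2 = 1 := fun k => Nat.odd_iff.mp ((Nat.odd_iff.mpr hp2).pow)
  have hmem : (v : ZMod (2 * p₁)) ∈ J ↔ (∃ k, v ≡ p ^ k [MOD 2 * p₁]) ∨ (∃ k, v ≡ 2 * p ^ k [MOD 2 * p₁]) ∨ v ≡ 0 [MOD 2 * p₁] := by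
    rw [hJ]
    simp only [Set.mem_union, Set.mem_setOf_eq, Set.mem_singleton_iff, or_assoc, ← ZMod.natCast_eq_natCast_iff]
    push_cast
    rfl
  rw [hmem]
  simp only [← Nat.modEq_and_modEq_iff_modEq_mul hcop]
  have hsz : (v : ZMod p₁) = 0 → sM p₁ (-1) (v : ZMod p₁) = 1 := by
    intro h; rw [h]; unfold sM; rw [quadCharC_zero]; simp
  have hs1 : quadraticChar (ZMod p₁) (v : ZMod p₁) = 1 → sM p₁ (-1) (v : ZMod p₁) = -1 := by
    intro h
    have : (v : ZMod p₁) ≠ 0 := by intro h0; rw [h0] at h; simp at h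
    unfold sM; rw [quadCharC_eq, h, if_neg this]; simp
  have hs2 : quadraticChar (ZMod p₁) (v : ZMod p₁) = -1 → sM p₁ (-1) (v : ZMod p₁) = 1 := by
    intro h
    have : (v : ZMod p₁) ≠ 0 := by intro h0; rw [h0] at h; simp at h
    unfold sM; rw [quadCharC_eq, h, if_neg this]; simp
  have hev : v % 2 = 0 → (-1 : ℂ) ^ v = 1 := fun h => (Nat.even_iff.mpr h).neg_one_pow
  have hod : v % 2 = 1 → (-1 : ℂ) ^ v = -1 := fun h => (Nat.odd_iff.mpr h).neg_one_pow
  constructor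
  · rintro (⟨k, h1, h2⟩ | ⟨k, h1, h2⟩ | ⟨h1, h2⟩)
    · have h3 : v % 2 = 1 := by rw [h1, hpk]
      rw [hod h3, hs1]
      rw [← ZMod.natCast_eq_natCast_iff] at h2
      rw [h2]; push_cast; rw [map_pow, hχp, one_pow]
    · have h3 : v % 2 = 0 := by rw [h1]; omega
      rw [hev h3, hs2]
      rw [← ZMod.natCast_eq_natCast_iff] at h2
      rw [h2]; push_cast; rw [map_mul, map_pow, hχp, one_pow, quadChar_two p₁ h8]; rfl
    · have h3 : v % 2 = 0 := by rw [h1]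
      rw [hev h3, hsz]
      rw [← ZMod.natCast_eq_natCast_iff] at h2
      simpa using h2
  · intro h
    by_cases hv0 : (v : ZMod p₁) = 0
    · right; right
      rw [hsz hv0] at h
      refine ⟨?_, ?_⟩
      · rcases Nat.mod_two_eq_zero_or_one v with h3 | h3
        · exact h3
        · rw [hod h3] at h; norm_num at h
      · rw [← ZMod.natCast_eq_natCast_iff]; simpa using hv0
    · rcases quadraticChar_dichotomy hv0 with hc | hc
      · left
        rw [hs1 hc] at h
        obtain ⟨i, hi⟩ := horb' 1 v (by simp) (by rw [hc]; simp)
        refine ⟨i, ?_, by simpa using hi⟩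
        rcases Nat.mod_two_eq_zero_or_one v with h3 | h3
        · rw [hev h3] at h; norm_num at h
        · unfold Nat.ModEq; rw [h3, hpk]
      · right; left
        rw [hs2 hc] at h
        have h22 : quadraticChar (ZMod p₁) ((2 : ℕ) : ZMod p₁) = -1 := by exact_mod_cast quadChar_two p₁ h8
        obtain ⟨i, hi⟩ := horb' 2 v (by rw [h22]; simp) (by rw [h22, hc])
        refine ⟨i, ?_, by rw [mul_comm]; exact hi⟩
        rcases Nat.mod_two_eq_zero_or_one v with h3 | h3
        · unfold Nat.ModEq; rw [h3]; omega
        · rw [hod h3] at h; norm_num at h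

lemma D_mem (p₁ : ℕ) [hp₁ : Fact p₁.Prime] (h8 : p₁ % 8 = 3) (m : ℕ) (hm : 1 ≤ m)
    (F : Type*) [Field F] [Fintype F]
    (γ : Fˣ) (hγ : ∀ x : Fˣ, x ∈ Subgroup.zpowers γ) (hN : 2 * p₁ ^ m ∣ Fintype.card F - 1)
    (J : Set (ZMod (2 * p₁)))
    (hJ : ∀ v : ℕ, (v : ZMod (2 * p₁)) ∈ J ↔ (-1 : ℂ) ^ v = sM p₁ (-1) (v : ZMod p₁)) (e : ℕ) :
    (((γ ^ e : Fˣ) : F) ∈ (⋃ i < p₁ ^ (m - 1), ⋃ j ∈ J,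
              cycClass γ (2 * p₁ ^ m) (2 * i + p₁ ^ (m - 1) * ZMod.val j))) ↔
     (-1 : ℂ) ^ e = FFn p₁ (p₁ ^ (m - 1)) (sM p₁ (-1)) e := by
  have hn := pow_succ_pred p₁ m hm
  have hMo : p₁ ^ (m - 1) % 2 = 1 := Nat.odd_iff.mp ((Nat.odd_iff.mpr (by omega : p₁ % 2 = 1)).pow)
  have hord : orderOf γ = Fintype.card F - 1 := by
    rw [orderOf_eq_card_of_forall_mem_zpowers hγ, Nat.card_eq_fintype_card, Fintype.card_units]
  haveI : NeZero (2 * p₁) := ⟨mul_ne_zero two_ne_zero hp₁.out.ne_zero⟩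
  set M := p₁ ^ (m - 1) with hM
  have hpar : ∀ i v e : ℕ, e ≡ 2 * i + M * v [MOD 2] → (-1 : ℂ) ^ e = (-1) ^ v := by
    intro i v e h
    have h1 : e % 2 = v % 2 := by
      rw [h, Nat.add_mod, Nat.mul_mod M v, hMo]; simp
    rw [neg_one_pow_eq_pow_mod_two, h1, ← neg_one_pow_eq_pow_mod_two]
  have hv' : ∀ v : ℕ, M * v ≡ M * ((v : ZMod p₁)).val [MOD M * p₁] := by
    intro v
    rw [ZMod.val_natCast]
    exact Nat.ModEq.mul_left' M (Nat.mod_modEq _ _).symm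
  simp only [Set.mem_iUnion, cycClass, Set.mem_setOf_eq]
  constructor
  · rintro ⟨i, hi, j, hj, k, hk⟩
    have hk2 : γ ^ e = γ ^ (((2 * i + M * j.val : ℕ) : ℤ) + ((2 * p₁ ^ m : ℕ) : ℤ) * k) := Units.ext hk
    rw [← zpow_natCast, zpow_eq_zpow_iff_modEq, hord] at hk2
    have h1 : (e : ℤ) ≡ ((2 * i + M * j.val : ℕ) : ℤ) [ZMOD ((2 * p₁ ^ m : ℕ) : ℤ)] := by
      have := hk2.of_dvd (Int.natCast_dvd_natCast.mpr hN)
      refine this.trans ?_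
      simp [Int.ModEq]
    rw [Int.natCast_modEq_iff] at h1
    rw [hpar i j.val e (h1.of_dvd (dvd_mul_right _ _))]
    rw [FFn_eq p₁ M hMo _ e i hi (j.val : ZMod p₁)]
    · rw [← hJ]; simpa using hj
    · have := h1.of_dvd (dvd_mul_left _ _)
      rw [hn] at this
      exact this.trans ((hv' _).add_left _)
  · intro h
    obtain ⟨i, hi, j, hj⟩ := beta_surj p₁ M hMo e
    rw [FFn_eq p₁ M hMo _ e i hi j hj] at h
    have hjl := ZMod.val_lt j
    obtain ⟨v, hv1, hv2, hv3⟩ : ∃ v < 2 * p₁, (v : ZMod p₁) = j ∧ v % 2 = e % 2 := by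
      by_cases hc : j.val % 2 = e % 2
      · exact ⟨j.val, by omega, by simp, hc⟩
      · exact ⟨j.val + p₁, by omega, by simp, by omega⟩
    have hvJ : (v : ZMod (2 * p₁)) ∈ J := by
      rw [hJ, hv2, ← h, neg_one_pow_eq_pow_mod_two, hv3, ← neg_one_pow_eq_pow_mod_two]
    have hval : ((v : ZMod (2 * p₁))).val = v := ZMod.val_cast_of_lt hv1
    have h1 : e ≡ 2 * i + M * v [MOD 2 * p₁ ^ m] := by
      rw [← Nat.modEq_and_modEq_iff_modEq_mul (Nat.coprime_two_left.mpr ((Nat.odd_iff.mpr (by omega : p₁ % 2 = 1)).pow))]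
      constructor
      · unfold Nat.ModEq
        rw [Nat.add_mod, Nat.mul_mod M v, hMo]; simp [hv3]
      · rw [hn]
        refine hj.trans ?_
        have := (hv' v).symm.add_left (2 * i)
        rwa [hv2] at this
    obtain ⟨k, hk⟩ := Nat.modEq_iff_dvd.mp h1
    refine ⟨i, hi, _, hvJ, -k, ?_⟩
    rw [hval]
    congr 1
    rw [← zpow_natCast]
    congr 1
    linear_combination -hk

end PartD4

section PartD5

lemma FFn_dich (p₁ M : ℕ) [hp₁ : Fact p₁.Prime] (hM : M % 2 = 1) (ε : ℂ) (hε : ε = 1 ∨ ε = -1) (e : ℕ) :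
    FFn p₁ M (sM p₁ ε) e = 1 ∨ FFn p₁ M (sM p₁ ε) e = -1 := by
  obtain ⟨i, hi, j, hj⟩ := beta_surj p₁ M hM e
  rw [FFn_eq p₁ M hM _ e i hi j hj]
  exact sM_dich p₁ ε hε j

lemma FFn_zero (p₁ M : ℕ) [hp₁ : Fact p₁.Prime] (hM : M % 2 = 1) (ε : ℂ) (e : ℕ) (he : M * p₁ ∣ e) :
    FFn p₁ M (sM p₁ ε) e = 1 := by
  rw [FFn_eq p₁ M hM _ e 0 (by omega) 0 (by simpa [Nat.modEq_zero_iff_dvd] using he)]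
  unfold sM; rw [quadCharC_zero]; simp

lemma sum_eval (p₁ : ℕ) [hp₁ : Fact p₁.Prime] (h8 : p₁ % 8 = 3) (m : ℕ) (hm : 1 ≤ m)
    (p : ℕ) [hp : Fact p.Prime]
    (F : Type*) [Field F] [Fintype F] [Algebra (ZMod p) F] (h2 : ringChar F ≠ 2)
    (ζ : ℂ) (hζ : IsPrimitiveRoot ζ (p₁ ^ m))
    (γ : Fˣ) (hγ : ∀ x : Fˣ, x ∈ Subgroup.zpowers γ)
    (θ : MulChar F ℂ) (hθγ : θ (γ : F) = ζ) (D : Set F) (hD0 : (0 : F) ∉ D)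
    (hD : ∀ e : ℕ, ((γ ^ e : Fˣ) : F) ∈ D ↔ (-1 : ℂ) ^ e = FFn p₁ (p₁ ^ (m - 1)) (sM p₁ (-1)) e)
    (hcf : ∀ u < p₁ ^ m, cf p₁ (p₁ ^ (m - 1)) ζ (sM p₁ (-1)) u * gaussSum (θ ^ u * etaC F) (psiC p F) =
      cf p₁ (p₁ ^ (m - 1)) ζ (sM p₁ 1) u * gaussSum (etaC F) (psiC p F))
    (a e : ℕ) (hae : p₁ ^ m ∣ a + e) :
    ∑ᶠ x ∈ D, psi p ((γ : F) ^ a * x) =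
      (-1 + (-1) ^ a * FFn p₁ (p₁ ^ (m - 1)) (sM p₁ 1) e * gaussSum (etaC F) (psiC p F)) / 2 := by
  have hn := pow_succ_pred p₁ m hm
  have hMo : p₁ ^ (m - 1) % 2 = 1 := Nat.odd_iff.mp ((Nat.odd_iff.mpr (by omega : p₁ % 2 = 1)).pow)
  have hT := T_eval p₁ m hm p F h2 ζ hζ γ hγ θ hθγ _ _ hcf a e hae
  have hη : etaC F (γ : F) = -1 := eta_gen F h2 γ hγ
  have h1 : ∑ᶠ x ∈ D, psi p ((γ : F) ^ a * x) = ∑ x : F, if x ∈ D then psiC p F ((γ : F) ^ a * x) else 0 := by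
    rw [finsum_mem_def, finsum_eq_sum_of_fintype]
    refine Finset.sum_congr rfl fun x _ => ?_
    rw [Set.indicator_apply]
    congr 1
    rw [psiC_eq_exp]; rfl
  have h3 : ∑ x : Fˣ, psiC p F ((γ : F) ^ a * x) = -1 := by
    have h4 := sum_units_F F (fun x => psiC p F ((γ : F) ^ a * x))
    have h5 : ∑ x : F, psiC p F ((γ : F) ^ a * x) = 0 := by
      have := AddChar.sum_eq_zero_of_ne_one (psiC_prim p F (pow_ne_zero a γ.ne_zero))
      simpa [AddChar.mulShift_apply] using this
    rw [h5] at h4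
    simp only [mul_zero, AddChar.map_zero_eq_one] at h4
    linear_combination -h4
  have h6 : ∀ x : Fˣ, (if (x : F) ∈ D then psiC p F ((γ : F) ^ a * x) else 0) =
     (psiC p F ((γ : F) ^ a * x) + etaC F (x : F) * (∑ u ∈ Finset.range (p₁ ^ m), cf p₁ (p₁ ^ (m - 1)) ζ (sM p₁ (-1)) u * (θ (x : F)) ^ u) *
      psiC p F ((γ : F) ^ a * x)) / 2 := by
    intro x
    obtain ⟨b, hb⟩ := (mem_powers_iff_mem_zpowers).mpr (hγ x)
    simp only at hb
    subst hb
    have hF := fourier_FFn p₁ (p₁ ^ (m - 1)) (by omega) ζ (by rw [← hn]; exact hζ) (sM p₁ (-1)) b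
    rw [← hn] at hF
    have e1 : θ ((γ ^ b : Fˣ) : F) = ζ ^ b := by rw [Units.val_pow_eq_pow_val, map_pow, hθγ]
    have e2 : etaC F ((γ ^ b : Fˣ) : F) = (-1) ^ b := by rw [Units.val_pow_eq_pow_val, map_pow, hη]
    rw [e1, e2, hF]
    simp only [hD]
    rcases neg_one_pow_eq_or ℂ b with h | h <;>
    rcases FFn_dich p₁ (p₁ ^ (m - 1)) hMo (-1) (Or.inr rfl) b with h' | h' <;> rw [h, h'] <;> norm_num
  rw [h1, sum_units_F, if_neg hD0, zero_add, Finset.sum_congr rfl fun x _ => h6 x, ← Finset.sum_div,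
    Finset.sum_add_distrib, h3, hT]
  ring

lemma gauss_sq (p f : ℕ) [hp : Fact p.Prime] (hp2 : p % 2 = 1) (hfo : f % 2 = 1)
    (F : Type*) [Field F] [Fintype F] [Algebra (ZMod p) F] (h2 : ringChar F ≠ 2) (hcard : Fintype.card F = p ^ f) :
    gaussSum (etaC F) (psiC p F) ^ 2 = (-1 : ℂ) ^ ((p - 1) / 2) * (p : ℂ) ^ f := by
  have h := gauss_mul_inv p F (etaC F) (etaC_ne_one F h2)
  have hi : (etaC F)⁻¹ = etaC F := by
    rw [inv_eq_iff_mul_eq_one, ← pow_two, etaC_sq]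
  rw [hi, ← pow_two, etaC_apply, quadraticChar_neg_one h2, hcard, ZMod.χ₄_eq_neg_one_pow (by
    exact Nat.odd_iff.mp ((Nat.odd_iff.mpr hp2).pow))] at h
  rw [h]
  push_cast
  congr 1
  rw [neg_one_pow_eq_pow_mod_two, neg_one_pow_eq_pow_mod_two ((p - 1) / 2)]
  congr 1
  -- p ^ f mod 4 = p mod 4
  have hpf : p ^ f % 4 = p % 4 := by
    obtain ⟨c, hc⟩ : ∃ c, f = 2 * c + 1 := ⟨f / 2, by omega⟩
    have h4 : p ^ 2 ≡ 1 [MOD 4] := by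
      have : p % 4 = 1 ∨ p % 4 = 3 := by omega
      unfold Nat.ModEq
      rcases this with h | h <;> simp [Nat.pow_mod, h]
    have := ((h4.pow c).mul_right p)
    rw [← pow_mul, ← pow_succ, ← hc, one_pow, one_mul] at this
    exact this
  omega

end PartD5

/-- Theorem 3.4 of the paper: the character sums `ψ(γ^a D)` take exactly the
two values `(-1 ± (-1)^{(p-1)(m-1)/2} w)/2`, where `w` is the principal square root of
`(-1)^{(p-1)/2} p^f` in `ℂ`. -/
theorem statement_15 (p₁ m : ℕ) (hp₁ : p₁.Prime) (hp₁mod : p₁ % 8 = 3) (hp₁ne : p₁ ≠ 3)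
    (hm : 1 ≤ m) (N : ℕ) (hN : N = 2 * p₁ ^ m)
    -- `h` is the class number of `ℚ(√-p₁)`
    (K : Type*) [Field K] [NumberField K] (α : K)
    (hα : α ^ 2 = -(p₁ : K)) (hKα : Algebra.adjoin ℚ {α} = ⊤)
    (h : ℕ) (hh : h = NumberField.classNumber K)
    (p : ℕ) (hp : p.Prime) (hcl : 1 + p₁ = 4 * p ^ h)
    (f : ℕ) (hf : f = orderOf ((p : ZMod N))) (hford : 2 * f = Nat.totient N)
    (F : Type*) [Field F] [Fintype F] [Algebra (ZMod p) F]
    (hcard : Fintype.card F = p ^ f)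
    -- `J = ⟨p⟩ ∪ 2⟨p⟩ ∪ {0} ⊆ Z_{2p₁}`
    (J : Set (ZMod (2 * p₁)))
    (hJ : J = {x : ZMod (2 * p₁) | ∃ k : ℕ, x = (p : ZMod (2 * p₁)) ^ k} ∪
      {x : ZMod (2 * p₁) | ∃ k : ℕ, x = 2 * (p : ZMod (2 * p₁)) ^ k} ∪ {0})
    -- `w` is the principal square root of `(-1)^{(p-1)/2}·p^f` in `ℂ`, and
    -- `ε = (-1)^{(p-1)(m-1)/2}`
    (w : ℂ) (hw : w = ((-1 : ℂ) ^ ((p - 1) / 2) * (p : ℂ) ^ f) ^ ((1 : ℂ) / 2))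
    (ε : ℂ) (hε : ε = (-1 : ℂ) ^ ((p - 1) * (m - 1) / 2)) :
    ∃ γ : Fˣ, (∀ x : Fˣ, x ∈ Subgroup.zpowers γ) ∧
      ({z : ℂ | ∃ a : ℕ, a < p ^ f - 1 ∧
          z = ∑ᶠ x ∈ (⋃ i < p₁ ^ (m - 1), ⋃ j ∈ J,
              cycClass γ N (2 * i + p₁ ^ (m - 1) * ZMod.val j)),
            psi p ((γ : F) ^ a * x)} =
        {(-1 + ε * w) / 2, (-1 - ε * w) / 2}) ∧
      (-1 + ε * w) / 2 ≠ (-1 - ε * w) / 2 := by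
  subst hh
  haveI : Fact p₁.Prime := ⟨hp₁⟩
  haveI : Fact p.Prime := ⟨hp⟩
  subst hN
  have hn := pow_succ_pred p₁ m hm
  have hn0 : p₁ ^ m ≠ 0 := pow_ne_zero _ hp₁.ne_zero
  haveI : NeZero (p₁ ^ m) := ⟨hn0⟩
  obtain ⟨hp2, hp3, hpp₁⟩ := basic_p p₁ p _ hp₁ hp₁mod hp₁ne hp hcl
  have hMo : p₁ ^ (m - 1) % 2 = 1 := Nat.odd_iff.mp ((Nat.odd_iff.mpr (by omega : p₁ % 2 = 1)).pow)
  have hno : p₁ ^ m % 2 = 1 := Nat.odd_iff.mp ((Nat.odd_iff.mpr (by omega : p₁ % 2 = 1)).pow)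
  have hcop : Nat.Coprime 2 (p₁ ^ m) := Nat.coprime_two_left.mpr (Nat.odd_iff.mpr hno)
  have h2f : 2 * f = Nat.totient (p₁ ^ m) := by
    rw [hford, Nat.totient_mul hcop]; simp
  have hfo : f % 2 = 1 := by
    rw [Nat.totient_prime_pow hp₁ (by omega)] at h2f
    obtain ⟨c, hc⟩ : ∃ c, p₁ - 1 = 2 * (2 * c + 1) := ⟨p₁ / 4, by omega⟩
    rw [hc] at h2f
    have h5 : f = p₁ ^ (m - 1) * (2 * c + 1) := by
      apply Nat.eq_of_mul_eq_mul_left (show 0 < 2 by norm_num)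
      rw [h2f]; ring
    rw [h5, Nat.mul_mod, hMo]; omega
  have hford' : orderOf (p : ZMod (p₁ ^ m)) = f := by
    let e := ZMod.chineseRemainder hcop
    have h1 : orderOf (e (p : ZMod (2 * p₁ ^ m))) = orderOf (p : ZMod (2 * p₁ ^ m)) :=
      orderOf_injective (e : ZMod (2 * p₁ ^ m) →* ZMod 2 × ZMod (p₁ ^ m)) e.injective _
    have h2 : e (p : ZMod (2 * p₁ ^ m)) = ((p : ZMod 2), (p : ZMod (p₁ ^ m))) := by
      rw [map_natCast]; rfl
    have h3 : (p : ZMod 2) = 1 := by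
      rw [ZMod.natCast_eq_one_iff_odd]; exact Nat.odd_iff.mpr hp2
    rw [hf, ← h1, h2, Prod.orderOf, h3]
    simp
  have h2 : ringChar F ≠ 2 := by
    haveI : CharP F p := charP_of_injective_algebraMap (algebraMap (ZMod p) F).injective p
    rw [ringChar.eq F p]; omega
  have hpf1 : 1 ≤ p ^ f := Nat.one_le_pow _ _ hp.pos
  have hNdvd : 2 * p₁ ^ m ∣ p ^ f - 1 := by
    have : (p : ZMod (2 * p₁ ^ m)) ^ f = 1 := by rw [hf, pow_orderOf_eq_one]
    have h2 : ((p ^ f : ℕ) : ZMod (2 * p₁ ^ m)) = ((1 : ℕ) : ZMod (2 * p₁ ^ m)) := by push_cast; exact this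
    rw [ZMod.natCast_eq_natCast_iff] at h2
    exact (Nat.modEq_iff_dvd' (by omega)).mp h2.symm
  have hndvd : p₁ ^ m ∣ p ^ f - 1 := (dvd_mul_left _ _).trans hNdvd
  have hpfgt : 1 < p ^ f := Nat.one_lt_pow (by omega) (by omega)
  have hnlt : p₁ ^ m < p ^ f - 1 := by
    have := Nat.le_of_dvd (by omega) hNdvd
    have : 0 < p₁ ^ m := Nat.pos_of_ne_zero hn0
    omega
  obtain ⟨γ, θ, A, hγ, hθγ, hθn, hA, hg⟩ := theta_exists p₁ hp₁mod hp₁ne m hm K α hα hKα p f hcl hford' h2f hfo F hcard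
  have hζ := zeta_prim (p₁ ^ m)
  have hζM := zeta_pow_M p₁ m hm
  set ζ : ℂ := ZMod.stdAddChar (1 : ZMod (p₁ ^ m)) with hζdef
  have hcf := coef_rel p₁ hp₁mod m hm p hp2 hp3 hpp₁ F h2 ζ hζ hζM γ hγ θ hθγ hθn A hA hg
  have hJ' := J_iff p₁ hp₁mod m hm p f hp2 hford' h2f hfo J hJ
  have hD := D_mem p₁ hp₁mod m hm F γ hγ (by rw [hcard]; exact hNdvd) J hJ'
  have hS := sum_eval p₁ hp₁mod m hm p F h2 ζ hζ γ hγ θ hθγ _ (by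
    simp only [Set.mem_iUnion, cycClass, Set.mem_setOf_eq]
    rintro ⟨i, hi, j, hj, k, hk⟩
    exact Units.ne_zero _ hk.symm) hD hcf
  have hgsq := gauss_sq p f hp2 hfo F h2 hcard
  set g := gaussSum (etaC F) (psiC p F) with hgdef
  have hwsq : w ^ 2 = g ^ 2 := by
    rw [hgsq, hw, one_div]
    exact_mod_cast Complex.cpow_nat_inv_pow _ (two_ne_zero)
  have hp0 : (p : ℂ) ≠ 0 := by exact_mod_cast hp.ne_zero
  have hg0 : g ≠ 0 := by
    intro h0
    rw [h0] at hgsq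
    have : (-1 : ℂ) ^ ((p - 1) / 2) * (p : ℂ) ^ f ≠ 0 := mul_ne_zero (pow_ne_zero _ (by norm_num)) (pow_ne_zero _ hp0)
    apply this; rw [← hgsq]; norm_num
  have hεw : ε * w = g ∨ ε * w = -g := by
    rw [← sq_eq_sq_iff_eq_or_eq_neg, mul_pow, hwsq, hε, ← pow_mul, mul_comm _ 2, pow_mul]
    norm_num
  refine ⟨γ, hγ, ?_, ?_⟩
  · have hset : ({(-1 + ε * w) / 2, (-1 - ε * w) / 2} : Set ℂ) = {(-1 + g) / 2, (-1 - g) / 2} := by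
      rcases hεw with h | h
      · rw [h]
      · rw [h, Set.pair_comm]; congr 1
        ring
    rw [hset]
    ext z
    simp only [Set.mem_setOf_eq, Set.mem_insert_iff, Set.mem_singleton_iff]
    constructor
    · rintro ⟨a, ha, rfl⟩
      rw [hS a (p ^ f - 1 - a) (by rw [Nat.add_sub_cancel' (by omega)]; exact hndvd)]
      rcases neg_one_pow_eq_or ℂ a with h | h <;>
      rcases FFn_dich p₁ (p₁ ^ (m - 1)) hMo 1 (Or.inl rfl) (p ^ f - 1 - a) with h' | h' <;> rw [h, h'] <;> ring_nf <;> simp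
    · rintro (rfl | rfl)
      · refine ⟨0, by omega, ?_⟩
        rw [hS 0 0 (by simp), FFn_zero p₁ _ hMo 1 0 (by simp)]
        simp
      · refine ⟨p₁ ^ m, hnlt, ?_⟩
        rw [hS (p₁ ^ m) 0 (by simp), FFn_zero p₁ _ hMo 1 0 (by simp), (Nat.odd_iff.mpr hno).neg_one_pow]
        ring
  · intro h
    have : ε * w = 0 := by linear_combination h
    rcases hεw with h' | h' <;> rw [this] at h'
    · exact hg0 h'.symm
    · exact hg0 (neg_eq_zero.mp h'.symm)
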